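/- arXiv:1410.8223 — 6 statements merged into one kernel-verified Lean document; each statement's English description precedes it below -/
import Mathlib

section
/- Let ε_n = γ_n − α_n = w_n/z_n − y_n/x_n. Then for every integer n ≥ 2, one has β_{n+1} − α_{n+1} < ε_n^2, γ_{n+1} − β_{n+1} < ε_n^2, and consequently ε_{n+1} < 2 ε_n^2. -/
open Filter Topology Real

namespace HanoiAux

noncomputable def fX (x y z w : ℝ) : ℝ :=
  8 * (x)^3 + 24 * (x)^2 * y + 6 * (x)^2 * z + 30 * x * (y)^2 + 18 * x * y * z + 3 * x * (z)^2 + 14 * (y)^3 + 15 * (y)^2 * z + 6 * y * (z)^2 + (z)^3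

noncomputable def fY (x y z w : ℝ) : ℝ :=
  8 * (x)^2 * y + 8 * (x)^2 * z + 2 * (x)^2 * w + 16 * x * (y)^2 + 24 * x * y * z + 6 * x * y * w + 6 * x * (z)^2 + 2 * x * z * w + 10 * (y)^3 + 20 * (y)^2 * z + 5 * (y)^2 * w + 11 * y * (z)^2 + 4 * y * z * w + 2 * (z)^3 + (z)^2 * w

noncomputable def fZ (x y z w : ℝ) : ℝ :=
  8 * x * (y)^2 + 16 * x * y * z + 4 * x * y * w + 10 * x * (z)^2 + 6 * x * z * w + x * (w)^2 + 8 * (y)^3 + 22 * (y)^2 * z + 6 * (y)^2 * w + 20 * y * (z)^2 + 12 * y * z * w + 2 * y * (w)^2 + 5 * (z)^3 + 4 * (z)^2 * w + z * (w)^2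

noncomputable def fW (x y z w : ℝ) : ℝ :=
  8 * (y)^3 + 24 * (y)^2 * z + 6 * (y)^2 * w + 30 * y * (z)^2 + 18 * y * z * w + 3 * y * (w)^2 + 14 * (z)^3 + 15 * (z)^2 * w + 6 * z * (w)^2 + (w)^3

set_option maxRecDepth 100000 in
set_option maxHeartbeats 4000000 in
lemma low1 (a s t : ℝ) (ha : 0 < a) (hs : 0 < s) (ht : 0 < t) :
    0 < fX 1 a (a*(a+s)) (a*(a+s)*(a+s+t)) * fZ 1 a (a*(a+s)) (a*(a+s)*(a+s+t)) - (fY 1 a (a*(a+s)) (a*(a+s)*(a+s+t)))^2 := by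
  simp only [fX, fY, fZ, fW]
  ring_nf
  positivity

set_option maxRecDepth 100000 in
set_option maxHeartbeats 4000000 in
lemma low2 (a s t : ℝ) (ha : 0 < a) (hs : 0 < s) (ht : 0 < t) :
    0 < fY 1 a (a*(a+s)) (a*(a+s)*(a+s+t)) * fW 1 a (a*(a+s)) (a*(a+s)*(a+s+t)) - (fZ 1 a (a*(a+s)) (a*(a+s)*(a+s+t)))^2 := by
  simp only [fX, fY, fZ, fW]
  ring_nf
  positivity

set_option maxRecDepth 100000 in
set_option maxHeartbeats 4000000 in
lemma up1 (a s t : ℝ) (ha : 0 < a) (hs : 0 < s) (ht : 0 < t) :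
    0 < (s+t)^2 * (fX 1 a (a*(a+s)) (a*(a+s)*(a+s+t)) * fY 1 a (a*(a+s)) (a*(a+s)*(a+s+t))) - (fX 1 a (a*(a+s)) (a*(a+s)*(a+s+t)) * fZ 1 a (a*(a+s)) (a*(a+s)*(a+s+t)) - (fY 1 a (a*(a+s)) (a*(a+s)*(a+s+t)))^2) := by
  simp only [fX, fY, fZ, fW]
  ring_nf
  positivity

set_option maxRecDepth 100000 in
set_option maxHeartbeats 4000000 in
lemma up2 (a s t : ℝ) (ha : 0 < a) (hs : 0 < s) (ht : 0 < t) :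
    0 < (s+t)^2 * (fY 1 a (a*(a+s)) (a*(a+s)*(a+s+t)) * fZ 1 a (a*(a+s)) (a*(a+s)*(a+s+t))) - (fY 1 a (a*(a+s)) (a*(a+s)*(a+s+t)) * fW 1 a (a*(a+s)) (a*(a+s)*(a+s+t)) - (fZ 1 a (a*(a+s)) (a*(a+s)*(a+s+t)))^2) := by
  simp only [fX, fY, fZ, fW]
  ring_nf
  positivity

lemma homX (k x y z w : ℝ) : fX (k*x) (k*y) (k*z) (k*w) = k^3 * fX x y z w := by
  simp only [fX]; ring

lemma homY (k x y z w : ℝ) : fY (k*x) (k*y) (k*z) (k*w) = k^3 * fY x y z w := by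
  simp only [fY]; ring

lemma homZ (k x y z w : ℝ) : fZ (k*x) (k*y) (k*z) (k*w) = k^3 * fZ x y z w := by
  simp only [fZ]; ring

lemma homW (k x y z w : ℝ) : fW (k*x) (k*y) (k*z) (k*w) = k^3 * fW x y z w := by
  simp only [fW]; ring

lemma div_sub_eq {X Y Z : ℝ} (hX : 0 < X) (hY : 0 < Y) :
    Z / Y - Y / X = (X * Z - Y^2) / (X * Y) := by
  field_simp

/-- One step of the recursion, under strict monotonicity of the ratios. -/
lemma step (x y z w : ℝ) (hx : 0 < x) (hy : 0 < y) (hz : 0 < z)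
    (h1 : y / x < z / y) (h2 : z / y < w / z) :
    0 < fX x y z w ∧ 0 < fY x y z w ∧ 0 < fZ x y z w ∧
    fY x y z w / fX x y z w < fZ x y z w / fY x y z w ∧
    fZ x y z w / fY x y z w < fW x y z w / fZ x y z w ∧
    fZ x y z w / fY x y z w - fY x y z w / fX x y z w < (w / z - y / x)^2 ∧
    fW x y z w / fZ x y z w - fZ x y z w / fY x y z w < (w / z - y / x)^2 := by
  obtain ⟨a, ha⟩ : ∃ a, a = y / x := ⟨_, rfl⟩
  obtain ⟨s, hs⟩ : ∃ s, s = z / y - y / x := ⟨_, rfl⟩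
  obtain ⟨t, ht⟩ : ∃ t, t = w / z - z / y := ⟨_, rfl⟩
  have ha0 : 0 < a := by rw [ha]; positivity
  have hs0 : 0 < s := by linarith
  have ht0 : 0 < t := by linarith
  have e1 : y = x * a := by rw [ha]; field_simp
  have e2 : z = x * (a * (a + s)) := by
    have : a + s = z / y := by linarith
    rw [this, ha]; field_simp
  have e3 : w = x * (a * (a + s) * (a + s + t)) := by
    have h : a + s + t = w / z := by linarith
    have h' : a + s = z / y := by linarith
    rw [h, h', ha]; field_simp
  have e4 : w / z - y / x = s + t := by linarith
  have e0 : x = x * 1 := by ring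
  have hw : 0 < w := by rw [e3]; positivity
  have pX : 0 < fX x y z w := by unfold fX; positivity
  have pY : 0 < fY x y z w := by unfold fY; positivity
  have pZ : 0 < fZ x y z w := by unfold fZ; positivity
  have eX : fX x y z w = x^3 * fX 1 a (a*(a+s)) (a*(a+s)*(a+s+t)) := by
    rw [← homX x 1 a (a*(a+s)) (a*(a+s)*(a+s+t)), ← e1, ← e2, ← e3, mul_one]
  have eY : fY x y z w = x^3 * fY 1 a (a*(a+s)) (a*(a+s)*(a+s+t)) := by
    rw [← homY x 1 a (a*(a+s)) (a*(a+s)*(a+s+t)), ← e1, ← e2, ← e3, mul_one]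
  have eZ : fZ x y z w = x^3 * fZ 1 a (a*(a+s)) (a*(a+s)*(a+s+t)) := by
    rw [← homZ x 1 a (a*(a+s)) (a*(a+s)*(a+s+t)), ← e1, ← e2, ← e3, mul_one]
  have eW : fW x y z w = x^3 * fW 1 a (a*(a+s)) (a*(a+s)*(a+s+t)) := by
    rw [← homW x 1 a (a*(a+s)) (a*(a+s)*(a+s+t)), ← e1, ← e2, ← e3, mul_one]
  have l1 := mul_pos (pow_pos hx 6) (low1 a s t ha0 hs0 ht0)
  have l2 := mul_pos (pow_pos hx 6) (low2 a s t ha0 hs0 ht0)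
  have u1 := mul_pos (pow_pos hx 6) (up1 a s t ha0 hs0 ht0)
  have u2 := mul_pos (pow_pos hx 6) (up2 a s t ha0 hs0 ht0)
  rw [e4]
  generalize fX x y z w = X at *
  generalize fY x y z w = Y at *
  generalize fZ x y z w = Z at *
  generalize fW x y z w = W at *
  generalize fX 1 a (a*(a+s)) (a*(a+s)*(a+s+t)) = X' at *
  generalize fY 1 a (a*(a+s)) (a*(a+s)*(a+s+t)) = Y' at *
  generalize fZ 1 a (a*(a+s)) (a*(a+s)*(a+s+t)) = Z' at *
  generalize fW 1 a (a*(a+s)) (a*(a+s)*(a+s+t)) = W' at *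
  have l1' : 0 < X * Z - Y^2 := by rw [eX, eY, eZ]; linarith
  have l2' : 0 < Y * W - Z^2 := by rw [eW, eY, eZ]; linarith
  have u1' : X * Z - Y^2 < (s+t)^2 * (X * Y) := by rw [eX, eY, eZ]; linarith
  have u2' : Y * W - Z^2 < (s+t)^2 * (Y * Z) := by rw [eW, eY, eZ]; linarith
  refine ⟨pX, pY, pZ, ?_, ?_, ?_, ?_⟩
  · rw [← sub_pos, div_sub_eq pX pY]; positivity
  · rw [← sub_pos, div_sub_eq pY pZ]; positivity
  · rw [div_sub_eq pX pY, div_lt_iff₀ (by positivity)]; exact u1'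
  · rw [div_sub_eq pY pZ, div_lt_iff₀ (by positivity)]; exact u2'

end HanoiAux

open HanoiAux

theorem hanoi_eps_squared
    (x y z w : ℕ → ℝ)
    (hx0 : x 0 = 1) (hy0 : y 0 = 0) (hz0 : z 0 = 1) (hw0 : w 0 = 0)
    (hx : ∀ n : ℕ, x (n + 1) = 8 * (x n)^3 + 24 * (x n)^2 * y n + 6 * (x n)^2 * z n + 30 * x n * (y n)^2 + 18 * x n * y n * z n + 3 * x n * (z n)^2 + 14 * (y n)^3 + 15 * (y n)^2 * z n + 6 * y n * (z n)^2 + (z n)^3)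
    (hy : ∀ n : ℕ, y (n + 1) = 8 * (x n)^2 * y n + 8 * (x n)^2 * z n + 2 * (x n)^2 * w n + 16 * x n * (y n)^2 + 24 * x n * y n * z n + 6 * x n * y n * w n + 6 * x n * (z n)^2 + 2 * x n * z n * w n + 10 * (y n)^3 + 20 * (y n)^2 * z n + 5 * (y n)^2 * w n + 11 * y n * (z n)^2 + 4 * y n * z n * w n + 2 * (z n)^3 + (z n)^2 * w n)
    (hz : ∀ n : ℕ, z (n + 1) = 8 * x n * (y n)^2 + 16 * x n * y n * z n + 4 * x n * y n * w n + 10 * x n * (z n)^2 + 6 * x n * z n * w n + x n * (w n)^2 + 8 * (y n)^3 + 22 * (y n)^2 * z n + 6 * (y n)^2 * w n + 20 * y n * (z n)^2 + 12 * y n * z n * w n + 2 * y n * (w n)^2 + 5 * (z n)^3 + 4 * (z n)^2 * w n + z n * (w n)^2)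
    (hw : ∀ n : ℕ, w (n + 1) = 8 * (y n)^3 + 24 * (y n)^2 * z n + 6 * (y n)^2 * w n + 30 * y n * (z n)^2 + 18 * y n * z n * w n + 3 * y n * (w n)^2 + 14 * (z n)^3 + 15 * (z n)^2 * w n + 6 * z n * (w n)^2 + (w n)^3) :
    ∀ n : ℕ, 2 ≤ n → z (n + 1) / y (n + 1) - y (n + 1) / x (n + 1) < (w n / z n - y n / x n)^2 ∧ w (n + 1) / z (n + 1) - z (n + 1) / y (n + 1) < (w n / z n - y n / x n)^2 ∧ w (n + 1) / z (n + 1) - y (n + 1) / x (n + 1) < 2 * (w n / z n - y n / x n)^2 := by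
  have gx : ∀ n, x (n+1) = fX (x n) (y n) (z n) (w n) := hx
  have gy : ∀ n, y (n+1) = fY (x n) (y n) (z n) (w n) := hy
  have gz : ∀ n, z (n+1) = fZ (x n) (y n) (z n) (w n) := hz
  have gw : ∀ n, w (n+1) = fW (x n) (y n) (z n) (w n) := hw
  have x1 : x 1 = 18 := by rw [gx 0, hx0, hy0, hz0, hw0]; norm_num [fX]
  have y1 : y 1 = 16 := by rw [gy 0, hx0, hy0, hz0, hw0]; norm_num [fY]
  have z1 : z 1 = 15 := by rw [gz 0, hx0, hy0, hz0, hw0]; norm_num [fZ]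
  have w1 : w 1 = 14 := by rw [gw 0, hx0, hy0, hz0, hw0]; norm_num [fW]
  have x2 : x 2 = 568301 := by rw [gx 1, x1, y1, z1, w1]; norm_num [fX]
  have y2 : y 2 = 521504 := by rw [gy 1, x1, y1, z1, w1]; norm_num [fY]
  have z2 : z 2 = 478579 := by rw [gz 1, x1, y1, z1, w1]; norm_num [fZ]
  have w2 : w 2 = 439204 := by rw [gw 1, x1, y1, z1, w1]; norm_num [fW]
  have inv : ∀ n, 2 ≤ n → 0 < x n ∧ 0 < y n ∧ 0 < z n ∧ y n / x n < z n / y n ∧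
      z n / y n < w n / z n := by
    intro n hn
    induction n, hn using Nat.le_induction with
    | base => rw [x2, y2, z2, w2]; norm_num
    | succ n hn ih =>
      obtain ⟨i1, i2, i3, i4, i5⟩ := ih
      obtain ⟨j1, j2, j3, j4, j5, -⟩ := step _ _ _ _ i1 i2 i3 i4 i5
      rw [gx, gy, gz, gw]
      exact ⟨j1, j2, j3, j4, j5⟩
  intro n hn
  obtain ⟨i1, i2, i3, i4, i5⟩ := inv n hn
  obtain ⟨-, -, -, -, -, j6, j7⟩ := step _ _ _ _ i1 i2 i3 i4 i5
  rw [gx, gy, gz, gw]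
  exact ⟨j6, j7, by linarith⟩
end

section
/- For all integers n ≥ k ≥ 2, the total number m_n = x_n + 3y_n + 3z_n + w_n of matchings of H_n satisfies x_k^(3^(n−k)) · (α_k^2 + 2α_k + 2)^(3·(3^(n−k)−1)/2) · (1 + α_n)^3 < m_n < x_k^(3^(n−k)) · (β_k^2 + 2β_k + 2)^(3·(3^(n−k)−1)/2) · (1 + γ_n)^3, where α_n = y_n/x_n, β_n = z_n/y_n, γ_n = w_n/z_n. -/
open Filter Topology Real

set_option maxHeartbeats 4000000

/-! With `y = a x`, `z = a (a+e) x`, `w = a (a+e) (a+e+r e) x` one step of the recursion gives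
`x^3` times the polynomials `hX, hY, hZ, hW` below. -/

noncomputable def hX (a e r : ℝ) : ℝ :=
  8 * 1 + 24 * 1 * a + 6 * 1 * (a*(a+e)) + 30 * 1 * a^2 + 18 * 1 * a * (a*(a+e)) + 3 * 1 * (a*(a+e))^2 + 14 * a^3 + 15 * a^2 * (a*(a+e)) + 6 * a * (a*(a+e))^2 + (a*(a+e))^3

noncomputable def hY (a e r : ℝ) : ℝ :=
  8 * 1 * a + 8 * 1 * (a*(a+e)) + 2 * 1 * (a*(a+e)*(a+e+r*e)) + 16 * 1 * a^2 + 24 * 1 * a * (a*(a+e)) + 6 * 1 * a * (a*(a+e)*(a+e+r*e)) + 6 * 1 * (a*(a+e))^2 + 2 * 1 * (a*(a+e)) * (a*(a+e)*(a+e+r*e)) + 10 * a^3 + 20 * a^2 * (a*(a+e)) + 5 * a^2 * (a*(a+e)*(a+e+r*e)) + 11 * a * (a*(a+e))^2 + 4 * a * (a*(a+e)) * (a*(a+e)*(a+e+r*e)) + 2 * (a*(a+e))^3 + (a*(a+e))^2 * (a*(a+e)*(a+e+r*e))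

noncomputable def hZ (a e r : ℝ) : ℝ :=
  8 * 1 * a^2 + 16 * 1 * a * (a*(a+e)) + 4 * 1 * a * (a*(a+e)*(a+e+r*e)) + 10 * 1 * (a*(a+e))^2 + 6 * 1 * (a*(a+e)) * (a*(a+e)*(a+e+r*e)) + 1 * (a*(a+e)*(a+e+r*e))^2 + 8 * a^3 + 22 * a^2 * (a*(a+e)) + 6 * a^2 * (a*(a+e)*(a+e+r*e)) + 20 * a * (a*(a+e))^2 + 12 * a * (a*(a+e)) * (a*(a+e)*(a+e+r*e)) + 2 * a * (a*(a+e)*(a+e+r*e))^2 + 5 * (a*(a+e))^3 + 4 * (a*(a+e))^2 * (a*(a+e)*(a+e+r*e)) + (a*(a+e)) * (a*(a+e)*(a+e+r*e))^2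

noncomputable def hW (a e r : ℝ) : ℝ :=
  8 * a^3 + 24 * a^2 * (a*(a+e)) + 6 * a^2 * (a*(a+e)*(a+e+r*e)) + 30 * a * (a*(a+e))^2 + 18 * a * (a*(a+e)) * (a*(a+e)*(a+e+r*e)) + 3 * a * (a*(a+e)*(a+e+r*e))^2 + 14 * (a*(a+e))^3 + 15 * (a*(a+e))^2 * (a*(a+e)*(a+e+r*e)) + 6 * (a*(a+e)) * (a*(a+e)*(a+e+r*e))^2 + (a*(a+e)*(a+e+r*e))^3

theorem hL1 (a e r : ℝ) : hY a e r - a * hX a e r = e *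
      (((8 * a + 22 * a^2 + 26 * a^3 + 17 * a^4 + 6 * a^5 + 1 * a^6) + (2 * a^2 + 6 * a^3 + 7 * a^4 + 4 * a^5 + 1 * a^6) * r)
      + ((2 * a + 12 * a^2 + 19 * a^3 + 12 * a^4 + 3 * a^5) + (2 * a + 6 * a^2 + 9 * a^3 + 8 * a^4 + 3 * a^5) * r) * e
      + ((2 * a^2 + 6 * a^3 + 3 * a^4) + (2 * a^2 + 4 * a^3 + 3 * a^4) * r) * e^2
      + ((1 * a^3) + (1 * a^3) * r) * e^3) := by
  unfold hY hX; ring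

theorem hL2 (a e r : ℝ) : (a + e) * hY a e r - hZ a e r = e * ((((8 * a + 16 * a^2 + 14 * a^3 + 6 * a^4 + 1 * a^5))) - (((2 * a^3 + 6 * a^4 + 7 * a^5 + 4 * a^6 + 1 * a^7) * r))
      + e * ((((8 * a + 16 * a^2 + 12 * a^3 + 3 * a^4))
      + ((2 * a + 6 * a^2 + 3 * a^3) + (2 * a) * r) * e
      + ((1 * a^2)) * e^2)
      - (((6 * a^3 + 14 * a^4 + 12 * a^5 + 4 * a^6) * r + (1 * a^4 + 2 * a^5 + 1 * a^6) * r^2)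
      + ((7 * a^3 + 12 * a^4 + 6 * a^5) * r + (2 * a^3 + 4 * a^4 + 3 * a^5) * r^2) * e
      + ((4 * a^3 + 4 * a^4) * r + (1 * a^2 + 2 * a^3 + 3 * a^4) * r^2) * e^2
      + ((1 * a^3) * r + (1 * a^3) * r^2) * e^3))) := by
  unfold hY hZ; ring

noncomputable def hp0 (a e r : ℝ) : ℝ :=
  (((16 * a^2 + 48 * a^3 + 68 * a^4 + 56 * a^5 + 28 * a^6 + 8 * a^7 + 1 * a^8) + (16 * a^3 + 56 * a^4 + 88 * a^5 + 80 * a^6 + 44 * a^7 + 14 * a^8 + 2 * a^9) * r + (4 * a^4 + 16 * a^5 + 28 * a^6 + 28 * a^7 + 17 * a^8 + 6 * a^9 + 1 * a^10) * r^2))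

noncomputable def hP1 (a e r : ℝ) : ℝ :=
  (((16 * a^2 + 60 * a^3 + 84 * a^4 + 62 * a^5 + 24 * a^6 + 4 * a^7) + (16 * a^2 + 64 * a^3 + 132 * a^4 + 156 * a^5 + 110 * a^6 + 44 * a^7 + 8 * a^8) * r + (8 * a^3 + 32 * a^4 + 62 * a^5 + 70 * a^6 + 49 * a^7 + 20 * a^8 + 4 * a^9) * r^2)
      + ((4 * a^2 + 28 * a^3 + 40 * a^4 + 24 * a^5 + 6 * a^6) + (8 * a^2 + 44 * a^3 + 88 * a^4 + 88 * a^5 + 48 * a^6 + 12 * a^7) * r + (4 * a^2 + 16 * a^3 + 40 * a^4 + 56 * a^5 + 48 * a^6 + 24 * a^7 + 6 * a^8) * r^2) * e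
      + ((6 * a^3 + 8 * a^4 + 4 * a^5) + (12 * a^3 + 22 * a^4 + 20 * a^5 + 8 * a^6) * r + (6 * a^3 + 14 * a^4 + 17 * a^5 + 12 * a^6 + 4 * a^7) * r^2) * e^2
      + ((1 * a^4) + (2 * a^4 + 2 * a^5) * r + (1 * a^4 + 2 * a^5 + 1 * a^6) * r^2) * e^3)

noncomputable def hQ1 (a e r : ℝ) : ℝ :=
  (((48 * a^4 + 136 * a^5 + 168 * a^6 + 112 * a^7 + 40 * a^8 + 6 * a^9) + (16 * a^4 + 116 * a^5 + 260 * a^6 + 302 * a^7 + 200 * a^8 + 74 * a^9 + 12 * a^10) * r + (8 * a^5 + 60 * a^6 + 132 * a^7 + 150 * a^8 + 98 * a^9 + 36 * a^10 + 6 * a^11) * r^2 + (6 * a^7 + 14 * a^8 + 15 * a^9 + 8 * a^10 + 2 * a^11) * r^3)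
      + ((68 * a^4 + 168 * a^5 + 168 * a^6 + 80 * a^7 + 15 * a^8) + (60 * a^4 + 256 * a^5 + 426 * a^6 + 360 * a^7 + 160 * a^8 + 30 * a^9) * r + (4 * a^4 + 72 * a^5 + 220 * a^6 + 306 * a^7 + 228 * a^8 + 90 * a^9 + 15 * a^10) * r^2 + (18 * a^6 + 50 * a^7 + 63 * a^8 + 38 * a^9 + 10 * a^10) * r^3 + (1 * a^8 + 2 * a^9 + 1 * a^10) * r^4) * e
      + ((56 * a^4 + 112 * a^5 + 80 * a^6 + 20 * a^7) + (84 * a^4 + 266 * a^5 + 320 * a^6 + 180 * a^7 + 40 * a^8) * r + (28 * a^4 + 156 * a^5 + 298 * a^6 + 272 * a^7 + 120 * a^8 + 20 * a^9) * r^2 + (18 * a^5 + 66 * a^6 + 103 * a^7 + 72 * a^8 + 20 * a^9) * r^3 + (4 * a^7 + 8 * a^8 + 4 * a^9) * r^4) * e^2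
      + ((28 * a^4 + 40 * a^5 + 15 * a^6) + (62 * a^4 + 140 * a^5 + 110 * a^6 + 30 * a^7) * r + (40 * a^4 + 138 * a^5 + 173 * a^6 + 90 * a^7 + 15 * a^8) * r^2 + (6 * a^4 + 38 * a^5 + 81 * a^6 + 68 * a^7 + 20 * a^8) * r^3 + (6 * a^6 + 12 * a^7 + 6 * a^8) * r^4) * e^3
      + ((8 * a^4 + 6 * a^5) + (24 * a^4 + 34 * a^5 + 12 * a^6) * r + (24 * a^4 + 54 * a^5 + 36 * a^6 + 6 * a^7) * r^2 + (8 * a^4 + 30 * a^5 + 32 * a^6 + 10 * a^7) * r^3 + (4 * a^5 + 8 * a^6 + 4 * a^7) * r^4) * e^4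
      + ((1 * a^4) + (4 * a^4 + 2 * a^5) * r + (6 * a^4 + 6 * a^5 + 1 * a^6) * r^2 + (4 * a^4 + 6 * a^5 + 2 * a^6) * r^3 + (1 * a^4 + 2 * a^5 + 1 * a^6) * r^4) * e^5)

theorem hp_eq (a e r : ℝ) : hZ a e r * hX a e r - hY a e r ^ 2 = e^2 * (hp0 a e r + e * hP1 a e r) := by
  unfold hZ hX hY hp0 hP1; ring

theorem hq_eq (a e r : ℝ) : hW a e r * hY a e r - hZ a e r ^ 2 = e^2 * (a^2 * hp0 a e r + e * hQ1 a e r) := by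
  unfold hZ hW hY hp0 hQ1; ring

theorem h_pos (a e r : ℝ) (ha : 0 < a) (he : 0 < e) (hr : 0 ≤ r) :
    0 < hX a e r ∧ 0 < hY a e r ∧ 0 < hZ a e r ∧ 0 < hW a e r ∧ 0 < hp0 a e r ∧ 0 ≤ hP1 a e r ∧
      0 ≤ hQ1 a e r := by
  refine ⟨?_, ?_, ?_, ?_, ?_, ?_, ?_⟩
  · unfold hX; positivity
  · unfold hY; positivity
  · unfold hZ; positivity
  · unfold hW; positivity
  · unfold hp0; positivity
  · unfold hP1; positivity
  · unfold hQ1; positivity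

theorem hL1_nonneg (a e r : ℝ) (ha : 0 < a) (he : 0 < e) (hr : 0 ≤ r) : a * hX a e r ≤ hY a e r := by
  have h := hL1 a e r
  have : 0 ≤ hY a e r - a * hX a e r := by rw [h]; positivity
  linarith

theorem hL2_nonneg (a e r : ℝ) (ha : 9/10 ≤ a) (ha2 : a ≤ 92/100) (he : 0 < e) (he2 : e ≤ 4/100000)
    (hr : 0 ≤ r) (hr2 : r ≤ 2) : hZ a e r ≤ (a + e) * hY a e r := by
  have ha0 : 0 < a := by linarith
  have h := hL2 a e r
  have he3 : e ≤ 1/1000 := by linarith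
  have h1 : (((8 * (9/10) + 16 * (9/10)^2 + 14 * (9/10)^3 + 6 * (9/10)^4 + 1 * (9/10)^5))) ≤ (((8 * a + 16 * a^2 + 14 * a^3 + 6 * a^4 + 1 * a^5))) := by gcongr
  have h2 : (((2 * a^3 + 6 * a^4 + 7 * a^5 + 4 * a^6 + 1 * a^7) * r)) ≤ (((2 * (92/100)^3 + 6 * (92/100)^4 + 7 * (92/100)^5 + 4 * (92/100)^6 + 1 * (92/100)^7) * 2)) := by gcongr
  have h3 : (((6 * a^3 + 14 * a^4 + 12 * a^5 + 4 * a^6) * r + (1 * a^4 + 2 * a^5 + 1 * a^6) * r^2)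
      + ((7 * a^3 + 12 * a^4 + 6 * a^5) * r + (2 * a^3 + 4 * a^4 + 3 * a^5) * r^2) * e
      + ((4 * a^3 + 4 * a^4) * r + (1 * a^2 + 2 * a^3 + 3 * a^4) * r^2) * e^2
      + ((1 * a^3) * r + (1 * a^3) * r^2) * e^3) ≤ (100:ℝ) := by
    calc (((6 * a^3 + 14 * a^4 + 12 * a^5 + 4 * a^6) * r + (1 * a^4 + 2 * a^5 + 1 * a^6) * r^2)
      + ((7 * a^3 + 12 * a^4 + 6 * a^5) * r + (2 * a^3 + 4 * a^4 + 3 * a^5) * r^2) * e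
      + ((4 * a^3 + 4 * a^4) * r + (1 * a^2 + 2 * a^3 + 3 * a^4) * r^2) * e^2
      + ((1 * a^3) * r + (1 * a^3) * r^2) * e^3) ≤ (((6 * (92/100:ℝ)^3 + 14 * (92/100:ℝ)^4 + 12 * (92/100:ℝ)^5 + 4 * (92/100:ℝ)^6) * 2 + (1 * (92/100:ℝ)^4 + 2 * (92/100:ℝ)^5 + 1 * (92/100:ℝ)^6) * 2^2)
      + ((7 * (92/100:ℝ)^3 + 12 * (92/100:ℝ)^4 + 6 * (92/100:ℝ)^5) * 2 + (2 * (92/100:ℝ)^3 + 4 * (92/100:ℝ)^4 + 3 * (92/100:ℝ)^5) * 2^2) * (1/1000)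
      + ((4 * (92/100:ℝ)^3 + 4 * (92/100:ℝ)^4) * 2 + (1 * (92/100:ℝ)^2 + 2 * (92/100:ℝ)^3 + 3 * (92/100:ℝ)^4) * 2^2) * (1/1000)^2
      + ((1 * (92/100:ℝ)^3) * 2 + (1 * (92/100:ℝ)^3) * 2^2) * (1/1000)^3) := by
          gcongr
      _ ≤ 100 := by norm_num
  have h4 : 0 ≤ (((8 * a + 16 * a^2 + 12 * a^3 + 3 * a^4))
      + ((2 * a + 6 * a^2 + 3 * a^3) + (2 * a) * r) * e
      + ((1 * a^2)) * e^2) := by positivity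
  have h5 : e * (((6 * a^3 + 14 * a^4 + 12 * a^5 + 4 * a^6) * r + (1 * a^4 + 2 * a^5 + 1 * a^6) * r^2)
      + ((7 * a^3 + 12 * a^4 + 6 * a^5) * r + (2 * a^3 + 4 * a^4 + 3 * a^5) * r^2) * e
      + ((4 * a^3 + 4 * a^4) * r + (1 * a^2 + 2 * a^3 + 3 * a^4) * r^2) * e^2
      + ((1 * a^3) * r + (1 * a^3) * r^2) * e^3) ≤ 4/100000 * 100 := by
    apply mul_le_mul he2 h3 <;> positivity
  have h6 : 0 ≤ e * (((8 * a + 16 * a^2 + 12 * a^3 + 3 * a^4))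
      + ((2 * a + 6 * a^2 + 3 * a^3) + (2 * a) * r) * e
      + ((1 * a^2)) * e^2) := by positivity
  have : 0 ≤ (a + e) * hY a e r - hZ a e r := by
    rw [h]
    apply mul_nonneg he.le
    rw [mul_sub]
    norm_num at h1 h2
    linarith
  linarith

theorem hq_le_hp (a e r : ℝ) (ha : 9/10 ≤ a) (ha2 : a ≤ 92/100) (he : 0 < e) (he2 : e ≤ 4/100000)
    (hr : 0 ≤ r) (hr2 : r ≤ 2) :
    hW a e r * hY a e r - hZ a e r ^ 2 ≤ hZ a e r * hX a e r - hY a e r ^ 2 := by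
  have ha0 : 0 < a := by linarith
  obtain ⟨_, _, _, _, hp0p, hP1p, hQ1p⟩ := h_pos a e r ha0 he hr
  have he3 : e ≤ 1/1000 := by linarith
  rw [hp_eq, hq_eq]
  apply mul_le_mul_of_nonneg_left _ (by positivity)
  have h1 : hQ1 a e r ≤ 10000 := by
    unfold hQ1
    calc _ ≤ (((48 * (92/100:ℝ)^4 + 136 * (92/100:ℝ)^5 + 168 * (92/100:ℝ)^6 + 112 * (92/100:ℝ)^7 + 40 * (92/100:ℝ)^8 + 6 * (92/100:ℝ)^9) + (16 * (92/100:ℝ)^4 + 116 * (92/100:ℝ)^5 + 260 * (92/100:ℝ)^6 + 302 * (92/100:ℝ)^7 + 200 * (92/100:ℝ)^8 + 74 * (92/100:ℝ)^9 + 12 * (92/100:ℝ)^10) * 2 + (8 * (92/100:ℝ)^5 + 60 * (92/100:ℝ)^6 + 132 * (92/100:ℝ)^7 + 150 * (92/100:ℝ)^8 + 98 * (92/100:ℝ)^9 + 36 * (92/100:ℝ)^10 + 6 * (92/100:ℝ)^11) * 2^2 + (6 * (92/100:ℝ)^7 + 14 * (92/100:ℝ)^8 + 15 * (92/100:ℝ)^9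 + 8 * (92/100:ℝ)^10 + 2 * (92/100:ℝ)^11) * 2^3)
      + ((68 * (92/100:ℝ)^4 + 168 * (92/100:ℝ)^5 + 168 * (92/100:ℝ)^6 + 80 * (92/100:ℝ)^7 + 15 * (92/100:ℝ)^8) + (60 * (92/100:ℝ)^4 + 256 * (92/100:ℝ)^5 + 426 * (92/100:ℝ)^6 + 360 * (92/100:ℝ)^7 + 160 * (92/100:ℝ)^8 + 30 * (92/100:ℝ)^9) * 2 + (4 * (92/100:ℝ)^4 + 72 * (92/100:ℝ)^5 + 220 * (92/100:ℝ)^6 + 306 * (92/100:ℝ)^7 + 228 * (92/100:ℝ)^8 + 90 * (92/100:ℝ)^9 + 15 * (92/100:ℝ)^10) * 2^2 + (18 * (92/100:ℝ)^6 + 50 * (92/100:ℝ)^7 + 63 * (92/100:ℝ)^8 + 38 * (92/100:ℝ)^9 + 10 * (92/100:ℝ)^10) * 2^3 + (1 * (92/100:ℝ)^8 + 2 * (92/100:ℝ)^9 + 1 * (92/100:ℝ)^10) * 2^4) * (1/1000)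
      + ((56 * (92/100:ℝ)^4 + 112 * (92/100:ℝ)^5 + 80 * (92/100:ℝ)^6 + 20 * (92/100:ℝ)^7) + (84 * (92/100:ℝ)^4 + 266 * (92/100:ℝ)^5 + 320 * (92/100:ℝ)^6 + 180 * (92/100:ℝ)^7 + 40 * (92/100:ℝ)^8) * 2 + (28 * (92/100:ℝ)^4 + 156 * (92/100:ℝ)^5 + 298 * (92/100:ℝ)^6 + 272 * (92/100:ℝ)^7 + 120 * (92/100:ℝ)^8 + 20 * (92/100:ℝ)^9) * 2^2 + (18 * (92/100:ℝ)^5 + 66 * (92/100:ℝ)^6 + 103 * (92/100:ℝ)^7 + 72 * (92/100:ℝ)^8 + 20 * (92/100:ℝ)^9) * 2^3 + (4 * (92/100:ℝ)^7 + 8 * (92/100:ℝ)^8 + 4 * (92/100:ℝ)^9) * 2^4) * (1/1000)^2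
      + ((28 * (92/100:ℝ)^4 + 40 * (92/100:ℝ)^5 + 15 * (92/100:ℝ)^6) + (62 * (92/100:ℝ)^4 + 140 * (92/100:ℝ)^5 + 110 * (92/100:ℝ)^6 + 30 * (92/100:ℝ)^7) * 2 + (40 * (92/100:ℝ)^4 + 138 * (92/100:ℝ)^5 + 173 * (92/100:ℝ)^6 + 90 * (92/100:ℝ)^7 + 15 * (92/100:ℝ)^8) * 2^2 + (6 * (92/100:ℝ)^4 + 38 * (92/100:ℝ)^5 + 81 * (92/100:ℝ)^6 + 68 * (92/100:ℝ)^7 + 20 * (92/100:ℝ)^8) * 2^3 + (6 * (92/100:ℝ)^6 + 12 * (92/100:ℝ)^7 + 6 * (92/100:ℝ)^8) * 2^4) * (1/1000)^3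
      + ((8 * (92/100:ℝ)^4 + 6 * (92/100:ℝ)^5) + (24 * (92/100:ℝ)^4 + 34 * (92/100:ℝ)^5 + 12 * (92/100:ℝ)^6) * 2 + (24 * (92/100:ℝ)^4 + 54 * (92/100:ℝ)^5 + 36 * (92/100:ℝ)^6 + 6 * (92/100:ℝ)^7) * 2^2 + (8 * (92/100:ℝ)^4 + 30 * (92/100:ℝ)^5 + 32 * (92/100:ℝ)^6 + 10 * (92/100:ℝ)^7) * 2^3 + (4 * (92/100:ℝ)^5 + 8 * (92/100:ℝ)^6 + 4 * (92/100:ℝ)^7) * 2^4) * (1/1000)^4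
      + ((1 * (92/100:ℝ)^4) + (4 * (92/100:ℝ)^4 + 2 * (92/100:ℝ)^5) * 2 + (6 * (92/100:ℝ)^4 + 6 * (92/100:ℝ)^5 + 1 * (92/100:ℝ)^6) * 2^2 + (4 * (92/100:ℝ)^4 + 6 * (92/100:ℝ)^5 + 2 * (92/100:ℝ)^6) * 2^3 + (1 * (92/100:ℝ)^4 + 2 * (92/100:ℝ)^5 + 1 * (92/100:ℝ)^6) * 2^4) * (1/1000)^5) := by
          gcongr
      _ ≤ 10000 := by norm_num
  have h2 : (20:ℝ) ≤ hp0 a e r := by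
    have h3 : hp0 a e r = (16 * a^2 + 48 * a^3) + (hp0 a e r - (16 * a^2 + 48 * a^3)) := by ring
    have h4 : 0 ≤ hp0 a e r - (16 * a^2 + 48 * a^3) := by
      have : hp0 a e r - (16 * a^2 + 48 * a^3) = (((68 * a^4 + 56 * a^5 + 28 * a^6 + 8 * a^7 + 1 * a^8) + (16 * a^3 + 56 * a^4 + 88 * a^5 + 80 * a^6 + 44 * a^7 + 14 * a^8 + 2 * a^9) * r + (4 * a^4 + 16 * a^5 + 28 * a^6 + 28 * a^7 + 17 * a^8 + 6 * a^9 + 1 * a^10) * r^2)) := by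
        unfold hp0; ring
      rw [this]; positivity
    have h5 : 16 * (9/10)^2 + 48 * (9/10)^3 ≤ 16 * a^2 + 48 * a^3 := by gcongr
    norm_num at h5
    linarith
  have h6 : e * hQ1 a e r ≤ 4/100000 * 10000 := by
    apply mul_le_mul he2 h1 <;> positivity
  have h7 : 0 ≤ e * hP1 a e r := by positivity
  have h8 : a^2 ≤ (92/100)^2 := by gcongr
  have h9 : a^2 * hp0 a e r ≤ (92/100)^2 * hp0 a e r := by gcongr
  linarith

def HInv (x y z w a e r : ℝ) : Prop :=
  0 < x ∧ y = a * x ∧ z = a * (a + e) * x ∧ w = a * (a + e) * (a + e + r * e) * x ∧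
    9/10 ≤ a ∧ a + e ≤ 92/100 ∧ 0 < e ∧ e ≤ 4/100000 ∧ 0 ≤ r ∧ r ≤ 2

theorem step_inv (X Y Z W x a e r : ℝ) (hx : 0 < x)
    (h1 : 9/10 ≤ a) (h2 : a + e ≤ 92/100) (h3 : 0 < e) (h4 : e ≤ 4/100000) (h5 : 0 ≤ r) (h6 : r ≤ 2)
    (hX' : X = x^3 * hX a e r) (hY' : Y = x^3 * hY a e r)
    (hZ' : Z = x^3 * hZ a e r) (hW' : W = x^3 * hW a e r) :
    ∃ a' e' r', HInv X Y Z W a' e' r' ∧ a ≤ a' ∧ a' + e' ≤ a + e := by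
  have ha0 : 0 < a := by linarith
  have ha2 : a ≤ 92/100 := by linarith
  obtain ⟨pX, pY, pZ, pW, hp0p, hP1p, hQ1p⟩ := h_pos a e r ha0 h3 h5
  have l1 := hL1_nonneg a e r ha0 h3 h5
  have l2 := hL2_nonneg a e r h1 ha2 h3 h4 h5 h6
  have l3 := hq_le_hp a e r h1 ha2 h3 h4 h5 h6
  have l4 : 0 < hZ a e r * hX a e r - hY a e r ^ 2 := by rw [hp_eq]; positivity
  have l5 : 0 ≤ hW a e r * hY a e r - hZ a e r ^ 2 := by rw [hq_eq]; positivity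
  generalize hX a e r = A at *
  generalize hY a e r = B at *
  generalize hZ a e r = C at *
  generalize hW a e r = D at *
  have m1 : a ≤ B / A := by rw [le_div_iff₀ pX]; exact l1
  have m2 : C / B ≤ a + e := by rw [div_le_iff₀ pY]; exact l2
  have e1 : C / B - B / A = (C * A - B^2) / (A * B) := by field_simp
  have e2 : D / C - C / B = (D * B - C^2) / (B * C) := by field_simp
  have m3 : 0 < C / B - B / A := by rw [e1]; positivity
  have m4 : 0 ≤ D / C - C / B := by rw [e2]; positivity
  have m5 : D / C - C / B ≤ 2 * (C / B - B / A) := by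
    have k1 : 9/10 * A ≤ B := le_trans (by gcongr) l1
    have k2 : A ≤ 2 * C := by nlinarith
    rw [e1, e2, ← mul_div_assoc, div_le_div_iff₀ (by positivity) (by positivity)]
    have k3 : (D * B - C^2) * A ≤ (C * A - B^2) * (2 * C) := by gcongr
    nlinarith
  refine ⟨B / A, C / B - B / A, (D / C - C / B) / (C / B - B / A), ⟨?_, ?_, ?_, ?_, ?_, ?_, m3, ?_, ?_, ?_⟩, m1, ?_⟩
  · rw [hX']; positivity
  · rw [hX', hY']; field_simp
  · rw [hX', hZ']; field_simp; ring
  · rw [div_mul_cancel₀ _ m3.ne', hX', hW']; field_simp; ring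
  · linarith
  · linarith
  · linarith
  · positivity
  · rw [div_le_iff₀ m3]; exact m5
  · linarith

theorem hX_bounds (a e r : ℝ) (ha : 0 < a) (he : 0 < e) :
    (a^2 + 2 * a + 2)^3 ≤ hX a e r ∧ hX a e r ≤ ((a+e)^2 + 2 * (a+e) + 2)^3 := by
  constructor
  · have : 0 ≤ hX a e r - (a^2 + 2 * a + 2)^3 := by
      have h : hX a e r - (a^2 + 2 * a + 2)^3 = (6 * a * e + 18 * a^2 * e + 21 * a^3 * e + 12 * a^4 * e + 3 * a^5 * e + 3 * a^2 * e^2 + 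
      6 * a^3 * e^2 + 3 * a^4 * e^2 + 1 * a^3 * e^3) := by unfold hX; ring
      rw [h]; positivity
    linarith
  · have : 0 ≤ ((a+e)^2 + 2 * (a+e) + 2)^3 - hX a e r := by
      have h : ((a+e)^2 + 2 * (a+e) + 2)^3 - hX a e r = (24 * e + 66 * a * e + 78 * a^2 * e + 51 * a^3 * e + 18 * a^4 * e + 3 * a^5 * e + 36 * e^2 + 
      96 * a * e^2 + 105 * a^2 * e^2 + 54 * a^3 * e^2 + 12 * a^4 * e^2 + 32 * e^3 + 72 * a * e^3 + 
      60 * a^2 * e^3 + 19 * a^3 * e^3 + 18 * e^4 + 30 * a * e^4 + 15 * a^2 * e^4 + 6 * e^5 + 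
      6 * a * e^5 + 1 * e^6) := by unfold hX; ring
      rw [h]; positivity
    linarith

theorem exp_succ (j : ℕ) : 3 * (3 ^ (j + 1) - 1) / 2 = 3 * (3 * (3 ^ j - 1) / 2) + 3 := by
  have h : ∃ t, 3 ^ j = 2 * t + 1 := by
    have : Odd (3 ^ j) := Odd.pow (by decide)
    exact this
  obtain ⟨t, ht⟩ := h
  rw [pow_succ, ht]
  omega

theorem pow_step (u v : ℝ) (j : ℕ) :
    u ^ (3 ^ (j + 1)) * v ^ (3 * (3 ^ (j + 1) - 1) / 2)
      = (u ^ (3 ^ j) * v ^ (3 * (3 ^ j - 1) / 2)) ^ 3 * v ^ 3 := by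
  rw [exp_succ, pow_succ 3 j, mul_pow, ← pow_mul, ← pow_mul, pow_add, mul_assoc,
    mul_comm (3 * (3 ^ j - 1) / 2) 3]

theorem hanoi_m_bounds
    (x y z w : ℕ → ℝ)
    (hx0 : x 0 = 1) (hy0 : y 0 = 0) (hz0 : z 0 = 1) (hw0 : w 0 = 0)
    (hx : ∀ n : ℕ, x (n + 1) = 8 * (x n)^3 + 24 * (x n)^2 * y n + 6 * (x n)^2 * z n + 30 * x n * (y n)^2 + 18 * x n * y n * z n + 3 * x n * (z n)^2 + 14 * (y n)^3 + 15 * (y n)^2 * z n + 6 * y n * (z n)^2 + (z n)^3)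
    (hy : ∀ n : ℕ, y (n + 1) = 8 * (x n)^2 * y n + 8 * (x n)^2 * z n + 2 * (x n)^2 * w n + 16 * x n * (y n)^2 + 24 * x n * y n * z n + 6 * x n * y n * w n + 6 * x n * (z n)^2 + 2 * x n * z n * w n + 10 * (y n)^3 + 20 * (y n)^2 * z n + 5 * (y n)^2 * w n + 11 * y n * (z n)^2 + 4 * y n * z n * w n + 2 * (z n)^3 + (z n)^2 * w n)
    (hz : ∀ n : ℕ, z (n + 1) = 8 * x n * (y n)^2 + 16 * x n * y n * z n + 4 * x n * y n * w n + 10 * x n * (z n)^2 + 6 * x n * z n * w n + x n * (w n)^2 + 8 * (y n)^3 + 22 * (y n)^2 * z n + 6 * (y n)^2 * w n + 20 * y n * (z n)^2 + 12 * y n * z n * w n + 2 * y n * (w n)^2 + 5 * (z n)^3 + 4 * (z n)^2 * w n + z n * (w n)^2)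
    (hw : ∀ n : ℕ, w (n + 1) = 8 * (y n)^3 + 24 * (y n)^2 * z n + 6 * (y n)^2 * w n + 30 * y n * (z n)^2 + 18 * y n * z n * w n + 3 * y n * (w n)^2 + 14 * (z n)^3 + 15 * (z n)^2 * w n + 6 * z n * (w n)^2 + (w n)^3) :
    ∀ k n : ℕ, 2 ≤ k → k ≤ n → x k ^ (3 ^ (n - k)) * ((y k / x k)^2 + 2 * (y k / x k) + 2) ^ ((3 * (3 ^ (n - k) - 1)) / 2) * (1 + y n / x n)^3 < x n + 3 * y n + 3 * z n + w n ∧ x n + 3 * y n + 3 * z n + w n < x k ^ (3 ^ (n - k)) * ((z k / y k)^2 + 2 * (z k / y k) + 2) ^ ((3 * (3 ^ (n - k) - 1)) / 2) * (1 + w n / z n)^3 := by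
  have step : ∀ n a e r, HInv (x n) (y n) (z n) (w n) a e r →
      (∃ a' e' r', HInv (x (n+1)) (y (n+1)) (z (n+1)) (w (n+1)) a' e' r' ∧ a ≤ a' ∧ a' + e' ≤ a + e)
        ∧ x (n+1) = x n ^ 3 * hX a e r := by
    intro n a e r ⟨g1, g2, g3, g4, g5, g6, g7, g8, g9, g10⟩
    have q : x (n+1) = x n ^ 3 * hX a e r := by rw [hx, g2, g3]; unfold hX; ring
    refine ⟨?_, q⟩
    apply step_inv _ _ _ _ (x n) a e r g1 g5 g6 g7 g8 g9 g10 q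
    · rw [hy, g2, g3, g4]; unfold hY; ring
    · rw [hz, g2, g3, g4]; unfold hZ; ring
    · rw [hw, g2, g3, g4]; unfold hW; ring
  have x1 : x 1 = 18 := by rw [show (1:ℕ) = 0 + 1 from rfl, hx, hx0, hy0, hz0]; norm_num
  have y1 : y 1 = 16 := by rw [show (1:ℕ) = 0 + 1 from rfl, hy, hx0, hy0, hz0, hw0]; norm_num
  have z1 : z 1 = 15 := by rw [show (1:ℕ) = 0 + 1 from rfl, hz, hx0, hy0, hz0, hw0]; norm_num
  have w1 : w 1 = 14 := by rw [show (1:ℕ) = 0 + 1 from rfl, hw, hy0, hz0, hw0]; norm_num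
  have x2 : x 2 = 568301 := by
    have h := hx 1
    norm_num [x1, y1, z1, w1] at h
    exact h
  have y2 : y 2 = 521504 := by
    have h := hy 1
    norm_num [x1, y1, z1, w1] at h
    exact h
  have z2 : z 2 = 478579 := by
    have h := hz 1
    norm_num [x1, y1, z1, w1] at h
    exact h
  have w2 : w 2 = 439204 := by
    have h := hw 1
    norm_num [x1, y1, z1, w1] at h
    exact h
  have base : ∃ a e r, HInv (x 2) (y 2) (z 2) (w 2) a e r := by
    refine ⟨y 2 / x 2, z 2 / y 2 - y 2 / x 2, (w 2 / z 2 - z 2 / y 2) / (z 2 / y 2 - y 2 / x 2), ?_⟩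
    rw [x2, y2, z2, w2]
    unfold HInv
    norm_num
  have all : ∀ k, 2 ≤ k → ∃ a e r, HInv (x k) (y k) (z k) (w k) a e r := by
    intro k hk
    induction k, hk using Nat.le_induction with
    | base => exact base
    | succ n hn ih =>
      obtain ⟨a, e, r, h⟩ := ih
      obtain ⟨⟨a', e', r', h', _⟩, _⟩ := step n a e r h
      exact ⟨a', e', r', h'⟩
  intro k n hk hkn
  obtain ⟨a, e, r, hI⟩ := all k hk
  have key : ∀ j, ∃ a' e' r', HInv (x (k+j)) (y (k+j)) (z (k+j)) (w (k+j)) a' e' r' ∧ a ≤ a' ∧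
      a' + e' ≤ a + e ∧
      x k ^ (3 ^ j) * (a^2 + 2 * a + 2) ^ (3 * (3 ^ j - 1) / 2) ≤ x (k+j) ∧
      x (k+j) ≤ x k ^ (3 ^ j) * ((a+e)^2 + 2 * (a+e) + 2) ^ (3 * (3 ^ j - 1) / 2) := by
    have hxk : 0 < x k := hI.1
    have ha : 0 < a := by have := hI.2.2.2.2.1; linarith
    have he : 0 < e := hI.2.2.2.2.2.2.1
    intro j
    induction j with
    | zero => exact ⟨a, e, r, hI, le_rfl, le_rfl, by simp, by simp⟩
    | succ j ih =>
      obtain ⟨a', e', r', h', i1, i2, i3, i4⟩ := ih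
      obtain ⟨⟨a'', e'', r'', h'', j1, j2⟩, j3⟩ := step _ a' e' r' h'
      have hxj : 0 < x (k+j) := h'.1
      have ha' : 0 < a' := by linarith
      have he' : 0 < e' := h'.2.2.2.2.2.2.1
      obtain ⟨b1, b2⟩ := hX_bounds a' e' r' ha' he'
      refine ⟨a'', e'', r'', h'', i1.trans j1, j2.trans i2, ?_, ?_⟩
      · rw [pow_step, ← add_assoc, j3]
        have b3 : (a^2 + 2 * a + 2)^3 ≤ hX a' e' r' := le_trans (by gcongr) b1
        gcongr
      · rw [pow_step, ← add_assoc, j3]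
        have b3 : hX a' e' r' ≤ ((a+e)^2 + 2 * (a+e) + 2)^3 := b2.trans (by gcongr)
        have : 0 ≤ hX a' e' r' := le_trans (by positivity) b1
        gcongr
  obtain ⟨a', e', r', h', i1, i2, i3, i4⟩ := key (n - k)
  rw [Nat.add_sub_cancel' hkn] at h' i3 i4
  obtain ⟨f1, f2, f3, f4, f5, f6, f7, f8, f9, f10⟩ := hI
  obtain ⟨g1, g2, g3, g4, g5, g6, g7, g8, g9, g10⟩ := h'
  have ha : 0 < a := by linarith
  have ha' : 0 < a' := by linarith
  have c1 : y k / x k = a := by rw [f2]; field_simp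
  have c2 : z k / y k = a + e := by rw [f2, f3]; field_simp
  have c3 : y n / x n = a' := by rw [g2]; field_simp
  have c4 : w n / z n = a' + e' + r' * e' := by rw [g3, g4]; field_simp
  have hm : x n + 3 * y n + 3 * z n + w n
      = x n * (1 + 3 * a' + 3 * (a' * (a' + e')) + a' * (a' + e') * (a' + e' + r' * e')) := by
    rw [g2, g3, g4]; ring
  have hre : 0 ≤ r' * e' := by positivity
  rw [c1, c2, c3, c4, hm]
  generalize r' * e' = d' at *
  constructor
  · refine lt_of_le_of_lt (mul_le_mul_of_nonneg_right i3 (by positivity)) ?_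
    refine mul_lt_mul_of_pos_left ?_ g1
    have : 0 < 3 * a' * e' + a' * (a' * (e' + d') + e' * (a' + e' + d')) := by positivity
    nlinarith
  · refine lt_of_lt_of_le ?_ (mul_le_mul_of_nonneg_right i4 (by positivity))
    refine mul_lt_mul_of_pos_left ?_ g1
    have t1 : a' * (a' + e') ≤ (a' + e' + d') * (a' + e' + d') :=
      mul_le_mul (by linarith) (by linarith) (by positivity) (by positivity)
    have t2 : a' * (a' + e') * (a' + e' + d') ≤ (a' + e' + d') * (a' + e' + d') * (a' + e' + d') := by
      gcongr
    nlinarith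
end

section
/- Let μ_H = lim_{n→∞} (ln m_n)/3^(n+1) (this limit exists). Then for every integer k ≥ 2, (ln x_k)/3^(k+1) + ln(α_k^2 + 2α_k + 2)/(2·3^k) ≤ μ_H ≤ (ln x_k)/3^(k+1) + ln(β_k^2 + 2β_k + 2)/(2·3^k), where α_k = y_k/x_k and β_k = z_k/y_k. -/
open Filter Topology Real

def polX (x y z _w : ℝ) : ℝ :=
  8 * x^3 + 24 * x^2 * y + 6 * x^2 * z + 30 * x * y^2 + 18 * x * y * z + 3 * x * z^2 + 14 * y^3 + 15 * y^2 * z + 6 * y * z^2 + z^3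

def polY (x y z w : ℝ) : ℝ :=
  8 * x^2 * y + 8 * x^2 * z + 2 * x^2 * w + 16 * x * y^2 + 24 * x * y * z + 6 * x * y * w + 6 * x * z^2 + 2 * x * z * w + 10 * y^3 + 20 * y^2 * z + 5 * y^2 * w + 11 * y * z^2 + 4 * y * z * w + 2 * z^3 + z^2 * w

def polZ (x y z w : ℝ) : ℝ :=
  8 * x * y^2 + 16 * x * y * z + 4 * x * y * w + 10 * x * z^2 + 6 * x * z * w + x * w^2 + 8 * y^3 + 22 * y^2 * z + 6 * y^2 * w + 20 * y * z^2 + 12 * y * z * w + 2 * y * w^2 + 5 * z^3 + 4 * z^2 * w + z * w^2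

def polW (_x y z w : ℝ) : ℝ :=
  8 * y^3 + 24 * y^2 * z + 6 * y^2 * w + 30 * y * z^2 + 18 * y * z * w + 3 * y * w^2 + 14 * z^3 + 15 * z^2 * w + 6 * z * w^2 + w^3


/-- Ratios `a ≤ b ≤ c` of consecutive entries, nearly equal. -/
structure Good (a b c : ℝ) : Prop where
  pos : 0 < a
  le1 : a ≤ b
  le2 : b ≤ c
  conv : c - b ≤ 2 * (b - a)
  small : b - a ≤ 1 / 1000
  one : b ≤ 1

lemma core_a (a u v : ℝ) (ha : 0 < a) (hu : 0 ≤ u) (hv : 0 ≤ v) :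
    0 ≤ polY 1 a (a * (a + u)) (a * (a + u) * (a + u + v)) -
      a * polX 1 a (a * (a + u)) (a * (a + u) * (a + u + v)) := by
  unfold polX polY
  ring_nf
  positivity

lemma core_log1 (a u v : ℝ) (ha : 0 < a) (hu : 0 ≤ u) (hv : 0 ≤ v) :
    0 ≤ polX 1 a (a * (a + u)) (a * (a + u) * (a + u + v)) *
        polZ 1 a (a * (a + u)) (a * (a + u) * (a + u + v)) -
      (polY 1 a (a * (a + u)) (a * (a + u) * (a + u + v))) ^ 2 := by
  unfold polX polY polZ
  ring_nf
  positivity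

lemma core_log2 (a u v : ℝ) (ha : 0 < a) (hu : 0 ≤ u) (hv : 0 ≤ v) :
    0 ≤ polY 1 a (a * (a + u)) (a * (a + u) * (a + u + v)) *
        polW 1 a (a * (a + u)) (a * (a + u) * (a + u + v)) -
      (polZ 1 a (a * (a + u)) (a * (a + u) * (a + u + v))) ^ 2 := by
  unfold polW polY polZ
  ring_nf
  positivity

set_option maxRecDepth 1000000 in
set_option maxHeartbeats 4000000 in
lemma core_conv (a s v : ℝ) (ha : 0 < a) (hs : 0 ≤ s) (hv : 0 ≤ v) (X Y Z W : ℝ)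
    (hX : X = polX 1 a (a * (a + (s + v))) (a * (a + (s + v)) * (a + (s + v) + 2 * v)))
    (hY : Y = polY 1 a (a * (a + (s + v))) (a * (a + (s + v)) * (a + (s + v) + 2 * v)))
    (hZ : Z = polZ 1 a (a * (a + (s + v))) (a * (a + (s + v)) * (a + (s + v) + 2 * v)))
    (hW : W = polW 1 a (a * (a + (s + v))) (a * (a + (s + v)) * (a + (s + v) + 2 * v))) :
    0 ≤ 2 * Z * (Z * X - Y ^ 2) - X * (W * Y - Z ^ 2) := by
  subst hX hY hZ hW
  unfold polX polY polZ polW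
  ring_nf
  positivity

lemma core_b_bound (a u v : ℝ) (ha : 0 < a) (ha1 : a ≤ 1) (hu : 0 ≤ u) (hv : 0 ≤ v)
    (hu1 : u ≤ 1 / 1000) (hv1 : v ≤ 1 / 500) :
    1 * u ^ 2 * v ^ 1 + 6 * a ^ 1 * u ^ 1 + 2 * a ^ 1 * u ^ 1 * v ^ 1 + 7 * a ^ 1 * u ^ 2 + 2 * a ^ 1 * u ^ 2 * v ^ 1 + 4 * a ^ 1 * u ^ 3 + 1 * a ^ 1 * u ^ 3 * v ^ 1 + 1 * a ^ 1 * u ^ 4 + 1 * a ^ 2 * v ^ 1 + 14 * a ^ 2 * u ^ 1 + 4 * a ^ 2 * u ^ 1 * v ^ 1 + 12 * a ^ 2 * u ^ 2 + 3 * a ^ 2 * u ^ 2 * v ^ 1 + 4 * a ^ 2 * u ^ 3 + 2 * a ^ 3 * v ^ 1 + 12 * a ^ 3 * u ^ 1 + 3 * a ^ 3 * u ^ 1 * v ^ 1 + 6 * a ^ 3 * u ^ 2 + 1 * a ^ 4 * v ^ 1 + 4 * a ^ 4 * u ^ 1 ≤ 1 := by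
  calc
    _ ≤ 1 * (1 / 1000 : ℝ) ^ 2 * (1 / 500 : ℝ) ^ 1 + 6 * (1 : ℝ) ^ 1 * (1 / 1000 : ℝ) ^ 1 + 2 * (1 : ℝ) ^ 1 * (1 / 1000 : ℝ) ^ 1 * (1 / 500 : ℝ) ^ 1 + 7 * (1 : ℝ) ^ 1 * (1 / 1000 : ℝ) ^ 2 + 2 * (1 : ℝ) ^ 1 * (1 / 1000 : ℝ) ^ 2 * (1 / 500 : ℝ) ^ 1 + 4 * (1 : ℝ) ^ 1 * (1 / 1000 : ℝ) ^ 3 + 1 * (1 : ℝ) ^ 1 * (1 / 1000 : ℝ) ^ 3 * (1 / 500 : ℝ) ^ 1 + 1 * (1 : ℝ) ^ 1 * (1 / 1000 : ℝ) ^ 4 + 1 * (1 : ℝ) ^ 2 * (1 / 500 : ℝ) ^ 1 + 14 * (1 : ℝ) ^ 2 * (1 / 1000 : ℝ) ^ 1 + 4 * (1 : ℝ) ^ 2 * (1 / 1000 : ℝ) ^ 1 * (1 / 500 : ℝ) ^ 1 + 12 * (1 : ℝ) ^ 2 * (1 / 1000 : ℝ) ^ 2 + 3 * (1 : ℝ)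 ^ 2 * (1 / 1000 : ℝ) ^ 2 * (1 / 500 : ℝ) ^ 1 + 4 * (1 : ℝ) ^ 2 * (1 / 1000 : ℝ) ^ 3 + 2 * (1 : ℝ) ^ 3 * (1 / 500 : ℝ) ^ 1 + 12 * (1 : ℝ) ^ 3 * (1 / 1000 : ℝ) ^ 1 + 3 * (1 : ℝ) ^ 3 * (1 / 1000 : ℝ) ^ 1 * (1 / 500 : ℝ) ^ 1 + 6 * (1 : ℝ) ^ 3 * (1 / 1000 : ℝ) ^ 2 + 1 * (1 : ℝ) ^ 4 * (1 / 500 : ℝ) ^ 1 + 4 * (1 : ℝ) ^ 4 * (1 / 1000 : ℝ) ^ 1 := by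
      gcongr
    _ ≤ 1 := by norm_num

lemma core_b (a u v : ℝ) (ha : 0 < a) (ha1 : a ≤ 1) (hu : 0 ≤ u) (hv : 0 ≤ v)
    (hu1 : u ≤ 1 / 1000) (hvu : v ≤ 2 * u) :
    0 ≤ (a + u) * polY 1 a (a * (a + u)) (a * (a + u) * (a + u + v)) -
      polZ 1 a (a * (a + u)) (a * (a + u) * (a + u + v)) := by
  have hS := core_b_bound a u v ha ha1 hu hv hu1 (by linarith)
  set S := 1 * u ^ 2 * v ^ 1 + 6 * a ^ 1 * u ^ 1 + 2 * a ^ 1 * u ^ 1 * v ^ 1 + 7 * a ^ 1 * u ^ 2 + 2 * a ^ 1 * u ^ 2 * v ^ 1 + 4 * a ^ 1 * u ^ 3 + 1 * a ^ 1 * u ^ 3 * v ^ 1 + 1 * a ^ 1 * u ^ 4 + 1 * a ^ 2 * v ^ 1 + 14 * a ^ 2 * u ^ 1 + 4 * a ^ 2 * u ^ 1 * v ^ 1 + 12 * a ^ 2 * u ^ 2 + 3 * a ^ 2 * u ^ 2 * v ^ 1 + 4 * a ^ 2 * u ^ 3 + 2 * a ^ 3 * v ^ 1 + 12 * a ^ 3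 * u ^ 1 + 3 * a ^ 3 * u ^ 1 * v ^ 1 + 6 * a ^ 3 * u ^ 2 + 1 * a ^ 4 * v ^ 1 + 4 * a ^ 4 * u ^ 1 with hSd
  have key : (a + u) * polY 1 a (a * (a + u)) (a * (a + u) * (a + u + v)) -
      polZ 1 a (a * (a + u)) (a * (a + u) * (a + u + v)) =
      u * (8 * a + 16 * a ^ 2 + 14 * a ^ 3 + 6 * a ^ 4 + a ^ 5)
      - v * (2 * a ^ 3 + 6 * a ^ 4 + 7 * a ^ 5 + 4 * a ^ 6 + a ^ 7 + a ^ 2 * S)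
      + (8 * a ^ 1 * u ^ 2 + 2 * a ^ 1 * u ^ 2 * v ^ 1 + 2 * a ^ 1 * u ^ 3 + 16 * a ^ 2 * u ^ 2 + 6 * a ^ 2 * u ^ 3 + 1 * a ^ 2 * u ^ 4 + 12 * a ^ 3 * u ^ 2 + 3 * a ^ 3 * u ^ 3 + 3 * a ^ 4 * u ^ 2) := by
    rw [hSd]
    unfold polY polZ
    ring
  have hS0 : 0 ≤ S := by
    rw [hSd]
    positivity
  have hP : 0 ≤ 8 * a ^ 1 * u ^ 2 + 2 * a ^ 1 * u ^ 2 * v ^ 1 + 2 * a ^ 1 * u ^ 3 + 16 * a ^ 2 * u ^ 2 + 6 * a ^ 2 * u ^ 3 + 1 * a ^ 2 * u ^ 4 + 12 * a ^ 3 * u ^ 2 + 3 * a ^ 3 * u ^ 3 + 3 * a ^ 4 * u ^ 2 := by positivity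
  rw [key]
  have h1 : v * (2 * a ^ 3 + 6 * a ^ 4 + 7 * a ^ 5 + 4 * a ^ 6 + a ^ 7 + a ^ 2 * S) ≤
      2 * u * (2 * a ^ 3 + 6 * a ^ 4 + 7 * a ^ 5 + 4 * a ^ 6 + a ^ 7 + a ^ 2 * 1) := by
    gcongr
  have p3 : a ^ 3 ≤ a ^ 2 := pow_le_pow_of_le_one ha.le ha1 (by norm_num)
  have p4 : a ^ 4 ≤ a ^ 3 := pow_le_pow_of_le_one ha.le ha1 (by norm_num)
  have p5 : a ^ 5 ≤ a ^ 3 := pow_le_pow_of_le_one ha.le ha1 (by norm_num)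
  have p6 : a ^ 6 ≤ a ^ 3 := pow_le_pow_of_le_one ha.le ha1 (by norm_num)
  have p7 : a ^ 7 ≤ a ^ 3 := pow_le_pow_of_le_one ha.le ha1 (by norm_num)
  have p2 : a ^ 2 ≤ a := by nlinarith
  have h2 : 0 ≤ u * ((8 * a + 16 * a ^ 2 + 14 * a ^ 3 + 6 * a ^ 4 + a ^ 5) -
      2 * (2 * a ^ 3 + 6 * a ^ 4 + 7 * a ^ 5 + 4 * a ^ 6 + a ^ 7 + a ^ 2 * 1)) := by
    apply mul_nonneg hu
    linarith
  linarith

lemma polX_lower (a b c : ℝ) (h : Good a b c) :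
    (a ^ 2 + 2 * a + 2) ^ 3 ≤ polX 1 a (a * b) (a * b * c) := by
  have ha := h.pos
  have hab := h.le1
  calc (a ^ 2 + 2 * a + 2) ^ 3 = polX 1 a (a * a) (a * a * c) := by unfold polX; ring
    _ ≤ _ := by unfold polX; gcongr

lemma polX_upper (a b c : ℝ) (h : Good a b c) :
    polX 1 a (a * b) (a * b * c) ≤ (b ^ 2 + 2 * b + 2) ^ 3 := by
  have ha := h.pos
  have hab := h.le1
  have hb : 0 < b := by linarith
  calc polX 1 a (a * b) (a * b * c) ≤ polX 1 b (b * b) (b * b * c) := by unfold polX; gcongr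
    _ = _ := by unfold polX; ring

lemma pol_pos (a b c : ℝ) (h : Good a b c) :
    0 < polX 1 a (a * b) (a * b * c) ∧ 0 < polY 1 a (a * b) (a * b * c) ∧
    0 < polZ 1 a (a * b) (a * b * c) ∧ 0 < polW 1 a (a * b) (a * b * c) := by
  have ha := h.pos
  have hb : 0 < b := by linarith [h.le1]
  have hc : 0 < c := by linarith [h.le2]
  unfold polX polY polZ polW
  refine ⟨?_, ?_, ?_, ?_⟩ <;> positivity

lemma good_step (a b c X Y Z W : ℝ) (h : Good a b c)
    (hX : X = polX 1 a (a * b) (a * b * c)) (hY : Y = polY 1 a (a * b) (a * b * c))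
    (hZ : Z = polZ 1 a (a * b) (a * b * c)) (hW : W = polW 1 a (a * b) (a * b * c)) :
    Good (Y / X) (Z / Y) (W / Z) ∧ a ≤ Y / X ∧ Z / Y ≤ b := by
  obtain ⟨pX, pY, pZ, pW⟩ := pol_pos a b c h
  rw [← hX] at pX
  rw [← hY] at pY
  rw [← hZ] at pZ
  rw [← hW] at pW
  have ha := h.pos
  have h1 := h.le1
  have h2 := h.le2
  have h3 := h.conv
  have h4 := h.small
  have h5 := h.one
  have eb : a + (b - a) = b := by ring
  have ec : b + (c - b) = c := by ring
  have A := core_a a (b - a) (c - b) ha (by linarith) (by linarith)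
  have B := core_b a (b - a) (c - b) ha (by linarith) (by linarith) (by linarith) h4 h3
  have L1 := core_log1 a (b - a) (c - b) ha (by linarith) (by linarith)
  have L2 := core_log2 a (b - a) (c - b) ha (by linarith) (by linarith)
  rw [eb, ec] at A B L1 L2
  rw [← hX, ← hY] at A
  rw [← hZ, ← hY] at B
  rw [← hX, ← hY, ← hZ] at L1
  rw [← hW, ← hY, ← hZ] at L2
  have eb' : a + ((b - a) - (c - b) / 2 + (c - b) / 2) = b := by ring
  have ec' : b + 2 * ((c - b) / 2) = c := by ring
  have K := core_conv a ((b - a) - (c - b) / 2) ((c - b) / 2) ha (by linarith) (by linarith)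
    X Y Z W (by rw [eb', ec', hX]) (by rw [eb', ec', hY]) (by rw [eb', ec', hZ])
    (by rw [eb', ec', hW])
  have ga : a ≤ Y / X := by
    rw [le_div_iff₀ pX]
    linarith
  have gb : Z / Y ≤ b := by
    rw [div_le_iff₀ pY]
    linarith
  refine ⟨⟨by positivity, ?_, ?_, ?_, by linarith, by linarith⟩, ga, gb⟩
  · rw [div_le_div_iff₀ pX pY]
    linarith
  · rw [div_le_div_iff₀ pY pZ]
    linarith
  · have e : 2 * (Z / Y - Y / X) - (W / Z - Z / Y) =
        (2 * Z * (Z * X - Y ^ 2) - X * (W * Y - Z ^ 2)) / (X * Y * Z) := by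
      field_simp
    have : 0 ≤ 2 * (Z / Y - Y / X) - (W / Z - Z / Y) := by
      rw [e]
      positivity
    linarith

lemma state_step (x y z w x' y' z' w' : ℝ) (hx : 0 < x)
    (h : Good (y / x) (z / y) (w / z))
    (hx' : x' = polX x y z w) (hy' : y' = polY x y z w)
    (hz' : z' = polZ x y z w) (hw' : w' = polW x y z w) :
    0 < x' ∧ Good (y' / x') (z' / y') (w' / z') ∧ y / x ≤ y' / x' ∧ z' / y' ≤ z / y ∧
    3 * Real.log x + 3 * Real.log ((y / x) ^ 2 + 2 * (y / x) + 2) ≤ Real.log x' ∧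
    Real.log x' ≤ 3 * Real.log x + 3 * Real.log ((z / y) ^ 2 + 2 * (z / y) + 2) := by
  have ha := h.pos
  have hb : 0 < z / y := by linarith [h.le1]
  have hc : 0 < w / z := by linarith [h.le2]
  have hy0 : y ≠ 0 := fun e => by simp [e] at ha
  have hz0 : z ≠ 0 := fun e => by simp [e] at hb
  obtain ⟨a, ea⟩ : ∃ a, a = y / x := ⟨_, rfl⟩
  obtain ⟨b, eb⟩ : ∃ b, b = z / y := ⟨_, rfl⟩
  obtain ⟨c, ec⟩ : ∃ c, c = w / z := ⟨_, rfl⟩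
  have ey : y = a * x := by rw [ea]; field_simp
  have ez : z = a * b * x := by rw [ea, eb]; field_simp
  have ew : w = a * b * c * x := by rw [ea, eb, ec]; field_simp
  rw [← ea, ← eb, ← ec] at h
  rw [← ea, ← eb]
  rw [← ea] at ha
  rw [← eb] at hb
  obtain ⟨X, hX⟩ : ∃ X, X = polX 1 a (a * b) (a * b * c) := ⟨_, rfl⟩
  obtain ⟨Y, hY⟩ : ∃ Y, Y = polY 1 a (a * b) (a * b * c) := ⟨_, rfl⟩
  obtain ⟨Z, hZ⟩ : ∃ Z, Z = polZ 1 a (a * b) (a * b * c) := ⟨_, rfl⟩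
  obtain ⟨W, hW⟩ : ∃ W, W = polW 1 a (a * b) (a * b * c) := ⟨_, rfl⟩
  have fx : x' = X * x ^ 3 := by rw [hx', hX, ey, ez, ew]; unfold polX; ring
  have fy : y' = Y * x ^ 3 := by rw [hy', hY, ey, ez, ew]; unfold polY; ring
  have fz : z' = Z * x ^ 3 := by rw [hz', hZ, ey, ez, ew]; unfold polZ; ring
  have fw : w' = W * x ^ 3 := by rw [hw', hW, ey, ez, ew]; unfold polW; ring
  have px : x ^ 3 ≠ 0 := by positivity
  have pX : 0 < X := by rw [hX]; exact (pol_pos a b c h).1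
  obtain ⟨g, g1, g2⟩ := good_step a b c X Y Z W h hX hY hZ hW
  have lX := polX_lower a b c h
  have uX := polX_upper a b c h
  rw [← hX] at lX uX
  have hlog : Real.log x' = Real.log X + 3 * Real.log x := by
    rw [fx, Real.log_mul pX.ne' px, Real.log_pow]
    norm_num
  have l1 : 3 * Real.log (a ^ 2 + 2 * a + 2) ≤ Real.log X := by
    have := Real.log_le_log (by positivity) lX
    rw [Real.log_pow] at this
    exact_mod_cast this
  have l2 : Real.log X ≤ 3 * Real.log (b ^ 2 + 2 * b + 2) := by
    have := Real.log_le_log pX uX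
    rw [Real.log_pow] at this
    exact_mod_cast this
  rw [hlog, fx, fy, fz, fw, mul_div_mul_right _ _ px, mul_div_mul_right _ _ px,
    mul_div_mul_right _ _ px]
  exact ⟨by positivity, g, g1, g2, by linarith, by linarith⟩

theorem hanoi_entropy_bounds
    (x y z w : ℕ → ℝ)
    (hx0 : x 0 = 1) (hy0 : y 0 = 0) (hz0 : z 0 = 1) (hw0 : w 0 = 0)
    (hx : ∀ n : ℕ, x (n + 1) = 8 * (x n)^3 + 24 * (x n)^2 * y n + 6 * (x n)^2 * z n + 30 * x n * (y n)^2 + 18 * x n * y n * z n + 3 * x n * (z n)^2 + 14 * (y n)^3 + 15 * (y n)^2 * z n + 6 * y n * (z n)^2 + (z n)^3)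
    (hy : ∀ n : ℕ, y (n + 1) = 8 * (x n)^2 * y n + 8 * (x n)^2 * z n + 2 * (x n)^2 * w n + 16 * x n * (y n)^2 + 24 * x n * y n * z n + 6 * x n * y n * w n + 6 * x n * (z n)^2 + 2 * x n * z n * w n + 10 * (y n)^3 + 20 * (y n)^2 * z n + 5 * (y n)^2 * w n + 11 * y n * (z n)^2 + 4 * y n * z n * w n + 2 * (z n)^3 + (z n)^2 * w n)
    (hz : ∀ n : ℕ, z (n + 1) = 8 * x n * (y n)^2 + 16 * x n * y n * z n + 4 * x n * y n * w n + 10 * x n * (z n)^2 + 6 * x n * z n * w n + x n * (w n)^2 + 8 * (y n)^3 + 22 * (y n)^2 * z n + 6 * (y n)^2 * w n + 20 * y n * (z n)^2 + 12 * y n * z n * w n + 2 * y n * (w n)^2 + 5 * (z n)^3 + 4 * (z n)^2 * w n + z n * (w n)^2)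
    (hw : ∀ n : ℕ, w (n + 1) = 8 * (y n)^3 + 24 * (y n)^2 * z n + 6 * (y n)^2 * w n + 30 * y n * (z n)^2 + 18 * y n * z n * w n + 3 * y n * (w n)^2 + 14 * (z n)^3 + 15 * (z n)^2 * w n + 6 * z n * (w n)^2 + (w n)^3)
    (μ : ℝ)
    (hμ : Tendsto (fun n => Real.log (x n + 3 * y n + 3 * z n + w n) / 3 ^ (n + 1)) atTop (𝓝 μ)) :
    ∀ k : ℕ, 2 ≤ k → Real.log (x k) / 3 ^ (k + 1) + Real.log ((y k / x k)^2 + 2 * (y k / x k) + 2) / (2 * 3 ^ k) ≤ μ ∧ μ ≤ Real.log (x k) / 3 ^ (k + 1) + Real.log ((z k / y k)^2 + 2 * (z k / y k) + 2) / (2 * 3 ^ k) := by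
  have step : ∀ n, 0 < x n → Good (y n / x n) (z n / y n) (w n / z n) → _ := fun n p g =>
    state_step (x n) (y n) (z n) (w n) (x (n + 1)) (y (n + 1)) (z (n + 1)) (w (n + 1)) p g
      (by rw [hx]; rfl) (by rw [hy]; rfl) (by rw [hz]; rfl) (by rw [hw]; rfl)
  have base : 0 < x 2 ∧ Good (y 2 / x 2) (z 2 / y 2) (w 2 / z 2) := by
    have x1 : x 1 = 18 := by rw [hx 0, hx0, hy0, hz0]; norm_num
    have y1 : y 1 = 16 := by rw [hy 0, hx0, hy0, hz0, hw0]; norm_num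
    have z1 : z 1 = 15 := by rw [hz 0, hx0, hy0, hz0, hw0]; norm_num
    have w1 : w 1 = 14 := by rw [hw 0, hy0, hz0, hw0]; norm_num
    have x2 := hx 1
    have y2 := hy 1
    have z2 := hz 1
    have w2 := hw 1
    rw [x1, y1, z1] at x2
    rw [x1, y1, z1, w1] at y2 z2
    rw [y1, z1, w1] at w2
    norm_num at x2 y2 z2 w2
    rw [x2, y2, z2, w2]
    refine ⟨by norm_num, ⟨?_, ?_, ?_, ?_, ?_, ?_⟩⟩ <;> norm_num
  have inv : ∀ n, 2 ≤ n → 0 < x n ∧ Good (y n / x n) (z n / y n) (w n / z n) := by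
    intro n hn
    induction n, hn using Nat.le_induction with
    | base => exact base
    | succ n hn ih =>
      have s := step n ih.1 ih.2
      exact ⟨s.1, s.2.1⟩
  intro k hk
  -- monotonicity of the lower and upper bounds
  have lower : ∀ n, k ≤ n →
      Real.log (x k) / 3 ^ (k + 1) + Real.log ((y k / x k)^2 + 2 * (y k / x k) + 2) / (2 * 3 ^ k) ≤
      Real.log (x n) / 3 ^ (n + 1) +
        Real.log ((y n / x n)^2 + 2 * (y n / x n) + 2) / (2 * 3 ^ n) := by
    intro n hn
    induction n, hn using Nat.le_induction with
    | base => exact le_rfl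
    | succ n hn ih =>
      refine ih.trans ?_
      obtain ⟨p, g⟩ := inv n (by omega)
      obtain ⟨p', g', m1, m2, l1, l2⟩ := step n p g
      have q := g.pos
      have hf : Real.log ((y n / x n)^2 + 2 * (y n / x n) + 2) ≤
          Real.log ((y (n + 1) / x (n + 1))^2 + 2 * (y (n + 1) / x (n + 1)) + 2) := by
        apply Real.log_le_log (by positivity)
        gcongr
      generalize Real.log ((y n / x n)^2 + 2 * (y n / x n) + 2) = f at *
      generalize Real.log ((y (n + 1) / x (n + 1))^2 + 2 * (y (n + 1) / x (n + 1)) + 2) = f' at *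
      calc Real.log (x n) / 3 ^ (n + 1) + f / (2 * 3 ^ n)
          = (3 * Real.log (x n) + 3 * f) / 3 ^ (n + 1 + 1) + f / (2 * 3 ^ (n + 1)) := by
            field_simp
            ring
        _ ≤ _ := by gcongr
  have upper : ∀ n, k ≤ n →
      Real.log (x n) / 3 ^ (n + 1) +
        Real.log ((z n / y n)^2 + 2 * (z n / y n) + 2) / (2 * 3 ^ n) ≤
      Real.log (x k) / 3 ^ (k + 1) +
        Real.log ((z k / y k)^2 + 2 * (z k / y k) + 2) / (2 * 3 ^ k) := by
    intro n hn
    induction n, hn using Nat.le_induction with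
    | base => exact le_rfl
    | succ n hn ih =>
      refine le_trans ?_ ih
      obtain ⟨p, g⟩ := inv n (by omega)
      obtain ⟨p', g', m1, m2, l1, l2⟩ := step n p g
      have q : 0 < z (n + 1) / y (n + 1) := by linarith [g'.pos, g'.le1]
      have hf : Real.log ((z (n + 1) / y (n + 1))^2 + 2 * (z (n + 1) / y (n + 1)) + 2) ≤
          Real.log ((z n / y n)^2 + 2 * (z n / y n) + 2) := by
        apply Real.log_le_log (by positivity)
        gcongr
      generalize Real.log ((z n / y n)^2 + 2 * (z n / y n) + 2) = f at *
      generalize Real.log ((z (n + 1) / y (n + 1))^2 + 2 * (z (n + 1) / y (n + 1)) + 2) = f' at *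
      calc _ ≤ (3 * Real.log (x n) + 3 * f) / 3 ^ (n + 1 + 1) + f / (2 * 3 ^ (n + 1)) := by gcongr
        _ = Real.log (x n) / 3 ^ (n + 1) + f / (2 * 3 ^ n) := by
            field_simp
            ring
  -- comparison of the total count with `x n`
  have cmp : ∀ n, 2 ≤ n → x n ≤ x n + 3 * y n + 3 * z n + w n ∧
      x n + 3 * y n + 3 * z n + w n ≤ 10 * x n := by
    intro n hn
    obtain ⟨p, g⟩ := inv n hn
    have ha := g.pos
    have h1 := g.le1
    have h2 := g.le2
    have h3 := g.conv
    have h4 := g.small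
    have h5 := g.one
    have hy0 : y n ≠ 0 := fun e => by simp [e] at ha
    have py : 0 < y n := by
      have := mul_pos ha p
      rwa [div_mul_cancel₀ _ p.ne'] at this
    have pz : 0 < z n := by
      have := mul_pos (ha.trans_le h1) py
      rwa [div_mul_cancel₀ _ py.ne'] at this
    have pw : 0 < w n := by
      have := mul_pos ((ha.trans_le h1).trans_le h2) pz
      rwa [div_mul_cancel₀ _ pz.ne'] at this
    have b1 : y n ≤ 1 * x n := (div_le_iff₀ p).1 (by linarith)
    have b2 : z n ≤ 1 * y n := (div_le_iff₀ py).1 (by linarith)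
    have b3 : w n ≤ 2 * z n := (div_le_iff₀ pz).1 (by linarith)
    constructor <;> linarith
  have tz : ∀ C : ℝ, Tendsto (fun n : ℕ => C / 3 ^ n) atTop (𝓝 0) := by
    intro C
    have := (tendsto_pow_atTop_nhds_zero_of_lt_one (r := (1 / 3 : ℝ)) (by norm_num)
      (by norm_num)).const_mul C
    simpa [div_eq_mul_inv] using this
  constructor
  · have lim := hμ.add (tz (Real.log 5 / 2))
    rw [add_zero] at lim
    refine ge_of_tendsto lim ?_
    filter_upwards [eventually_ge_atTop k] with n hn
    refine (lower n hn).trans ?_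
    obtain ⟨p, g⟩ := inv n (by omega)
    have c1 := (cmp n (by omega)).1
    have ha := g.pos
    have h1 : y n / x n ≤ 1 := g.le1.trans g.one
    have e : Real.log ((y n / x n)^2 + 2 * (y n / x n) + 2) ≤ Real.log 5 := by
      apply Real.log_le_log (by positivity)
      nlinarith
    have e2 := Real.log_le_log p c1
    have e3 : Real.log 5 / 2 / 3 ^ n = Real.log 5 / (2 * 3 ^ n) := by rw [div_div]
    rw [e3]
    gcongr
  · have lim := hμ.sub (tz (Real.log 10 / 3))
    rw [sub_zero] at lim
    refine le_of_tendsto lim ?_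
    filter_upwards [eventually_ge_atTop k] with n hn
    refine le_trans ?_ (upper n hn)
    obtain ⟨p, g⟩ := inv n (by omega)
    obtain ⟨c1, c2⟩ := cmp n (by omega)
    have hb : 0 < z n / y n := g.pos.trans_le g.le1
    have e : 0 ≤ Real.log ((z n / y n)^2 + 2 * (z n / y n) + 2) := by
      apply Real.log_nonneg
      nlinarith
    have e2 := Real.log_le_log (p.trans_le c1) c2
    rw [Real.log_mul (by norm_num) p.ne'] at e2
    have e3 : Real.log (x n + 3 * y n + 3 * z n + w n) / 3 ^ (n + 1) ≤
        (Real.log 10 + Real.log (x n)) / 3 ^ (n + 1) := by gcongr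
    have e4 : (Real.log 10 + Real.log (x n)) / 3 ^ (n + 1) =
        Real.log 10 / 3 / 3 ^ n + Real.log (x n) / 3 ^ (n + 1) := by
      field_simp
      ring
    have e5 : 0 ≤ Real.log ((z n / y n)^2 + 2 * (z n / y n) + 2) / (2 * 3 ^ n) := by positivity
    linarith
end

section
/- The entropy per site for the number of dimer-monomers of the Tower of Hanoi graphs, μ_H = lim_{n→∞} (ln m_n)/3^(n+1), satisfies 0.576464301650528 < μ_H < 0.576464301650529 (its decimal expansion begins 0.5764643016505283756...). -/
open Filter Topology Real

/-- trace form: three blocks glued cyclically along the three connecting edges. -/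
noncomputable def hF (p0 p1 p2 q0 q1 q2 r0 r1 r2 : ℝ) : ℝ :=
  (((2*p0+p1)*(2*q0+q1) + (p0+p1)*(2*q1+q2)) * (2*r0+r1)
    + ((2*p0+p1)*(q0+q1) + (p0+p1)*(q1+q2)) * (2*r1+r2))
  + (((2*p1+p2)*(2*q0+q1) + (p1+p2)*(2*q1+q2)) * (r0+r1)
    + ((2*p1+p2)*(q0+q1) + (p1+p2)*(q1+q2)) * (r1+r2))

lemma hF_nonneg {p0 p1 p2 q0 q1 q2 r0 r1 r2 : ℝ} (h1 : 0 ≤ p0) (h2 : 0 ≤ p1) (h3 : 0 ≤ p2)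
    (h4 : 0 ≤ q0) (h5 : 0 ≤ q1) (h6 : 0 ≤ q2) (h7 : 0 ≤ r0) (h8 : 0 ≤ r1) (h9 : 0 ≤ r2) :
    0 ≤ hF p0 p1 p2 q0 q1 q2 r0 r1 r2 := by
  unfold hF; positivity

lemma exp_lower : Real.exp 0.5764643016505282 ≤ 1.7797346882513591539 := by
  refine (Real.exp_bound' (by norm_num) (by norm_num) (n := 20) (by norm_num)).trans ?_
  simp only [Finset.sum_range_succ, Finset.sum_range_zero, Nat.factorial]
  norm_num

lemma exp_upper : 1.7797346882513596877 ≤ Real.exp 0.5764643016505285 := by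
  refine le_trans ?_ (Real.sum_le_exp_of_nonneg (by norm_num) 20)
  simp only [Finset.sum_range_succ, Finset.sum_range_zero, Nat.factorial]
  norm_num

set_option maxHeartbeats 2000000 in
lemma box_step {a b X Y Z W : ℝ} (ha : 0 < a) (h0 : 0 < X) (h1 : a * X ≤ Y) (h2 : Y ≤ b * X)
    (h3 : a * Y ≤ Z) (h4 : Z ≤ b * Y) (h5 : a * Z ≤ W) (h6 : W ≤ b * Z) :
    0 < (8 * X^3 + 24 * X^2 * Y + 6 * X^2 * Z + 30 * X * Y^2 + 18 * X * Y * Z + 3 * X * Z^2 + 14 * Y^3 + 15 * Y^2 * Z + 6 * Y * Z^2 + Z^3) ∧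
    a * (8 * X^3 + 24 * X^2 * Y + 6 * X^2 * Z + 30 * X * Y^2 + 18 * X * Y * Z + 3 * X * Z^2 + 14 * Y^3 + 15 * Y^2 * Z + 6 * Y * Z^2 + Z^3) ≤ (8 * X^2 * Y + 8 * X^2 * Z + 2 * X^2 * W + 16 * X * Y^2 + 24 * X * Y * Z + 6 * X * Y * W + 6 * X * Z^2 + 2 * X * Z * W + 10 * Y^3 + 20 * Y^2 * Z + 5 * Y^2 * W + 11 * Y * Z^2 + 4 * Y * Z * W + 2 * Z^3 + Z^2 * W) ∧
    (8 * X^2 * Y + 8 * X^2 * Z + 2 * X^2 * W + 16 * X * Y^2 + 24 * X * Y * Z + 6 * X * Y * W + 6 * X * Z^2 + 2 * X * Z * W + 10 * Y^3 + 20 * Y^2 * Z + 5 * Y^2 * W + 11 * Y * Z^2 + 4 * Y * Z * W + 2 * Z^3 + Z^2 * W) ≤ b * (8 * X^3 + 24 * X^2 * Y + 6 * X^2 * Z + 30 * X * Y^2 + 18 * X * Y * Z + 3 * X * Z^2 + 14 * Y^3 + 15 * Y^2 * Z + 6 * Y * Z^2 + Z^3) ∧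
    a * (8 * X^2 * Y + 8 * X^2 * Z + 2 * X^2 * W + 16 * X * Y^2 + 24 * X * Y * Z + 6 * X * Y * W + 6 * X * Z^2 + 2 * X * Z * W + 10 * Y^3 + 20 * Y^2 * Z + 5 * Y^2 * W + 11 * Y * Z^2 + 4 * Y * Z * W + 2 * Z^3 + Z^2 * W) ≤ (8 * X * Y^2 + 16 * X * Y * Z + 4 * X * Y * W + 10 * X * Z^2 + 6 * X * Z * W + X * W^2 + 8 * Y^3 + 22 * Y^2 * Z + 6 * Y^2 * W + 20 * Y * Z^2 + 12 * Y * Z * W + 2 * Y * W^2 + 5 * Z^3 + 4 * Z^2 * W + Z * W^2) ∧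
    (8 * X * Y^2 + 16 * X * Y * Z + 4 * X * Y * W + 10 * X * Z^2 + 6 * X * Z * W + X * W^2 + 8 * Y^3 + 22 * Y^2 * Z + 6 * Y^2 * W + 20 * Y * Z^2 + 12 * Y * Z * W + 2 * Y * W^2 + 5 * Z^3 + 4 * Z^2 * W + Z * W^2) ≤ b * (8 * X^2 * Y + 8 * X^2 * Z + 2 * X^2 * W + 16 * X * Y^2 + 24 * X * Y * Z + 6 * X * Y * W + 6 * X * Z^2 + 2 * X * Z * W + 10 * Y^3 + 20 * Y^2 * Z + 5 * Y^2 * W + 11 * Y * Z^2 + 4 * Y * Z * W + 2 * Z^3 + Z^2 * W) ∧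
    a * (8 * X * Y^2 + 16 * X * Y * Z + 4 * X * Y * W + 10 * X * Z^2 + 6 * X * Z * W + X * W^2 + 8 * Y^3 + 22 * Y^2 * Z + 6 * Y^2 * W + 20 * Y * Z^2 + 12 * Y * Z * W + 2 * Y * W^2 + 5 * Z^3 + 4 * Z^2 * W + Z * W^2) ≤ (8 * Y^3 + 24 * Y^2 * Z + 6 * Y^2 * W + 30 * Y * Z^2 + 18 * Y * Z * W + 3 * Y * W^2 + 14 * Z^3 + 15 * Z^2 * W + 6 * Z * W^2 + W^3) ∧
    (8 * Y^3 + 24 * Y^2 * Z + 6 * Y^2 * W + 30 * Y * Z^2 + 18 * Y * Z * W + 3 * Y * W^2 + 14 * Z^3 + 15 * Z^2 * W + 6 * Z * W^2 + W^3) ≤ b * (8 * X * Y^2 + 16 * X * Y * Z + 4 * X * Y * W + 10 * X * Z^2 + 6 * X * Z * W + X * W^2 + 8 * Y^3 + 22 * Y^2 * Z + 6 * Y^2 * W + 20 * Y * Z^2 + 12 * Y * Z * W + 2 * Y * W^2 + 5 * Z^3 + 4 * Z^2 * W + Z * W^2) := by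
  have hY : 0 < Y := lt_of_lt_of_le (by positivity) h1
  have hZ : 0 < Z := lt_of_lt_of_le (by positivity) h3
  have hW : 0 < W := lt_of_lt_of_le (by positivity) h5
  have g1 := sub_nonneg.2 h1
  have g2 := sub_nonneg.2 h2
  have g3 := sub_nonneg.2 h3
  have g4 := sub_nonneg.2 h4
  have g5 := sub_nonneg.2 h5
  have g6 := sub_nonneg.2 h6
  refine ⟨by positivity, ?_, ?_, ?_, ?_, ?_, ?_⟩ <;> rw [← sub_nonneg]
  · refine (hF_nonneg g1 g3 g5 h0.le hY.le hZ.le h0.le hY.le hZ.le).trans_eq ?_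
    unfold hF; ring
  · refine (hF_nonneg g2 g4 g6 h0.le hY.le hZ.le h0.le hY.le hZ.le).trans_eq ?_
    unfold hF; ring
  · refine (hF_nonneg g1 g3 g5 hY.le hZ.le hW.le h0.le hY.le hZ.le).trans_eq ?_
    unfold hF; ring
  · refine (hF_nonneg g2 g4 g6 hY.le hZ.le hW.le h0.le hY.le hZ.le).trans_eq ?_
    unfold hF; ring
  · refine (hF_nonneg g1 g3 g5 hY.le hZ.le hW.le hY.le hZ.le hW.le).trans_eq ?_
    unfold hF; ring
  · refine (hF_nonneg g2 g4 g6 hY.le hZ.le hW.le hY.le hZ.le hW.le).trans_eq ?_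
    unfold hF; ring

set_option maxHeartbeats 2000000 in
lemma x_step {a b X Y Z : ℝ} (ha : 0 < a) (hb : 0 < b) (h0 : 0 < X) (h1 : a * X ≤ Y)
    (h2 : Y ≤ b * X) (h3 : a * Y ≤ Z) (h4 : Z ≤ b * Y) :
    (X * (2 + 2 * a + a ^ 2)) ^ 3 ≤ (8 * X^3 + 24 * X^2 * Y + 6 * X^2 * Z + 30 * X * Y^2 + 18 * X * Y * Z + 3 * X * Z^2 + 14 * Y^3 + 15 * Y^2 * Z + 6 * Y * Z^2 + Z^3) ∧
    (8 * X^3 + 24 * X^2 * Y + 6 * X^2 * Z + 30 * X * Y^2 + 18 * X * Y * Z + 3 * X * Z^2 + 14 * Y^3 + 15 * Y^2 * Z + 6 * Y * Z^2 + Z^3) ≤ (X * (2 + 2 * b + b ^ 2)) ^ 3 := by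
  have hY : 0 < Y := lt_of_lt_of_le (by positivity) h1
  have hZ : 0 < Z := lt_of_lt_of_le (by positivity) h3
  have h3' : a * (a * X) ≤ Z := (mul_le_mul_of_nonneg_left h1 ha.le).trans h3
  have h4' : Z ≤ b * (b * X) := h4.trans (mul_le_mul_of_nonneg_left h2 hb.le)
  constructor
  · calc (X * (2 + 2 * a + a ^ 2)) ^ 3 = (8 * X^3 + 24 * X^2 * (a*X) + 6 * X^2 * (a*(a*X)) + 30 * X * (a*X)^2 + 18 * X * (a*X) * (a*(a*X)) + 3 * X * (a*(a*X))^2 + 14 * (a*X)^3 + 15 * (a*X)^2 * (a*(a*X)) + 6 * (a*X) * (a*(a*X))^2 + (a*(a*X))^3) := by ring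
      _ ≤ _ := by gcongr
  · calc _ ≤ (8 * X^3 + 24 * X^2 * (b*X) + 6 * X^2 * (b*(b*X)) + 30 * X * (b*X)^2 + 18 * X * (b*X) * (b*(b*X)) + 3 * X * (b*(b*X))^2 + 14 * (b*X)^3 + 15 * (b*X)^2 * (b*(b*X)) + 6 * (b*X) * (b*(b*X))^2 + (b*(b*X))^3) := by gcongr
      _ = _ := by ring

set_option maxHeartbeats 1000000 in
/-- everything after the numerical initial data at level four -/
lemma main_aux (x y z w : ℕ → ℝ) (a b : ℝ) (ha : 0 < a) (hb : 0 < b)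
    (hx : ∀ n : ℕ, x (n + 1) = 8 * (x n)^3 + 24 * (x n)^2 * y n + 6 * (x n)^2 * z n + 30 * x n * (y n)^2 + 18 * x n * y n * z n + 3 * x n * (z n)^2 + 14 * (y n)^3 + 15 * (y n)^2 * z n + 6 * y n * (z n)^2 + (z n)^3)
    (hy : ∀ n : ℕ, y (n + 1) = 8 * (x n)^2 * y n + 8 * (x n)^2 * z n + 2 * (x n)^2 * w n + 16 * x n * (y n)^2 + 24 * x n * y n * z n + 6 * x n * y n * w n + 6 * x n * (z n)^2 + 2 * x n * z n * w n + 10 * (y n)^3 + 20 * (y n)^2 * z n + 5 * (y n)^2 * w n + 11 * y n * (z n)^2 + 4 * y n * z n * w n + 2 * (z n)^3 + (z n)^2 * w n)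
    (hz : ∀ n : ℕ, z (n + 1) = 8 * x n * (y n)^2 + 16 * x n * y n * z n + 4 * x n * y n * w n + 10 * x n * (z n)^2 + 6 * x n * z n * w n + x n * (w n)^2 + 8 * (y n)^3 + 22 * (y n)^2 * z n + 6 * (y n)^2 * w n + 20 * y n * (z n)^2 + 12 * y n * z n * w n + 2 * y n * (w n)^2 + 5 * (z n)^3 + 4 * (z n)^2 * w n + z n * (w n)^2)
    (hw : ∀ n : ℕ, w (n + 1) = 8 * (y n)^3 + 24 * (y n)^2 * z n + 6 * (y n)^2 * w n + 30 * y n * (z n)^2 + 18 * y n * z n * w n + 3 * y n * (w n)^2 + 14 * (z n)^3 + 15 * (z n)^2 * w n + 6 * z n * (w n)^2 + (w n)^3)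
    (hx4 : 0 < x 4) (bax : a * x 4 ≤ y 4) (bbx : y 4 ≤ b * x 4)
    (bay : a * y 4 ≤ z 4) (bby : z 4 ≤ b * y 4) (baz : a * z 4 ≤ w 4) (bbz : w 4 ≤ b * z 4)
    (hlow0 : Real.exp 0.5764643016505282 ^ (2 * 3 ^ 5) ≤ x 4 ^ 2 * (2 + 2 * a + a ^ 2) ^ 3)
    (hupp0 : x 4 ^ 2 * (2 + 2 * b + b ^ 2) ^ 3 ≤ Real.exp 0.5764643016505285 ^ (2 * 3 ^ 5)) :
    ∃ μ : ℝ, Tendsto (fun n => Real.log (x n + 3 * y n + 3 * z n + w n) / 3 ^ (n + 1)) atTop (𝓝 μ) ∧ 0.576464301650528 < μ ∧ μ < 0.576464301650529 := by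
  
  have box : ∀ k : ℕ, 0 < x (k+4) ∧ a * x (k+4) ≤ y (k+4) ∧ y (k+4) ≤ b * x (k+4) ∧
      a * y (k+4) ≤ z (k+4) ∧ z (k+4) ≤ b * y (k+4) ∧ a * z (k+4) ≤ w (k+4) ∧
      w (k+4) ≤ b * z (k+4) := by
    intro k
    induction k with
    | zero => exact ⟨by simpa using hx4, by simpa using bax, by simpa using bbx,
        by simpa using bay, by simpa using bby, by simpa using baz, by simpa using bbz⟩
    | succ k ih =>
      rw [show k + 1 + 4 = (k + 4) + 1 by ring, hx (k+4), hy (k+4), hz (k+4), hw (k+4)]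
      obtain ⟨h0, h1, h2, h3, h4, h5, h6⟩ := ih
      exact box_step ha h0 h1 h2 h3 h4 h5 h6
  have stepb : ∀ k : ℕ, (x (k+4) * (2 + 2 * a + a ^ 2)) ^ 3 ≤ x (k+4+1) ∧
      x (k+4+1) ≤ (x (k+4) * (2 + 2 * b + b ^ 2)) ^ 3 := by
    intro k
    obtain ⟨h0, h1, h2, h3, h4, h5, h6⟩ := box k
    rw [hx (k+4)]
    exact x_step ha hb h0 h1 h2 h3 h4
  have low : ∀ k : ℕ, Real.exp 0.5764643016505282 ^ (2 * 3 ^ (k+5)) ≤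
      x (k+4) ^ 2 * (2 + 2 * a + a ^ 2) ^ 3 := by
    intro k
    induction k with
    | zero => simpa using hlow0
    | succ k ih =>
      have hxp := (box k).1
      calc Real.exp 0.5764643016505282 ^ (2 * 3 ^ (k+1+5))
          = (Real.exp 0.5764643016505282 ^ (2 * 3 ^ (k+5))) ^ 3 := by
            rw [← pow_mul]; congr 1; ring
        _ ≤ (x (k+4) ^ 2 * (2 + 2 * a + a ^ 2) ^ 3) ^ 3 := by gcongr
        _ = ((x (k+4) * (2 + 2 * a + a ^ 2)) ^ 3) ^ 2 * (2 + 2 * a + a ^ 2) ^ 3 := by ring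
        _ ≤ x (k+4+1) ^ 2 * (2 + 2 * a + a ^ 2) ^ 3 := by
            have := (stepb k).1
            gcongr
        _ = x (k+1+4) ^ 2 * (2 + 2 * a + a ^ 2) ^ 3 := by
            rw [show k + 1 + 4 = k + 4 + 1 by ring]
  have upp : ∀ k : ℕ, x (k+4) ^ 2 * (2 + 2 * b + b ^ 2) ^ 3 ≤
      Real.exp 0.5764643016505285 ^ (2 * 3 ^ (k+5)) := by
    intro k
    induction k with
    | zero => simpa using hupp0
    | succ k ih =>
      have hxp := (box k).1
      have hxp1 := (box (k+1)).1
      rw [show k + 1 + 4 = k + 4 + 1 by ring] at hxp1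
      calc x (k+1+4) ^ 2 * (2 + 2 * b + b ^ 2) ^ 3
          = x (k+4+1) ^ 2 * (2 + 2 * b + b ^ 2) ^ 3 := by
            rw [show k + 1 + 4 = k + 4 + 1 by ring]
        _ ≤ ((x (k+4) * (2 + 2 * b + b ^ 2)) ^ 3) ^ 2 * (2 + 2 * b + b ^ 2) ^ 3 := by
            have := (stepb k).2
            gcongr
        _ = (x (k+4) ^ 2 * (2 + 2 * b + b ^ 2) ^ 3) ^ 3 := by ring
        _ ≤ (Real.exp 0.5764643016505285 ^ (2 * 3 ^ (k+5))) ^ 3 := by gcongr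
        _ = Real.exp 0.5764643016505285 ^ (2 * 3 ^ (k+1+5)) := by
            rw [← pow_mul]; congr 1; ring
  have hqa : 1 ≤ 2 + 2 * a + a ^ 2 := by nlinarith [sq_nonneg a]
  have hqb : 1 ≤ 2 + 2 * b + b ^ 2 := by nlinarith [sq_nonneg b]
  -- logarithmic versions
  have loglow : ∀ k : ℕ, 2 * 3 ^ (k+5) * (0.5764643016505282 : ℝ) ≤
      2 * Real.log (x (k+4)) + 3 * Real.log (2 + 2 * a + a ^ 2) := by
    intro k
    have hxp := (box k).1
    have h := Real.log_le_log (by positivity) (low k)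
    rw [Real.log_mul (by positivity) (by positivity), Real.log_pow, Real.log_pow, Real.log_pow,
      Real.log_exp] at h
    push_cast at h
    exact h
  have logupp : ∀ k : ℕ, 2 * Real.log (x (k+4)) ≤ 2 * 3 ^ (k+5) * (0.5764643016505285 : ℝ) := by
    intro k
    have hxp := (box k).1
    have h := Real.log_le_log (by positivity) (upp k)
    rw [Real.log_mul (by positivity) (by positivity), Real.log_pow, Real.log_pow, Real.log_pow,
      Real.log_exp] at h
    push_cast at h
    have := Real.log_nonneg hqb
    linarith
  have hmono : Monotone (fun k : ℕ => Real.log (x (k+4)) / 3 ^ (k+5)) := by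
    refine monotone_nat_of_le_succ fun k => ?_
    have hxp := (box k).1
    have h1 : x (k+4) ^ 3 ≤ x (k+1+4) := by
      rw [show k + 1 + 4 = k + 4 + 1 by ring]
      refine le_trans ?_ (stepb k).1
      gcongr
      exact le_mul_of_one_le_right hxp.le hqa
    have h2 := Real.log_le_log (by positivity) h1
    rw [Real.log_pow] at h2
    push_cast at h2
    rw [div_le_div_iff₀ (by positivity) (by positivity), show k + 1 + 5 = k + 5 + 1 by ring,
      pow_succ]
    have : (0:ℝ) < 3 ^ (k+5) := by positivity
    nlinarith
  have hle : ∀ k : ℕ, Real.log (x (k+4)) / 3 ^ (k+5) ≤ 0.5764643016505285 := by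
    intro k
    rw [div_le_iff₀ (by positivity)]
    linarith [logupp k]
  obtain ⟨μ, hμ⟩ : ∃ μ : ℝ, Tendsto (fun k : ℕ => Real.log (x (k+4)) / 3 ^ (k+5)) atTop (𝓝 μ) :=
    ⟨_, tendsto_atTop_ciSup hmono ⟨0.5764643016505285, by rintro _ ⟨k, rfl⟩; exact hle k⟩⟩
  have hz3 : ∀ C : ℝ, Tendsto (fun k : ℕ => C / (3:ℝ) ^ (k+5)) atTop (𝓝 0) := by
    intro C
    have h := (tendsto_pow_atTop_nhds_zero_of_lt_one (r := (1/3 : ℝ)) (by norm_num)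
      (by norm_num)).const_mul C
    rw [mul_zero] at h
    refine ((tendsto_add_atTop_iff_nat 5).2 h).congr fun k => ?_
    rw [one_div, inv_pow, div_eq_mul_inv]
  refine ⟨μ, ?_, ?_, ?_⟩
  · rw [← tendsto_add_atTop_iff_nat 4]
    have hup : Tendsto (fun k : ℕ => Real.log (x (k+4)) / 3 ^ (k+5)
        + Real.log (1 + 3 * b + 3 * (b * b) + b * (b * b)) / 3 ^ (k+5)) atTop (𝓝 μ) := by
      simpa using hμ.add (hz3 _)
    refine tendsto_of_tendsto_of_tendsto_of_le_of_le hμ hup (fun k => ?_) (fun k => ?_)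
    · obtain ⟨h0, h1, h2, h3, h4, h5, h6⟩ := box k
      have hY : 0 < y (k+4) := lt_of_lt_of_le (by positivity) h1
      have hZ : 0 < z (k+4) := lt_of_lt_of_le (by positivity) h3
      have hW : 0 < w (k+4) := lt_of_lt_of_le (by positivity) h5
      have : Real.log (x (k+4)) ≤ Real.log (x (k+4) + 3 * y (k+4) + 3 * z (k+4) + w (k+4)) :=
        Real.log_le_log h0 (by linarith)
      exact div_le_div_of_nonneg_right this (by positivity)
    · obtain ⟨h0, h1, h2, h3, h4, h5, h6⟩ := box k
      have hY : 0 < y (k+4) := lt_of_lt_of_le (by positivity) h1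
      have hZ : 0 < z (k+4) := lt_of_lt_of_le (by positivity) h3
      have hW : 0 < w (k+4) := lt_of_lt_of_le (by positivity) h5
      have h4' := h4.trans (mul_le_mul_of_nonneg_left h2 hb.le)
      have h6' := h6.trans (mul_le_mul_of_nonneg_left h4' hb.le)
      have : Real.log (x (k+4) + 3 * y (k+4) + 3 * z (k+4) + w (k+4)) ≤
          Real.log (x (k+4)) + Real.log (1 + 3 * b + 3 * (b * b) + b * (b * b)) := by
        rw [← Real.log_mul (by positivity) (by positivity)]
        exact Real.log_le_log (by positivity) (by nlinarith)
      rw [← add_div]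
      exact div_le_div_of_nonneg_right this (by positivity)
  · have hlim : Tendsto (fun k : ℕ => Real.log (x (k+4)) / 3 ^ (k+5)
        + (3 / 2 * Real.log (2 + 2 * a + a ^ 2)) / 3 ^ (k+5)) atTop (𝓝 μ) := by
      simpa using hμ.add (hz3 _)
    have : (0.5764643016505282 : ℝ) ≤ μ := by
      refine ge_of_tendsto' hlim fun k => ?_
      rw [← add_div, le_div_iff₀ (by positivity)]
      linarith [loglow k]
    refine lt_of_lt_of_le (by norm_num) this
  · have : μ ≤ (0.5764643016505285 : ℝ) := le_of_tendsto' hμ hle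
    refine lt_of_le_of_lt this (by norm_num)

set_option exponentiation.threshold 1000 in
set_option maxHeartbeats 1000000 in
theorem hanoi_entropy_value
    (x y z w : ℕ → ℝ)
    (hx0 : x 0 = 1) (hy0 : y 0 = 0) (hz0 : z 0 = 1) (hw0 : w 0 = 0)
    (hx : ∀ n : ℕ, x (n + 1) = 8 * (x n)^3 + 24 * (x n)^2 * y n + 6 * (x n)^2 * z n + 30 * x n * (y n)^2 + 18 * x n * y n * z n + 3 * x n * (z n)^2 + 14 * (y n)^3 + 15 * (y n)^2 * z n + 6 * y n * (z n)^2 + (z n)^3)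
    (hy : ∀ n : ℕ, y (n + 1) = 8 * (x n)^2 * y n + 8 * (x n)^2 * z n + 2 * (x n)^2 * w n + 16 * x n * (y n)^2 + 24 * x n * y n * z n + 6 * x n * y n * w n + 6 * x n * (z n)^2 + 2 * x n * z n * w n + 10 * (y n)^3 + 20 * (y n)^2 * z n + 5 * (y n)^2 * w n + 11 * y n * (z n)^2 + 4 * y n * z n * w n + 2 * (z n)^3 + (z n)^2 * w n)
    (hz : ∀ n : ℕ, z (n + 1) = 8 * x n * (y n)^2 + 16 * x n * y n * z n + 4 * x n * y n * w n + 10 * x n * (z n)^2 + 6 * x n * z n * w n + x n * (w n)^2 + 8 * (y n)^3 + 22 * (y n)^2 * z n + 6 * (y n)^2 * w n + 20 * y n * (z n)^2 + 12 * y n * z n * w n + 2 * y n * (w n)^2 + 5 * (z n)^3 + 4 * (z n)^2 * w n + z n * (w n)^2)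
    (hw : ∀ n : ℕ, w (n + 1) = 8 * (y n)^3 + 24 * (y n)^2 * z n + 6 * (y n)^2 * w n + 30 * y n * (z n)^2 + 18 * y n * z n * w n + 3 * y n * (w n)^2 + 14 * (z n)^3 + 15 * (z n)^2 * w n + 6 * z n * (w n)^2 + (w n)^3) :
    ∃ μ : ℝ, Tendsto (fun n => Real.log (x n + 3 * y n + 3 * z n + w n) / 3 ^ (n + 1)) atTop (𝓝 μ) ∧ 0.576464301650528 < μ ∧ μ < 0.576464301650529 := by
  have hx1 : x 1 = 18 := by
    have h := hx 0
    simp only [zero_add, Nat.reduceAdd, hx0, hy0, hz0, hw0] at h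
    rw [h]; norm_num
  have hy1 : y 1 = 16 := by
    have h := hy 0
    simp only [zero_add, Nat.reduceAdd, hx0, hy0, hz0, hw0] at h
    rw [h]; norm_num
  have hz1 : z 1 = 15 := by
    have h := hz 0
    simp only [zero_add, Nat.reduceAdd, hx0, hy0, hz0, hw0] at h
    rw [h]; norm_num
  have hw1 : w 1 = 14 := by
    have h := hw 0
    simp only [zero_add, Nat.reduceAdd, hx0, hy0, hz0, hw0] at h
    rw [h]; norm_num
  have hx2 : x 2 = 568301 := by
    have h := hx 1
    simp only [zero_add, Nat.reduceAdd, hx1, hy1, hz1, hw1] at h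
    rw [h]; norm_num
  have hy2 : y 2 = 521504 := by
    have h := hy 1
    simp only [zero_add, Nat.reduceAdd, hx1, hy1, hz1, hw1] at h
    rw [h]; norm_num
  have hz2 : z 2 = 478579 := by
    have h := hz 1
    simp only [zero_add, Nat.reduceAdd, hx1, hy1, hz1, hw1] at h
    rw [h]; norm_num
  have hw2 : w 2 = 439204 := by
    have h := hw 1
    simp only [zero_add, Nat.reduceAdd, hx1, hy1, hz1, hw1] at h
    rw [h]; norm_num
  have hx3 : x 3 = 18782596680434060148 := by
    have h := hx 2
    simp only [zero_add, Nat.reduceAdd, hx2, hy2, hz2, hw2] at h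
    rw [h]; norm_num
  have hy3 : y 3 = 17236435531779805328 := by
    have h := hy 2
    simp only [zero_add, Nat.reduceAdd, hx2, hy2, hz2, hw2] at h
    rw [h]; norm_num
  have hz3 : z 3 = 15817552541478488865 := by
    have h := hz 2
    simp only [zero_add, Nat.reduceAdd, hx2, hy2, hz2, hw2] at h
    rw [h]; norm_num
  have hw3 : w 3 = 14515470321889909750 := by
    have h := hw 2
    simp only [zero_add, Nat.reduceAdd, hx2, hy2, hz2, hw2] at h
    rw [h]; norm_num
  have hx4 : x 4 = 678123193803167986386556118594094113184356435935868627226877 := by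
    have h := hx 3
    simp only [zero_add, Nat.reduceAdd, hx3, hy3, hz3, hw3] at h
    rw [h]; norm_num
  have hy4 : y 4 = 622300894384375551059013160807945111737369742728844080426448 := by
    have h := hy 3
    simp only [zero_add, Nat.reduceAdd, hx3, hy3, hz3, hw3] at h
    rw [h]; norm_num
  have hz4 : z 4 = 571073820642683023017714727301299446189518123785705782627977 := by
    have h := hz 3
    simp only [zero_add, Nat.reduceAdd, hx3, hy3, hz3, hw3] at h
    rw [h]; norm_num
  have hw4 : w 4 = 524063699034303533098404490024650297819890593423488196501256 := by
    have h := hw 3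
    simp only [zero_add, Nat.reduceAdd, hx3, hy3, hz3, hw3] at h
    rw [h]; norm_num
  obtain ⟨a, ha⟩ : ∃ a : ℝ, a = 0.917681182521246406 := ⟨_, rfl⟩
  obtain ⟨b, hb⟩ : ∃ b : ℝ, b = 0.917681182521246407 := ⟨_, rfl⟩
  have ha0 : 0 < a := by rw [ha]; norm_num
  have hb0 : 0 < b := by rw [hb]; norm_num
  have hlow0 : Real.exp 0.5764643016505282 ^ (2 * 3 ^ 5) ≤ x 4 ^ 2 * (2 + 2 * a + a ^ 2) ^ 3 := by
    refine (pow_le_pow_left₀ (Real.exp_pos _).le exp_lower _).trans ?_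
    rw [hx4, ha]; norm_num
  have hupp0 : x 4 ^ 2 * (2 + 2 * b + b ^ 2) ^ 3 ≤ Real.exp 0.5764643016505285 ^ (2 * 3 ^ 5) := by
    refine le_trans ?_ (pow_le_pow_left₀ (by norm_num) exp_upper _)
    rw [hx4, hb]; norm_num
  have bax : a * x 4 ≤ y 4 := by rw [hx4, hy4, ha]; norm_num
  have bbx : y 4 ≤ b * x 4 := by rw [hx4, hy4, hb]; norm_num
  have bay : a * y 4 ≤ z 4 := by rw [hy4, hz4, ha]; norm_num
  have bby : z 4 ≤ b * y 4 := by rw [hy4, hz4, hb]; norm_num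
  have baz : a * z 4 ≤ w 4 := by rw [hz4, hw4, ha]; norm_num
  have bbz : w 4 ≤ b * z 4 := by rw [hz4, hw4, hb]; norm_num
  have hx4pos : 0 < x 4 := by rw [hx4]; norm_num
  exact main_aux x y z w a b ha0 hb0 hx hy hz hw hx4pos bax bbx bay bby baz bbz hlow0 hupp0
end

section
/- There exists a real number L such that the three ratio sequences all converge to L: lim_{n→∞} y_n/x_n = lim_{n→∞} z_n/y_n = lim_{n→∞} w_n/z_n = L. -/
open Filter Topology Real

def sierX (x y z : ℝ) : ℝ := 32 * x^3 + 96 * x^2 * y + 24 * x^2 * z + 108 * x * y^2 + 60 * x * y * z + 9 * x * z^2 + 44 * y^3 + 39 * y^2 * z + 12 * y * z^2 + z^3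
def sierY (x y z w : ℝ) : ℝ := 32 * x^2 * y + 32 * x^2 * z + 8 * x^2 * w + 64 * x * y^2 + 88 * x * y * z + 20 * x * y * w + 20 * x * z^2 + 6 * x * z * w + 36 * y^3 + 64 * y^2 * z + 13 * y^2 * w + 29 * y * z^2 + 8 * y * z * w + 4 * z^3 + z^2 * w
def sierZ (x y z w : ℝ) : ℝ := 32 * x * y^2 + 64 * x * y * z + 16 * x * y * w + 36 * x * z^2 + 20 * x * z * w + 3 * x * w^2 + 32 * y^3 + 80 * y^2 * z + 20 * y^2 * w + 64 * y * z^2 + 32 * y * z * w + 4 * y * w^2 + 13 * z^3 + 8 * z^2 * w + z * w^2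
def sierW (y z w : ℝ) : ℝ := 32 * y^3 + 96 * y^2 * z + 24 * y^2 * w + 108 * y * z^2 + 60 * y * z * w + 9 * y * w^2 + 44 * z^3 + 39 * z^2 * w + 12 * z * w^2 + w^3

/-- The invariant: positive, decreasing, log-convex. -/
structure SierInv (x y z w : ℝ) : Prop where
  w_pos : 0 < w
  wz : w ≤ z
  zzyw : z ^ 2 ≤ y * w
  yyxz : y ^ 2 ≤ x * z

lemma SierInv.param {x y z w : ℝ} (h : SierInv x y z w) :
    ∃ r s t : ℝ, 0 ≤ r ∧ 0 ≤ s ∧ 0 ≤ t ∧ z = w * (1 + r) ∧ y = w * (1 + r) * (1 + r + s) ∧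
      x = w * (1 + r) * (1 + r + s) * (1 + r + s + t) := by
  obtain ⟨hw, hwz, h1, h2⟩ := h
  have hz : 0 < z := hw.trans_le hwz
  have hy : 0 < y := by
    by_contra hy
    nlinarith [mul_nonneg (sub_nonneg.2 (not_lt.1 hy)) hw.le, pow_pos hz 2]
  refine ⟨z / w - 1, y / z - z / w, x / y - y / z, ?_, ?_, ?_, ?_, ?_, ?_⟩
  · rw [sub_nonneg, le_div_iff₀ hw]; linarith
  · rw [sub_nonneg, div_le_div_iff₀ hw hz]; nlinarith
  · rw [sub_nonneg, div_le_div_iff₀ hz hy]; nlinarith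
  · field_simp; ring
  · field_simp; ring
  · field_simp; ring

set_option maxHeartbeats 1000000 in
/-- The last ratio decreases by a definite proportion of the gap. -/
lemma SierInv.gap {x y z w : ℝ} (h : SierInv x y z w) :
    32 * y ^ 2 * (x * w - y * z) ≤ sierZ x y z w * w - sierW y z w * z := by
  have hw := h.w_pos
  obtain ⟨r, s, t, hr, hs, ht, rfl, rfl, rfl⟩ := h.param
  rw [← sub_nonneg]
  unfold sierW sierZ
  ring_nf
  positivity

lemma SierInv.order {x y z w : ℝ} (h : SierInv x y z w) :
    0 < z ∧ 0 < y ∧ 0 < x ∧ z ≤ y ∧ y ≤ x := by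
  have hw := h.w_pos
  obtain ⟨r, s, t, hr, hs, ht, rfl, rfl, rfl⟩ := h.param
  refine ⟨by positivity, by positivity, by positivity, ?_, ?_⟩
  · exact le_mul_of_one_le_right (by positivity) (by linarith)
  · exact le_mul_of_one_le_right (by positivity) (by linarith)

lemma SierInv.gap_nonneg {x y z w : ℝ} (h : SierInv x y z w) : 0 ≤ x * w - y * z := by
  have hw := h.w_pos
  obtain ⟨r, s, t, hr, hs, ht, rfl, rfl, rfl⟩ := h.param
  ring_nf
  positivity

/-- Coefficient facts for the two log-convexity certificates below. -/
lemma SierInv.minors {x y z w : ℝ} (h : SierInv x y z w) :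
    0 ≤ x * z - y ^ 2 ∧ 0 ≤ y * w - z ^ 2 ∧ y * w - z ^ 2 ≤ x * w - y * z := by
  have hw := h.w_pos
  obtain ⟨hz, hy, hx, hzy, hyx⟩ := h.order
  have h1 := sub_nonneg.2 h.yyxz
  have h2 := sub_nonneg.2 h.zzyw
  have h3 := h.gap_nonneg
  refine ⟨h1, h2, ?_⟩
  have k1 : y * (y * w - z ^ 2) ≤ y * (x * w - y * z) := by
    linarith [mul_nonneg (sub_nonneg.2 hzy) h3, mul_nonneg h1 hw.le]
  exact le_of_mul_le_mul_left k1 hy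

lemma SierInv.convex1 {x y z w : ℝ} (h : SierInv x y z w) :
    0 ≤ sierX x y z * sierZ x y z w - sierY x y z w ^ 2 := by
  have hw := h.w_pos
  obtain ⟨hz, hy, hx, hzy, hyx⟩ := h.order
  have hwz := h.wz
  obtain ⟨h1, h3, h32⟩ := h.minors
  have h2 := h.gap_nonneg
  have key : sierX x y z * sierZ x y z w - sierY x y z w ^ 2 =
      (x * z - y ^ 2) ^ 2 * (128 * x ^ 2 + 16 * x * y + 240 * x * (y - w) + 56 * y ^ 2 + 56 * y * (y - w)
        + 132 * y * z + 20 * z * (y - z) + 8 * z * (y - w) + 7 * w ^ 2)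
      + (x * z - y ^ 2) * (x * w - y * z) * (128 * x ^ 2 + 320 * x * y + 172 * x * z
        + 100 * x * (z - w) + 109 * y * z + 44 * y * (z - w) + 3 * z * (y - w) + 12 * z ^ 2)
      + (x * z - y ^ 2) * (y * w - z ^ 2) * (7 * z ^ 2 + 8 * z * w)
      + (x * w - y * z) ^ 2 * (32 * x ^ 2 + 96 * x * y + 88 * x * z + 20 * z * (x - z) + 48 * y * z)
      + 12 * z ^ 2 * (x * w - y * z) * ((x * w - y * z) - (y * w - z ^ 2))
      + 3 * z ^ 2 * ((x * w - y * z) - (y * w - z ^ 2)) * ((x * w - y * z) + (y * w - z ^ 2)) := by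
    unfold sierX sierY sierZ
    ring
  rw [key]
  have a1 := sub_nonneg.2 hwz
  have a2 := sub_nonneg.2 hzy
  have a3 := sub_nonneg.2 (hwz.trans hzy)
  have a4 := sub_nonneg.2 (hzy.trans hyx)
  have a5 := sub_nonneg.2 h32
  positivity

lemma SierInv.convex2 {x y z w : ℝ} (h : SierInv x y z w) :
    0 ≤ sierY x y z w * sierW y z w - sierZ x y z w ^ 2 := by
  have hw := h.w_pos
  obtain ⟨hz, hy, hx, hzy, hyx⟩ := h.order
  have hwz := h.wz
  obtain ⟨h1, h3, h32⟩ := h.minors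
  have h2 := h.gap_nonneg
  have key : sierY x y z w * sierW y z w - sierZ x y z w ^ 2 =
      (x * z - y ^ 2) ^ 2 * (128 * y ^ 2 + 256 * y * z + 12 * z ^ 2 + 80 * z * (z - w)
        + 20 * (z - w) * (z + w))
      + (x * z - y ^ 2) * (x * w - y * z) * (128 * y ^ 2 + 320 * y * z + 32 * y * w + 240 * z ^ 2
        + 4 * w ^ 2)
      + (x * z - y ^ 2) * (y * w - z ^ 2) * (56 * z ^ 2 + 8 * z * w + 7 * w ^ 2)
      + (x * w - y * z) ^ 2 * (32 * y ^ 2 + 96 * y * z + 8 * y * w + 95 * z ^ 2 + 4 * z * w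
        + (z - w) * (z + w))
      + (x * w - y * z) * (y * w - z ^ 2) * (29 * z ^ 2 + 11 * z * (z - w) + 4 * (z - w) * (z + w))
      + (y * w - z ^ 2) ^ 2 * (8 * z * (z - w) + 3 * (z - w) * (z + w))
      + 4 * z ^ 2 * ((x * w - y * z) - (y * w - z ^ 2)) * ((x * w - y * z) + (y * w - z ^ 2)) := by
    unfold sierW sierY sierZ
    ring
  rw [key]
  have a1 := sub_nonneg.2 hwz
  have a5 := sub_nonneg.2 h32
  positivity

lemma SierInv.next {x y z w : ℝ} (h : SierInv x y z w) :
    SierInv (sierX x y z) (sierY x y z w) (sierZ x y z w) (sierW y z w) := by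
  have hw := h.w_pos
  obtain ⟨hz, hy, hx, hzy, hyx⟩ := h.order
  have hg := h.gap
  have hg0 := h.gap_nonneg
  have hwz := h.wz
  have hW : 0 < sierW y z w := by unfold sierW; positivity
  refine ⟨hW, ?_, ?_, ?_⟩
  · have h1 : 0 ≤ 32 * y ^ 2 * (x * w - y * z) := by positivity
    have h2 : 0 < sierZ x y z w := by unfold sierZ; positivity
    have h3 : sierW y z w * z ≤ sierZ x y z w * z := by nlinarith
    exact le_of_mul_le_mul_right h3 hz
  · exact sub_nonneg.1 h.convex2
  · exact sub_nonneg.1 h.convex1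

lemma SierInv.sierZ_le {x y z w : ℝ} (h : SierInv x y z w) :
    sierZ x y z w ≤ 500 * (x * y ^ 2) := by
  have hw := h.w_pos
  obtain ⟨hz, hy, hx, hzy, hyx⟩ := h.order
  have hwz := h.wz
  have hwy := hwz.trans hzy
  have hzx := hzy.trans hyx
  have hwx := hwy.trans hyx
  have hle : sierZ x y z w ≤ 32 * x * y^2 + 64 * x * y * y + 16 * x * y * y + 36 * x * y^2 + 20 * x * y * y + 3 * x * y^2 + 32 * (x * y^2) + 80 * (y^2 * x) + 20 * (y^2 * x) + 64 * (x * y^2) + 32 * (x * y * y) + 4 * (x * y^2) + 13 * (x * y^2) + 8 * (y^2 * x) + x * y^2 := by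
    unfold sierZ
    have e1 : y ^ 3 ≤ x * y ^ 2 := by rw [pow_succ, mul_comm]; gcongr
    have e2 : z ^ 3 ≤ x * y ^ 2 := by rw [pow_succ, mul_comm]; gcongr
    have e3 : y * z * w ≤ x * y * y := by gcongr
    have e4 : 0 ≤ x * y ^ 2 := by positivity
    have e5 : 64 * y * z ^ 2 ≤ 64 * (x * y ^ 2) := by rw [mul_assoc]; gcongr
    have e6 : 4 * y * w ^ 2 ≤ 4 * (x * y ^ 2) := by rw [mul_assoc]; gcongr
    have e7 : y ^ 2 * z ≤ y ^ 2 * x := by gcongr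
    have e8 : y ^ 2 * w ≤ y ^ 2 * x := by gcongr
    have e9 : z ^ 2 * w ≤ y ^ 2 * x := by gcongr
    have e10 : z * w ^ 2 ≤ x * y ^ 2 := by gcongr
    have e11 : 64 * x * y * z ≤ 64 * x * y * y := by gcongr
    have e12 : 16 * x * y * w ≤ 16 * x * y * y := by gcongr
    have e13 : 36 * x * z ^ 2 ≤ 36 * x * y ^ 2 := by gcongr
    have e14 : 20 * x * z * w ≤ 20 * x * y * y := by gcongr
    have e15 : 3 * x * w ^ 2 ≤ 3 * x * y ^ 2 := by gcongr
    linarith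
  have : 0 ≤ x * y ^ 2 := by positivity
  nlinarith

/-- The gap between the outer ratios is controlled by the decrease of the last ratio. -/
lemma SierInv.ratio {x y z w : ℝ} (h : SierInv x y z w) :
    w / z - y / x ≤ 500 / 32 * (w / z - sierW y z w / sierZ x y z w) := by
  have hw := h.w_pos
  obtain ⟨hz, hy, hx, hzy, hyx⟩ := h.order
  have hg := h.gap
  have hg0 := h.gap_nonneg
  have hZ : 0 < sierZ x y z w := by unfold sierZ; positivity
  have hle := h.sierZ_le
  rw [div_sub_div _ _ hz.ne' hx.ne', div_sub_div _ _ hz.ne' hZ.ne', ← mul_div_assoc,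
    div_le_div_iff₀ (by positivity) (by positivity)]
  generalize sierZ x y z w = Z at *
  generalize sierW y z w = W at *
  have k1 : (x * w - y * z) * z * Z ≤ (x * w - y * z) * z * (500 * (x * y ^ 2)) := by gcongr
  have k2 : 500 / 32 * (z * x) * (32 * y ^ 2 * (x * w - y * z)) ≤
    500 / 32 * (z * x) * (Z * w - W * z) := by gcongr
  linarith

theorem sier_ratios_common_limit
    (x y z w : ℕ → ℝ)
    (hx0 : x 0 = 1) (hy0 : y 0 = 0) (hz0 : z 0 = 1) (hw0 : w 0 = 0)
    (hx : ∀ n : ℕ, x (n + 1) = 32 * (x n)^3 + 96 * (x n)^2 * y n + 24 * (x n)^2 * z n + 108 * x n * (y n)^2 + 60 * x n * y n * z n + 9 * x n * (z n)^2 + 44 * (y n)^3 + 39 * (y n)^2 * z n + 12 * y n * (z n)^2 + (z n)^3)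
    (hy : ∀ n : ℕ, y (n + 1) = 32 * (x n)^2 * y n + 32 * (x n)^2 * z n + 8 * (x n)^2 * w n + 64 * x n * (y n)^2 + 88 * x n * y n * z n + 20 * x n * y n * w n + 20 * x n * (z n)^2 + 6 * x n * z n * w n + 36 * (y n)^3 + 64 * (y n)^2 * z n + 13 * (y n)^2 * w n + 29 * y n * (z n)^2 + 8 * y n * z n * w n + 4 * (z n)^3 + (z n)^2 * w n)
    (hz : ∀ n : ℕ, z (n + 1) = 32 * x n * (y n)^2 + 64 * x n * y n * z n + 16 * x n * y n * w n + 36 * x n * (z n)^2 + 20 * x n * z n * w n + 3 * x n * (w n)^2 + 32 * (y n)^3 + 80 * (y n)^2 * z n + 20 * (y n)^2 * w n + 64 * y n * (z n)^2 + 32 * y n * z n * w n + 4 * y n * (w n)^2 + 13 * (z n)^3 + 8 * (z n)^2 * w n + z n * (w n)^2)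
    (hw : ∀ n : ℕ, w (n + 1) = 32 * (y n)^3 + 96 * (y n)^2 * z n + 24 * (y n)^2 * w n + 108 * y n * (z n)^2 + 60 * y n * z n * w n + 9 * y n * (w n)^2 + 44 * (z n)^3 + 39 * (z n)^2 * w n + 12 * z n * (w n)^2 + (w n)^3) :
    ∃ L : ℝ, Tendsto (fun n => y n / x n) atTop (𝓝 L) ∧ Tendsto (fun n => z n / y n) atTop (𝓝 L) ∧ Tendsto (fun n => w n / z n) atTop (𝓝 L) := by
  have inv : ∀ n, SierInv (x (n + 1)) (y (n + 1)) (z (n + 1)) (w (n + 1)) := by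
    intro n
    induction n with
    | zero =>
      rw [hx 0, hy 0, hz 0, hw 0, hx0, hy0, hz0, hw0]
      constructor <;> norm_num
    | succ n ih =>
      rw [hx (n + 1), hy (n + 1), hz (n + 1), hw (n + 1)]
      exact ih.next
  have hrat : ∀ n, w (n + 1) / z (n + 1) - y (n + 1) / x (n + 1) ≤
      500 / 32 * (w (n + 1) / z (n + 1) - w (n + 1 + 1) / z (n + 1 + 1)) := by
    intro n
    have := (inv n).ratio
    rw [hz (n + 1), hw (n + 1)]
    exact this
  have hab : ∀ n, y (n + 1) / x (n + 1) ≤ z (n + 1) / y (n + 1) := by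
    intro n
    obtain ⟨_, hy', hx', _, _⟩ := (inv n).order
    rw [div_le_div_iff₀ hx' hy']
    nlinarith [(inv n).yyxz]
  have hbc : ∀ n, z (n + 1) / y (n + 1) ≤ w (n + 1) / z (n + 1) := by
    intro n
    obtain ⟨hz', hy', _, _, _⟩ := (inv n).order
    rw [div_le_div_iff₀ hy' hz']
    nlinarith [(inv n).zzyw]
  have hanti : Antitone (fun n => w (n + 1) / z (n + 1)) := by
    refine antitone_nat_of_succ_le fun n => ?_
    have h1 := hrat n
    have h2 := hab n
    have h3 := hbc n
    linarith
  have hbdd : BddBelow (Set.range (fun n => w (n + 1) / z (n + 1))) := by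
    refine ⟨0, ?_⟩
    rintro _ ⟨n, rfl⟩
    exact div_nonneg (inv n).w_pos.le (inv n).order.1.le
  obtain ⟨L, hL⟩ : ∃ L, Tendsto (fun n => w (n + 1) / z (n + 1)) atTop (𝓝 L) :=
    ⟨_, tendsto_atTop_ciInf hanti hbdd⟩
  have hL1 : Tendsto (fun n => w (n + 1 + 1) / z (n + 1 + 1)) atTop (𝓝 L) :=
    hL.comp (tendsto_add_atTop_nat 1)
  have hlow : Tendsto (fun n => w (n + 1) / z (n + 1) -
      500 / 32 * (w (n + 1) / z (n + 1) - w (n + 1 + 1) / z (n + 1 + 1))) atTop (𝓝 L) := by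
    have := hL.sub ((hL.sub hL1).const_mul (500 / 32))
    simpa using this
  have hA : Tendsto (fun n => y (n + 1) / x (n + 1)) atTop (𝓝 L) :=
    tendsto_of_tendsto_of_tendsto_of_le_of_le hlow hL
      (fun n => by have := hrat n; simp only; linarith) (fun n => (hab n).trans (hbc n))
  have hB : Tendsto (fun n => z (n + 1) / y (n + 1)) atTop (𝓝 L) :=
    tendsto_of_tendsto_of_tendsto_of_le_of_le hA hL hab hbc
  exact ⟨L, (tendsto_add_atTop_iff_nat (f := fun n => y n / x n) 1).1 hA,
    (tendsto_add_atTop_iff_nat (f := fun n => z n / y n) 1).1 hB,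
    (tendsto_add_atTop_iff_nat (f := fun n => w n / z n) 1).1 hL⟩
end

section
/- The entropy per site μ_X = lim_{n→∞} (ln m_n) / ((7·3^n − 1)/2) exists, and for every integer k ≥ 1 it satisfies (2·ln x_k + ln(α_k^2 + 8α_k + 8) + 2·ln(α_k^2 + 2α_k + 2)) / (7·3^k) ≤ μ_X ≤ (2·ln x_k + ln(β_k^2 + 8β_k + 8) + 2·ln(β_k^2 + 2β_k + 2)) / (7·3^k), where α_k = y_k/x_k and β_k = z_k/y_k. -/
open Filter Topology Real

lemma cf_D1_20 (a b : ℝ) (ha : (106/125 : ℝ) ≤ a) (ha' : a ≤ 7/8) (hb : (106/125 : ℝ) ≤ b) (hb' : b ≤ 7/8) :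
    (727 : ℝ) ≤ (128*a^2 + 128*a^2*b^1 + 32*a^2*b^2 + 256*a^3 + 320*a^3*b^1 + 128*a^3*b^2 + 8*a^3*b^3 + 112*a^4 + 160*a^4*b^1 + 80*a^4*b^2 + 8*a^4*b^3) - (1*a^4*b^4) ∧
    (128*a^2 + 128*a^2*b^1 + 32*a^2*b^2 + 256*a^3 + 320*a^3*b^1 + 128*a^3*b^2 + 8*a^3*b^3 + 112*a^4 + 160*a^4*b^1 + 80*a^4*b^2 + 8*a^4*b^3) - (1*a^4*b^4) ≤ 818 := by
  have ha0 : 0 ≤ a := by linarith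
  have hb0 : 0 ≤ b := by linarith
  have l0 : 128*(106/125 : ℝ)^2 + 128*(106/125 : ℝ)^2*(106/125 : ℝ)^1 + 32*(106/125 : ℝ)^2*(106/125 : ℝ)^2 + 256*(106/125 : ℝ)^3 + 320*(106/125 : ℝ)^3*(106/125 : ℝ)^1 + 128*(106/125 : ℝ)^3*(106/125 : ℝ)^2 + 8*(106/125 : ℝ)^3*(106/125 : ℝ)^3 + 112*(106/125 : ℝ)^4 + 160*(106/125 : ℝ)^4*(106/125 : ℝ)^1 + 80*(106/125 : ℝ)^4*(106/125 : ℝ)^2 + 8*(106/125 : ℝ)^4*(106/125 : ℝ)^3 ≤ 128*a^2 + 128*a^2*b^1 + 32*a^2*b^2 + 256*a^3 + 320*a^3*b^1 + 128*a^3*b^2 + 8*a^3*b^3 + 112*a^4 + 160*a^4*b^1 + 80*a^4*b^2 + 8*a^4*b^3 := by gcongr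
  have u0 : 128*a^2 + 128*a^2*b^1 + 32*a^2*b^2 + 256*a^3 + 320*a^3*b^1 + 128*a^3*b^2 + 8*a^3*b^3 + 112*a^4 + 160*a^4*b^1 + 80*a^4*b^2 + 8*a^4*b^3 ≤ 128*(7/8 : ℝ)^2 + 128*(7/8 : ℝ)^2*(7/8 : ℝ)^1 + 32*(7/8 : ℝ)^2*(7/8 : ℝ)^2 + 256*(7/8 : ℝ)^3 + 320*(7/8 : ℝ)^3*(7/8 : ℝ)^1 + 128*(7/8 : ℝ)^3*(7/8 : ℝ)^2 + 8*(7/8 : ℝ)^3*(7/8 : ℝ)^3 + 112*(7/8 : ℝ)^4 + 160*(7/8 : ℝ)^4*(7/8 : ℝ)^1 + 80*(7/8 : ℝ)^4*(7/8 : ℝ)^2 + 8*(7/8 : ℝ)^4*(7/8 : ℝ)^3 := by gcongr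
  have l1 : 1*(106/125 : ℝ)^4*(106/125 : ℝ)^4 ≤ 1*a^4*b^4 := by gcongr
  have u1 : 1*a^4*b^4 ≤ 1*(7/8 : ℝ)^4*(7/8 : ℝ)^4 := by gcongr
  norm_num at *
  constructor <;> linarith

lemma cf_D1_11 (a b : ℝ) (ha : (106/125 : ℝ) ≤ a) (ha' : a ≤ 7/8) (hb : (106/125 : ℝ) ≤ b) (hb' : b ≤ 7/8) :
    (598 : ℝ) ≤ (128*a^2*b^1 + 64*a^2*b^2 + 320*a^3*b^1 + 224*a^3*b^2 + 16*a^3*b^3 + 240*a^4*b^1 + 200*a^4*b^2 + 12*a^4*b^3 + 56*a^5*b^1 + 52*a^5*b^2) - (2*a^4*b^4 + 4*a^5*b^3 + 4*a^5*b^4) ∧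
    (128*a^2*b^1 + 64*a^2*b^2 + 320*a^3*b^1 + 224*a^3*b^2 + 16*a^3*b^3 + 240*a^4*b^1 + 200*a^4*b^2 + 12*a^4*b^3 + 56*a^5*b^1 + 52*a^5*b^2) - (2*a^4*b^4 + 4*a^5*b^3 + 4*a^5*b^4) ≤ 694 := by
  have ha0 : 0 ≤ a := by linarith
  have hb0 : 0 ≤ b := by linarith
  have l0 : 128*(106/125 : ℝ)^2*(106/125 : ℝ)^1 + 64*(106/125 : ℝ)^2*(106/125 : ℝ)^2 + 320*(106/125 : ℝ)^3*(106/125 : ℝ)^1 + 224*(106/125 : ℝ)^3*(106/125 : ℝ)^2 + 16*(106/125 : ℝ)^3*(106/125 : ℝ)^3 + 240*(106/125 : ℝ)^4*(106/125 : ℝ)^1 + 200*(106/125 : ℝ)^4*(106/125 : ℝ)^2 + 12*(106/125 : ℝ)^4*(106/125 : ℝ)^3 + 56*(106/125 : ℝ)^5*(106/125 : ℝ)^1 + 52*(106/125 : ℝ)^5*(106/125 : ℝ)^2 ≤ 128*a^2*b^1 + 64*a^2*b^2 + 320*a^3*b^1 + 224*a^3*b^2 + 16*a^3*b^3 + 240*a^4*b^1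 + 200*a^4*b^2 + 12*a^4*b^3 + 56*a^5*b^1 + 52*a^5*b^2 := by gcongr
  have u0 : 128*a^2*b^1 + 64*a^2*b^2 + 320*a^3*b^1 + 224*a^3*b^2 + 16*a^3*b^3 + 240*a^4*b^1 + 200*a^4*b^2 + 12*a^4*b^3 + 56*a^5*b^1 + 52*a^5*b^2 ≤ 128*(7/8 : ℝ)^2*(7/8 : ℝ)^1 + 64*(7/8 : ℝ)^2*(7/8 : ℝ)^2 + 320*(7/8 : ℝ)^3*(7/8 : ℝ)^1 + 224*(7/8 : ℝ)^3*(7/8 : ℝ)^2 + 16*(7/8 : ℝ)^3*(7/8 : ℝ)^3 + 240*(7/8 : ℝ)^4*(7/8 : ℝ)^1 + 200*(7/8 : ℝ)^4*(7/8 : ℝ)^2 + 12*(7/8 : ℝ)^4*(7/8 : ℝ)^3 + 56*(7/8 : ℝ)^5*(7/8 : ℝ)^1 + 52*(7/8 : ℝ)^5*(7/8 : ℝ)^2 := by gcongr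
  have l1 : 2*(106/125 : ℝ)^4*(106/125 : ℝ)^4 + 4*(106/125 : ℝ)^5*(106/125 : ℝ)^3 + 4*(106/125 : ℝ)^5*(106/125 : ℝ)^4 ≤ 2*a^4*b^4 + 4*a^5*b^3 + 4*a^5*b^4 := by gcongr
  have u1 : 2*a^4*b^4 + 4*a^5*b^3 + 4*a^5*b^4 ≤ 2*(7/8 : ℝ)^4*(7/8 : ℝ)^4 + 4*(7/8 : ℝ)^5*(7/8 : ℝ)^3 + 4*(7/8 : ℝ)^5*(7/8 : ℝ)^4 := by gcongr
  norm_num at *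
  constructor <;> linarith

lemma cf_D1_02 (a b : ℝ) (ha : (106/125 : ℝ) ≤ a) (ha' : a ≤ 7/8) (hb : (106/125 : ℝ) ≤ b) (hb' : b ≤ 7/8) :
    (107 : ℝ) ≤ (32*a^2*b^2 + 96*a^3*b^2 + 8*a^3*b^3 + 100*a^4*b^2 + 4*a^4*b^3 + 44*a^5*b^2 + 7*a^6*b^2) - (1*a^4*b^4 + 11*a^5*b^3 + 4*a^5*b^4 + 8*a^6*b^3 + 3*a^6*b^4) ∧
    (32*a^2*b^2 + 96*a^3*b^2 + 8*a^3*b^3 + 100*a^4*b^2 + 4*a^4*b^3 + 44*a^5*b^2 + 7*a^6*b^2) - (1*a^4*b^4 + 11*a^5*b^3 + 4*a^5*b^4 + 8*a^6*b^3 + 3*a^6*b^4) ≤ 132 := by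
  have ha0 : 0 ≤ a := by linarith
  have hb0 : 0 ≤ b := by linarith
  have l0 : 32*(106/125 : ℝ)^2*(106/125 : ℝ)^2 + 96*(106/125 : ℝ)^3*(106/125 : ℝ)^2 + 8*(106/125 : ℝ)^3*(106/125 : ℝ)^3 + 100*(106/125 : ℝ)^4*(106/125 : ℝ)^2 + 4*(106/125 : ℝ)^4*(106/125 : ℝ)^3 + 44*(106/125 : ℝ)^5*(106/125 : ℝ)^2 + 7*(106/125 : ℝ)^6*(106/125 : ℝ)^2 ≤ 32*a^2*b^2 + 96*a^3*b^2 + 8*a^3*b^3 + 100*a^4*b^2 + 4*a^4*b^3 + 44*a^5*b^2 + 7*a^6*b^2 := by gcongr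
  have u0 : 32*a^2*b^2 + 96*a^3*b^2 + 8*a^3*b^3 + 100*a^4*b^2 + 4*a^4*b^3 + 44*a^5*b^2 + 7*a^6*b^2 ≤ 32*(7/8 : ℝ)^2*(7/8 : ℝ)^2 + 96*(7/8 : ℝ)^3*(7/8 : ℝ)^2 + 8*(7/8 : ℝ)^3*(7/8 : ℝ)^3 + 100*(7/8 : ℝ)^4*(7/8 : ℝ)^2 + 4*(7/8 : ℝ)^4*(7/8 : ℝ)^3 + 44*(7/8 : ℝ)^5*(7/8 : ℝ)^2 + 7*(7/8 : ℝ)^6*(7/8 : ℝ)^2 := by gcongr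
  have l1 : 1*(106/125 : ℝ)^4*(106/125 : ℝ)^4 + 11*(106/125 : ℝ)^5*(106/125 : ℝ)^3 + 4*(106/125 : ℝ)^5*(106/125 : ℝ)^4 + 8*(106/125 : ℝ)^6*(106/125 : ℝ)^3 + 3*(106/125 : ℝ)^6*(106/125 : ℝ)^4 ≤ 1*a^4*b^4 + 11*a^5*b^3 + 4*a^5*b^4 + 8*a^6*b^3 + 3*a^6*b^4 := by gcongr
  have u1 : 1*a^4*b^4 + 11*a^5*b^3 + 4*a^5*b^4 + 8*a^6*b^3 + 3*a^6*b^4 ≤ 1*(7/8 : ℝ)^4*(7/8 : ℝ)^4 + 11*(7/8 : ℝ)^5*(7/8 : ℝ)^3 + 4*(7/8 : ℝ)^5*(7/8 : ℝ)^4 + 8*(7/8 : ℝ)^6*(7/8 : ℝ)^3 + 3*(7/8 : ℝ)^6*(7/8 : ℝ)^4 := by gcongr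
  norm_num at *
  constructor <;> linarith

lemma cf_D3_20 (a b : ℝ) (ha : (106/125 : ℝ) ≤ a) (ha' : a ≤ 7/8) (hb : (106/125 : ℝ) ≤ b) (hb' : b ≤ 7/8) :
    (523 : ℝ) ≤ (128*a^4 + 384*a^4*b^1 + 464*a^4*b^2 + 288*a^4*b^3 + 88*a^4*b^4 + 8*a^4*b^5) - (1*a^4*b^6) ∧
    (128*a^4 + 384*a^4*b^1 + 464*a^4*b^2 + 288*a^4*b^3 + 88*a^4*b^4 + 8*a^4*b^5) - (1*a^4*b^6) ≤ 626 := by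
  have ha0 : 0 ≤ a := by linarith
  have hb0 : 0 ≤ b := by linarith
  have l0 : 128*(106/125 : ℝ)^4 + 384*(106/125 : ℝ)^4*(106/125 : ℝ)^1 + 464*(106/125 : ℝ)^4*(106/125 : ℝ)^2 + 288*(106/125 : ℝ)^4*(106/125 : ℝ)^3 + 88*(106/125 : ℝ)^4*(106/125 : ℝ)^4 + 8*(106/125 : ℝ)^4*(106/125 : ℝ)^5 ≤ 128*a^4 + 384*a^4*b^1 + 464*a^4*b^2 + 288*a^4*b^3 + 88*a^4*b^4 + 8*a^4*b^5 := by gcongr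
  have u0 : 128*a^4 + 384*a^4*b^1 + 464*a^4*b^2 + 288*a^4*b^3 + 88*a^4*b^4 + 8*a^4*b^5 ≤ 128*(7/8 : ℝ)^4 + 384*(7/8 : ℝ)^4*(7/8 : ℝ)^1 + 464*(7/8 : ℝ)^4*(7/8 : ℝ)^2 + 288*(7/8 : ℝ)^4*(7/8 : ℝ)^3 + 88*(7/8 : ℝ)^4*(7/8 : ℝ)^4 + 8*(7/8 : ℝ)^4*(7/8 : ℝ)^5 := by gcongr
  have l1 : 1*(106/125 : ℝ)^4*(106/125 : ℝ)^6 ≤ 1*a^4*b^6 := by gcongr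
  have u1 : 1*a^4*b^6 ≤ 1*(7/8 : ℝ)^4*(7/8 : ℝ)^6 := by gcongr
  norm_num at *
  constructor <;> linarith

lemma cf_D3_11 (a b : ℝ) (ha : (106/125 : ℝ) ≤ a) (ha' : a ≤ 7/8) (hb : (106/125 : ℝ) ≤ b) (hb' : b ≤ 7/8) :
    (429 : ℝ) ≤ (128*a^4*b^1 + 384*a^4*b^2 + 416*a^4*b^3 + 184*a^4*b^4 + 24*a^4*b^5 + 48*a^5*b^2 + 88*a^5*b^3 + 40*a^5*b^4) - (4*a^4*b^6 + 2*a^5*b^5 + 4*a^5*b^6) ∧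
    (128*a^4*b^1 + 384*a^4*b^2 + 416*a^4*b^3 + 184*a^4*b^4 + 24*a^4*b^5 + 48*a^5*b^2 + 88*a^5*b^3 + 40*a^5*b^4) - (4*a^4*b^6 + 2*a^5*b^5 + 4*a^5*b^6) ≤ 532 := by
  have ha0 : 0 ≤ a := by linarith
  have hb0 : 0 ≤ b := by linarith
  have l0 : 128*(106/125 : ℝ)^4*(106/125 : ℝ)^1 + 384*(106/125 : ℝ)^4*(106/125 : ℝ)^2 + 416*(106/125 : ℝ)^4*(106/125 : ℝ)^3 + 184*(106/125 : ℝ)^4*(106/125 : ℝ)^4 + 24*(106/125 : ℝ)^4*(106/125 : ℝ)^5 + 48*(106/125 : ℝ)^5*(106/125 : ℝ)^2 + 88*(106/125 : ℝ)^5*(106/125 : ℝ)^3 + 40*(106/125 : ℝ)^5*(106/125 : ℝ)^4 ≤ 128*a^4*b^1 + 384*a^4*b^2 + 416*a^4*b^3 + 184*a^4*b^4 + 24*a^4*b^5 + 48*a^5*b^2 + 88*a^5*b^3 + 40*a^5*b^4 := by gcongr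
  have u0 : 128*a^4*b^1 + 384*a^4*b^2 + 416*a^4*b^3 + 184*a^4*b^4 + 24*a^4*b^5 + 48*a^5*b^2 + 88*a^5*b^3 + 40*a^5*b^4 ≤ 128*(7/8 : ℝ)^4*(7/8 : ℝ)^1 + 384*(7/8 : ℝ)^4*(7/8 : ℝ)^2 + 416*(7/8 : ℝ)^4*(7/8 : ℝ)^3 + 184*(7/8 : ℝ)^4*(7/8 : ℝ)^4 + 24*(7/8 : ℝ)^4*(7/8 : ℝ)^5 + 48*(7/8 : ℝ)^5*(7/8 : ℝ)^2 + 88*(7/8 : ℝ)^5*(7/8 : ℝ)^3 + 40*(7/8 : ℝ)^5*(7/8 : ℝ)^4 := by gcongr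
  have l1 : 4*(106/125 : ℝ)^4*(106/125 : ℝ)^6 + 2*(106/125 : ℝ)^5*(106/125 : ℝ)^5 + 4*(106/125 : ℝ)^5*(106/125 : ℝ)^6 ≤ 4*a^4*b^6 + 2*a^5*b^5 + 4*a^5*b^6 := by gcongr
  have u1 : 4*a^4*b^6 + 2*a^5*b^5 + 4*a^5*b^6 ≤ 4*(7/8 : ℝ)^4*(7/8 : ℝ)^6 + 2*(7/8 : ℝ)^5*(7/8 : ℝ)^5 + 4*(7/8 : ℝ)^5*(7/8 : ℝ)^6 := by gcongr
  norm_num at *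
  constructor <;> linarith

lemma cf_D3_02 (a b : ℝ) (ha : (106/125 : ℝ) ≤ a) (ha' : a ≤ 7/8) (hb : (106/125 : ℝ) ≤ b) (hb' : b ≤ 7/8) :
    (72 : ℝ) ≤ (32*a^4*b^2 + 128*a^4*b^3 + 104*a^4*b^4 + 24*a^4*b^5 + 24*a^5*b^3 + 28*a^5*b^4 + 3*a^6*b^4) - (6*a^4*b^6 + 32*a^5*b^2 + 2*a^5*b^5 + 12*a^5*b^6 + 20*a^6*b^2 + 4*a^6*b^3 + 3*a^6*b^6) ∧
    (32*a^4*b^2 + 128*a^4*b^3 + 104*a^4*b^4 + 24*a^4*b^5 + 24*a^5*b^3 + 28*a^5*b^4 + 3*a^6*b^4) - (6*a^4*b^6 + 32*a^5*b^2 + 2*a^5*b^5 + 12*a^5*b^6 + 20*a^6*b^2 + 4*a^6*b^3 + 3*a^6*b^6) ≤ 105 := by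
  have ha0 : 0 ≤ a := by linarith
  have hb0 : 0 ≤ b := by linarith
  have l0 : 32*(106/125 : ℝ)^4*(106/125 : ℝ)^2 + 128*(106/125 : ℝ)^4*(106/125 : ℝ)^3 + 104*(106/125 : ℝ)^4*(106/125 : ℝ)^4 + 24*(106/125 : ℝ)^4*(106/125 : ℝ)^5 + 24*(106/125 : ℝ)^5*(106/125 : ℝ)^3 + 28*(106/125 : ℝ)^5*(106/125 : ℝ)^4 + 3*(106/125 : ℝ)^6*(106/125 : ℝ)^4 ≤ 32*a^4*b^2 + 128*a^4*b^3 + 104*a^4*b^4 + 24*a^4*b^5 + 24*a^5*b^3 + 28*a^5*b^4 + 3*a^6*b^4 := by gcongr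
  have u0 : 32*a^4*b^2 + 128*a^4*b^3 + 104*a^4*b^4 + 24*a^4*b^5 + 24*a^5*b^3 + 28*a^5*b^4 + 3*a^6*b^4 ≤ 32*(7/8 : ℝ)^4*(7/8 : ℝ)^2 + 128*(7/8 : ℝ)^4*(7/8 : ℝ)^3 + 104*(7/8 : ℝ)^4*(7/8 : ℝ)^4 + 24*(7/8 : ℝ)^4*(7/8 : ℝ)^5 + 24*(7/8 : ℝ)^5*(7/8 : ℝ)^3 + 28*(7/8 : ℝ)^5*(7/8 : ℝ)^4 + 3*(7/8 : ℝ)^6*(7/8 : ℝ)^4 := by gcongr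
  have l1 : 6*(106/125 : ℝ)^4*(106/125 : ℝ)^6 + 32*(106/125 : ℝ)^5*(106/125 : ℝ)^2 + 2*(106/125 : ℝ)^5*(106/125 : ℝ)^5 + 12*(106/125 : ℝ)^5*(106/125 : ℝ)^6 + 20*(106/125 : ℝ)^6*(106/125 : ℝ)^2 + 4*(106/125 : ℝ)^6*(106/125 : ℝ)^3 + 3*(106/125 : ℝ)^6*(106/125 : ℝ)^6 ≤ 6*a^4*b^6 + 32*a^5*b^2 + 2*a^5*b^5 + 12*a^5*b^6 + 20*a^6*b^2 + 4*a^6*b^3 + 3*a^6*b^6 := by gcongr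
  have u1 : 6*a^4*b^6 + 32*a^5*b^2 + 2*a^5*b^5 + 12*a^5*b^6 + 20*a^6*b^2 + 4*a^6*b^3 + 3*a^6*b^6 ≤ 6*(7/8 : ℝ)^4*(7/8 : ℝ)^6 + 32*(7/8 : ℝ)^5*(7/8 : ℝ)^2 + 2*(7/8 : ℝ)^5*(7/8 : ℝ)^5 + 12*(7/8 : ℝ)^5*(7/8 : ℝ)^6 + 20*(7/8 : ℝ)^6*(7/8 : ℝ)^2 + 4*(7/8 : ℝ)^6*(7/8 : ℝ)^3 + 3*(7/8 : ℝ)^6*(7/8 : ℝ)^6 := by gcongr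
  norm_num at *
  constructor <;> linarith

lemma cf_D3_03 (a b : ℝ) (ha : (106/125 : ℝ) ≤ a) (ha' : a ≤ 7/8) (hb : (106/125 : ℝ) ≤ b) (hb' : b ≤ 7/8) :
    (-7 : ℝ) ≤ (8*a^4*b^3 + 8*a^4*b^4) - (4*a^4*b^5 + 4*a^5*b^3 + 2*a^5*b^4 + 12*a^5*b^5 + 7*a^6*b^3 + 4*a^6*b^4 + 6*a^6*b^5) ∧
    (8*a^4*b^3 + 8*a^4*b^4) - (4*a^4*b^5 + 4*a^5*b^3 + 2*a^5*b^4 + 12*a^5*b^5 + 7*a^6*b^3 + 4*a^6*b^4 + 6*a^6*b^5) ≤ -2 := by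
  have ha0 : 0 ≤ a := by linarith
  have hb0 : 0 ≤ b := by linarith
  have l0 : 8*(106/125 : ℝ)^4*(106/125 : ℝ)^3 + 8*(106/125 : ℝ)^4*(106/125 : ℝ)^4 ≤ 8*a^4*b^3 + 8*a^4*b^4 := by gcongr
  have u0 : 8*a^4*b^3 + 8*a^4*b^4 ≤ 8*(7/8 : ℝ)^4*(7/8 : ℝ)^3 + 8*(7/8 : ℝ)^4*(7/8 : ℝ)^4 := by gcongr
  have l1 : 4*(106/125 : ℝ)^4*(106/125 : ℝ)^5 + 4*(106/125 : ℝ)^5*(106/125 : ℝ)^3 + 2*(106/125 : ℝ)^5*(106/125 : ℝ)^4 + 12*(106/125 : ℝ)^5*(106/125 : ℝ)^5 + 7*(106/125 : ℝ)^6*(106/125 : ℝ)^3 + 4*(106/125 : ℝ)^6*(106/125 : ℝ)^4 + 6*(106/125 : ℝ)^6*(106/125 : ℝ)^5 ≤ 4*a^4*b^5 + 4*a^5*b^3 + 2*a^5*b^4 + 12*a^5*b^5 + 7*a^6*b^3 + 4*a^6*b^4 + 6*a^6*b^5 := by gcongr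
  have u1 : 4*a^4*b^5 + 4*a^5*b^3 + 2*a^5*b^4 + 12*a^5*b^5 + 7*a^6*b^3 + 4*a^6*b^4 + 6*a^6*b^5 ≤ 4*(7/8 : ℝ)^4*(7/8 : ℝ)^5 + 4*(7/8 : ℝ)^5*(7/8 : ℝ)^3 + 2*(7/8 : ℝ)^5*(7/8 : ℝ)^4 + 12*(7/8 : ℝ)^5*(7/8 : ℝ)^5 + 7*(7/8 : ℝ)^6*(7/8 : ℝ)^3 + 4*(7/8 : ℝ)^6*(7/8 : ℝ)^4 + 6*(7/8 : ℝ)^6*(7/8 : ℝ)^5 := by gcongr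
  norm_num at *
  constructor <;> linarith

lemma cf_D3_04 (a b : ℝ) (ha : (106/125 : ℝ) ≤ a) (ha' : a ≤ 7/8) (hb : (106/125 : ℝ) ≤ b) (hb' : b ≤ 7/8) :
    (-3 : ℝ) ≤ (0) - (1*a^4*b^4 + 4*a^5*b^4 + 3*a^6*b^4) ∧
    (0) - (1*a^4*b^4 + 4*a^5*b^4 + 3*a^6*b^4) ≤ -1 := by
  have ha0 : 0 ≤ a := by linarith
  have hb0 : 0 ≤ b := by linarith
  have l1 : 1*(106/125 : ℝ)^4*(106/125 : ℝ)^4 + 4*(106/125 : ℝ)^5*(106/125 : ℝ)^4 + 3*(106/125 : ℝ)^6*(106/125 : ℝ)^4 ≤ 1*a^4*b^4 + 4*a^5*b^4 + 3*a^6*b^4 := by gcongr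
  have u1 : 1*a^4*b^4 + 4*a^5*b^4 + 3*a^6*b^4 ≤ 1*(7/8 : ℝ)^4*(7/8 : ℝ)^4 + 4*(7/8 : ℝ)^5*(7/8 : ℝ)^4 + 3*(7/8 : ℝ)^6*(7/8 : ℝ)^4 := by gcongr
  norm_num at *
  constructor <;> linarith

lemma cf_be_10 (a b : ℝ) (ha : (106/125 : ℝ) ≤ a) (ha' : a ≤ 7/8) (hb : (106/125 : ℝ) ≤ b) (hb' : b ≤ 7/8) :
    (116 : ℝ) ≤ (32*a^1 + 32*a^1*b^1 + 8*a^1*b^2 + 32*a^2 + 44*a^2*b^1 + 20*a^2*b^2 + 3*a^2*b^3) - (0) ∧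
    (32*a^1 + 32*a^1*b^1 + 8*a^1*b^2 + 32*a^2 + 44*a^2*b^1 + 20*a^2*b^2 + 3*a^2*b^3) - (0) ≤ 126 := by
  have ha0 : 0 ≤ a := by linarith
  have hb0 : 0 ≤ b := by linarith
  have l0 : 32*(106/125 : ℝ)^1 + 32*(106/125 : ℝ)^1*(106/125 : ℝ)^1 + 8*(106/125 : ℝ)^1*(106/125 : ℝ)^2 + 32*(106/125 : ℝ)^2 + 44*(106/125 : ℝ)^2*(106/125 : ℝ)^1 + 20*(106/125 : ℝ)^2*(106/125 : ℝ)^2 + 3*(106/125 : ℝ)^2*(106/125 : ℝ)^3 ≤ 32*a^1 + 32*a^1*b^1 + 8*a^1*b^2 + 32*a^2 + 44*a^2*b^1 + 20*a^2*b^2 + 3*a^2*b^3 := by gcongr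
  have u0 : 32*a^1 + 32*a^1*b^1 + 8*a^1*b^2 + 32*a^2 + 44*a^2*b^1 + 20*a^2*b^2 + 3*a^2*b^3 ≤ 32*(7/8 : ℝ)^1 + 32*(7/8 : ℝ)^1*(7/8 : ℝ)^1 + 8*(7/8 : ℝ)^1*(7/8 : ℝ)^2 + 32*(7/8 : ℝ)^2 + 44*(7/8 : ℝ)^2*(7/8 : ℝ)^1 + 20*(7/8 : ℝ)^2*(7/8 : ℝ)^2 + 3*(7/8 : ℝ)^2*(7/8 : ℝ)^3 := by gcongr
  norm_num at *
  constructor <;> linarith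

lemma cf_be_01 (a b : ℝ) (ha : (106/125 : ℝ) ≤ a) (ha' : a ≤ 7/8) (hb : (106/125 : ℝ) ≤ b) (hb' : b ≤ 7/8) :
    (-32 : ℝ) ≤ (8*a^1*b^2) - (16*a^2*b^1 + 20*a^3*b^1 + 19*a^3*b^2 + 8*a^3*b^3 + 1*a^3*b^4) ∧
    (8*a^1*b^2) - (16*a^2*b^1 + 20*a^3*b^1 + 19*a^3*b^2 + 8*a^3*b^3 + 1*a^3*b^4) ≤ -26 := by
  have ha0 : 0 ≤ a := by linarith
  have hb0 : 0 ≤ b := by linarith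
  have l0 : 8*(106/125 : ℝ)^1*(106/125 : ℝ)^2 ≤ 8*a^1*b^2 := by gcongr
  have u0 : 8*a^1*b^2 ≤ 8*(7/8 : ℝ)^1*(7/8 : ℝ)^2 := by gcongr
  have l1 : 16*(106/125 : ℝ)^2*(106/125 : ℝ)^1 + 20*(106/125 : ℝ)^3*(106/125 : ℝ)^1 + 19*(106/125 : ℝ)^3*(106/125 : ℝ)^2 + 8*(106/125 : ℝ)^3*(106/125 : ℝ)^3 + 1*(106/125 : ℝ)^3*(106/125 : ℝ)^4 ≤ 16*a^2*b^1 + 20*a^3*b^1 + 19*a^3*b^2 + 8*a^3*b^3 + 1*a^3*b^4 := by gcongr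
  have u1 : 16*a^2*b^1 + 20*a^3*b^1 + 19*a^3*b^2 + 8*a^3*b^3 + 1*a^3*b^4 ≤ 16*(7/8 : ℝ)^2*(7/8 : ℝ)^1 + 20*(7/8 : ℝ)^3*(7/8 : ℝ)^1 + 19*(7/8 : ℝ)^3*(7/8 : ℝ)^2 + 8*(7/8 : ℝ)^3*(7/8 : ℝ)^3 + 1*(7/8 : ℝ)^3*(7/8 : ℝ)^4 := by gcongr
  norm_num at *
  constructor <;> linarith

lemma cf_be_02 (a b : ℝ) (ha : (106/125 : ℝ) ≤ a) (ha' : a ≤ 7/8) (hb : (106/125 : ℝ) ≤ b) (hb' : b ≤ 7/8) :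
    (-5 : ℝ) ≤ (0) - (3*a^2*b^2 + 4*a^3*b^2 + 1*a^3*b^3) ∧
    (0) - (3*a^2*b^2 + 4*a^3*b^2 + 1*a^3*b^3) ≤ -3 := by
  have ha0 : 0 ≤ a := by linarith
  have hb0 : 0 ≤ b := by linarith
  have l1 : 3*(106/125 : ℝ)^2*(106/125 : ℝ)^2 + 4*(106/125 : ℝ)^3*(106/125 : ℝ)^2 + 1*(106/125 : ℝ)^3*(106/125 : ℝ)^3 ≤ 3*a^2*b^2 + 4*a^3*b^2 + 1*a^3*b^3 := by gcongr
  have u1 : 3*a^2*b^2 + 4*a^3*b^2 + 1*a^3*b^3 ≤ 3*(7/8 : ℝ)^2*(7/8 : ℝ)^2 + 4*(7/8 : ℝ)^3*(7/8 : ℝ)^2 + 1*(7/8 : ℝ)^3*(7/8 : ℝ)^3 := by gcongr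
  norm_num at *
  constructor <;> linarith

def fX (x y z w : ℝ) : ℝ := 32*x^3+96*x^2*y+24*x^2*z+108*x*y^2+60*x*y*z+9*x*z^2+44*y^3+39*y^2*z+12*y*z^2+z^3
def fY (x y z w : ℝ) : ℝ := 32*x^2*y+32*x^2*z+8*x^2*w+64*x*y^2+88*x*y*z+20*x*y*w+20*x*z^2+6*x*z*w+36*y^3+64*y^2*z+13*y^2*w+29*y*z^2+8*y*z*w+4*z^3+z^2*w
def fZ (x y z w : ℝ) : ℝ := 32*x*y^2+64*x*y*z+16*x*y*w+36*x*z^2+20*x*z*w+3*x*w^2+32*y^3+80*y^2*z+20*y^2*w+64*y*z^2+32*y*z*w+4*y*w^2+13*z^3+8*z^2*w+z*w^2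
def fW (x y z w : ℝ) : ℝ := 32*y^3+96*y^2*z+24*y^2*w+108*y*z^2+60*y*z*w+9*y*w^2+44*z^3+39*z^2*w+12*z*w^2+w^3

set_option maxHeartbeats 4000000 in
lemma norm_step (a b q : ℝ) (ha : (106/125 : ℝ) ≤ a) (hab : a ≤ b) (hb' : b ≤ 7/8) (hq : 0 ≤ q)
    (hpq : a*b*q ≤ b - a) (X Y Z W : ℝ) (hX : X = fX 1 a (a*b) (a*b*(b+q))) (hY : Y = fY 1 a (a*b) (a*b*(b+q)))
    (hZ : Z = fZ 1 a (a*b) (a*b*(b+q))) (hW : W = fW 1 a (a*b) (a*b*(b+q))) :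
    0 < X ∧ 0 < Y ∧ 0 < Z ∧ 0 ≤ X*Z - Y^2 ∧ 0 ≤ Y*W - Z^2 ∧ Y*W - Z^2 ≤ X*Z - Y^2 ∧ a*X ≤ Y ∧ Z ≤ b*Y := by
  have ha' : a ≤ 7/8 := hab.trans hb'
  have hb : (106/125 : ℝ) ≤ b := ha.trans hab
  have ha0 : 0 < a := by linarith
  have hb0 : 0 < b := by linarith
  have hp : 0 ≤ b - a := by linarith
  have h7 : (7/10 : ℝ) ≤ a*b := by nlinarith
  have hq7 : 7/10 * q ≤ b - a := le_trans (by gcongr) hpq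
  have hq1 : q ≤ 1/20 := by linarith

  have eD1 : X*Z - Y^2 = ((128*a^2 + 128*a^2*b^1 + 32*a^2*b^2 + 256*a^3 + 320*a^3*b^1 + 128*a^3*b^2 + 8*a^3*b^3 + 112*a^4 + 160*a^4*b^1 + 80*a^4*b^2 + 8*a^4*b^3) - (1*a^4*b^4)) * ((b-a)^2 * q^0)
      + ((128*a^2*b^1 + 64*a^2*b^2 + 320*a^3*b^1 + 224*a^3*b^2 + 16*a^3*b^3 + 240*a^4*b^1 + 200*a^4*b^2 + 12*a^4*b^3 + 56*a^5*b^1 + 52*a^5*b^2) - (2*a^4*b^4 + 4*a^5*b^3 + 4*a^5*b^4)) * ((b-a)^1 * q^1)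
      + ((32*a^2*b^2 + 96*a^3*b^2 + 8*a^3*b^3 + 100*a^4*b^2 + 4*a^4*b^3 + 44*a^5*b^2 + 7*a^6*b^2) - (1*a^4*b^4 + 11*a^5*b^3 + 4*a^5*b^4 + 8*a^6*b^3 + 3*a^6*b^4)) * ((b-a)^0 * q^2) := by
    rw [hX, hY, hZ]; simp only [fX, fY, fZ, fW]; ring
  have eD3 : Y*W - Z^2 = ((128*a^4 + 384*a^4*b^1 + 464*a^4*b^2 + 288*a^4*b^3 + 88*a^4*b^4 + 8*a^4*b^5) - (1*a^4*b^6)) * ((b-a)^2 * q^0)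
      + ((128*a^4*b^1 + 384*a^4*b^2 + 416*a^4*b^3 + 184*a^4*b^4 + 24*a^4*b^5 + 48*a^5*b^2 + 88*a^5*b^3 + 40*a^5*b^4) - (4*a^4*b^6 + 2*a^5*b^5 + 4*a^5*b^6)) * ((b-a)^1 * q^1)
      + ((32*a^4*b^2 + 128*a^4*b^3 + 104*a^4*b^4 + 24*a^4*b^5 + 24*a^5*b^3 + 28*a^5*b^4 + 3*a^6*b^4) - (6*a^4*b^6 + 32*a^5*b^2 + 2*a^5*b^5 + 12*a^5*b^6 + 20*a^6*b^2 + 4*a^6*b^3 + 3*a^6*b^6)) * ((b-a)^0 * q^2)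
      + ((8*a^4*b^3 + 8*a^4*b^4) - (4*a^4*b^5 + 4*a^5*b^3 + 2*a^5*b^4 + 12*a^5*b^5 + 7*a^6*b^3 + 4*a^6*b^4 + 6*a^6*b^5)) * ((b-a)^0 * q^3)
      + ((0) - (1*a^4*b^4 + 4*a^5*b^4 + 3*a^6*b^4)) * ((b-a)^0 * q^4) := by
    rw [hY, hZ, hW]; simp only [fX, fY, fZ, fW]; ring
  have eal : Y - a*X = (32*a^1 + 8*a^1*b^1 + 72*a^2 + 40*a^2*b^1 + 6*a^2*b^2 + 44*a^3 + 39*a^3*b^1 + 12*a^3*b^2 + 1*a^3*b^3) * ((b-a)^1 * q^0)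
      + (8*a^1*b^1 + 20*a^2*b^1 + 6*a^2*b^2 + 13*a^3*b^1 + 8*a^3*b^2 + 1*a^3*b^3) * ((b-a)^0 * q^1) := by
    rw [hX, hY]; simp only [fX, fY, fZ, fW]; ring
  have ebe : b*Y - Z = ((32*a^1 + 32*a^1*b^1 + 8*a^1*b^2 + 32*a^2 + 44*a^2*b^1 + 20*a^2*b^2 + 3*a^2*b^3) - (0)) * ((b-a)^1 * q^0)
      + ((8*a^1*b^2) - (16*a^2*b^1 + 20*a^3*b^1 + 19*a^3*b^2 + 8*a^3*b^3 + 1*a^3*b^4)) * ((b-a)^0 * q^1)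
      + ((0) - (3*a^2*b^2 + 4*a^3*b^2 + 1*a^3*b^3)) * ((b-a)^0 * q^2) := by
    rw [hY, hZ]; simp only [fX, fY, fZ, fW]; ring
  have cD1_20 := cf_D1_20 a b ha ha' hb hb'
  generalize ((128*a^2 + 128*a^2*b^1 + 32*a^2*b^2 + 256*a^3 + 320*a^3*b^1 + 128*a^3*b^2 + 8*a^3*b^3 + 112*a^4 + 160*a^4*b^1 + 80*a^4*b^2 + 8*a^4*b^3) - (1*a^4*b^4)) = kD1_20 at cD1_20 eD1
  have cD1_11 := cf_D1_11 a b ha ha' hb hb'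
  generalize ((128*a^2*b^1 + 64*a^2*b^2 + 320*a^3*b^1 + 224*a^3*b^2 + 16*a^3*b^3 + 240*a^4*b^1 + 200*a^4*b^2 + 12*a^4*b^3 + 56*a^5*b^1 + 52*a^5*b^2) - (2*a^4*b^4 + 4*a^5*b^3 + 4*a^5*b^4)) = kD1_11 at cD1_11 eD1
  have cD1_02 := cf_D1_02 a b ha ha' hb hb'
  generalize ((32*a^2*b^2 + 96*a^3*b^2 + 8*a^3*b^3 + 100*a^4*b^2 + 4*a^4*b^3 + 44*a^5*b^2 + 7*a^6*b^2) - (1*a^4*b^4 + 11*a^5*b^3 + 4*a^5*b^4 + 8*a^6*b^3 + 3*a^6*b^4)) = kD1_02 at cD1_02 eD1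
  have cD3_20 := cf_D3_20 a b ha ha' hb hb'
  generalize ((128*a^4 + 384*a^4*b^1 + 464*a^4*b^2 + 288*a^4*b^3 + 88*a^4*b^4 + 8*a^4*b^5) - (1*a^4*b^6)) = kD3_20 at cD3_20 eD3
  have cD3_11 := cf_D3_11 a b ha ha' hb hb'
  generalize ((128*a^4*b^1 + 384*a^4*b^2 + 416*a^4*b^3 + 184*a^4*b^4 + 24*a^4*b^5 + 48*a^5*b^2 + 88*a^5*b^3 + 40*a^5*b^4) - (4*a^4*b^6 + 2*a^5*b^5 + 4*a^5*b^6)) = kD3_11 at cD3_11 eD3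
  have cD3_02 := cf_D3_02 a b ha ha' hb hb'
  generalize ((32*a^4*b^2 + 128*a^4*b^3 + 104*a^4*b^4 + 24*a^4*b^5 + 24*a^5*b^3 + 28*a^5*b^4 + 3*a^6*b^4) - (6*a^4*b^6 + 32*a^5*b^2 + 2*a^5*b^5 + 12*a^5*b^6 + 20*a^6*b^2 + 4*a^6*b^3 + 3*a^6*b^6)) = kD3_02 at cD3_02 eD3
  have cD3_03 := cf_D3_03 a b ha ha' hb hb'
  generalize ((8*a^4*b^3 + 8*a^4*b^4) - (4*a^4*b^5 + 4*a^5*b^3 + 2*a^5*b^4 + 12*a^5*b^5 + 7*a^6*b^3 + 4*a^6*b^4 + 6*a^6*b^5)) = kD3_03 at cD3_03 eD3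
  have cD3_04 := cf_D3_04 a b ha ha' hb hb'
  generalize ((0) - (1*a^4*b^4 + 4*a^5*b^4 + 3*a^6*b^4)) = kD3_04 at cD3_04 eD3
  have cbe_10 := cf_be_10 a b ha ha' hb hb'
  generalize ((32*a^1 + 32*a^1*b^1 + 8*a^1*b^2 + 32*a^2 + 44*a^2*b^1 + 20*a^2*b^2 + 3*a^2*b^3) - (0)) = kbe_10 at cbe_10 ebe
  have cbe_01 := cf_be_01 a b ha ha' hb hb'
  generalize ((8*a^1*b^2) - (16*a^2*b^1 + 20*a^3*b^1 + 19*a^3*b^2 + 8*a^3*b^3 + 1*a^3*b^4)) = kbe_01 at cbe_01 ebe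
  have cbe_02 := cf_be_02 a b ha ha' hb hb'
  generalize ((0) - (3*a^2*b^2 + 4*a^3*b^2 + 1*a^3*b^3)) = kbe_02 at cbe_02 ebe
  have hpp : 0 ≤ (b-a)^2 * q^0 := by positivity
  have hpq' : 0 ≤ (b-a)^1 * q^1 := by positivity
  have hqq : 0 ≤ (b-a)^0 * q^2 := by positivity
  have hq3 : 0 ≤ (b-a)^0 * q^3 := by positivity
  have hq4 : 0 ≤ (b-a)^0 * q^4 := by positivity
  have hq32 : (b-a)^0 * q^3 ≤ 1/20 * ((b-a)^0 * q^2) := by linear_combination mul_le_mul_of_nonneg_right hq1 (pow_nonneg hq 2)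
  have hq43 : (b-a)^0 * q^4 ≤ 1/20 * ((b-a)^0 * q^3) := by linear_combination mul_le_mul_of_nonneg_right hq1 (pow_nonneg hq 3)
  have hq21 : (b-a)^0 * q^2 ≤ 1/20 * ((b-a)^0 * q^1) := by linear_combination mul_le_mul_of_nonneg_right hq1 hq
  have hp1 : 0 ≤ (b-a)^1 * q^0 := by positivity
  have hq10 : 0 ≤ (b-a)^0 * q^1 := by positivity
  have hq71 : 7/10 * ((b-a)^0 * q^1) ≤ (b-a)^1 * q^0 := by simpa using hq7
  generalize (b-a)^2 * q^0 = t20 at *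
  generalize (b-a)^1 * q^1 = t11 at *
  generalize (b-a)^0 * q^2 = t02 at *
  generalize (b-a)^0 * q^3 = t03 at *
  generalize (b-a)^0 * q^4 = t04 at *
  have D1l : 0 ≤ X*Z - Y^2 := by rw [eD1]; linarith [mul_le_mul_of_nonneg_right cD1_20.1 hpp, mul_le_mul_of_nonneg_right cD1_11.1 hpq', mul_le_mul_of_nonneg_right cD1_02.1 hqq]
  have D3l : 0 ≤ Y*W - Z^2 := by rw [eD3]; linarith [mul_le_mul_of_nonneg_right cD3_20.1 hpp, mul_le_mul_of_nonneg_right cD3_11.1 hpq', mul_le_mul_of_nonneg_right cD3_02.1 hqq, mul_le_mul_of_nonneg_right cD3_03.1 hq3, mul_le_mul_of_nonneg_right cD3_04.1 hq4]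
  have D13 : Y*W - Z^2 ≤ X*Z - Y^2 := by rw [eD3, eD1]; linarith [mul_le_mul_of_nonneg_right cD1_20.1 hpp, mul_le_mul_of_nonneg_right cD1_11.1 hpq', mul_le_mul_of_nonneg_right cD1_02.1 hqq, mul_le_mul_of_nonneg_right cD3_20.2 hpp, mul_le_mul_of_nonneg_right cD3_11.2 hpq', mul_le_mul_of_nonneg_right cD3_02.2 hqq, mul_le_mul_of_nonneg_right cD3_03.2 hq3, mul_le_mul_of_nonneg_right cD3_04.2 hq4]
  have bel : 0 ≤ b*Y - Z := by rw [ebe]; linarith [mul_le_mul_of_nonneg_right cbe_10.1 hp1, mul_le_mul_of_nonneg_right cbe_01.1 hq10, mul_le_mul_of_nonneg_right cbe_02.1 hqq]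
  have all : 0 ≤ Y - a*X := by rw [eal]; positivity
  refine ⟨?_, ?_, ?_, D1l, D3l, D13, by linarith, by linarith⟩
  · rw [hX]; unfold fX; positivity
  · rw [hY]; unfold fY; positivity
  · rw [hZ]; unfold fZ; positivity

/-- The invariant kept by the recursion from `n = 1` on. -/
def SierInv_s17 (x y z w : ℝ) : Prop :=
  0 < x ∧ 106/125 * x ≤ y ∧ y^2 ≤ x*z ∧ z ≤ 7/8 * y ∧ z^2 ≤ y*w ∧ y*w - z^2 ≤ x*z - y^2

def fP (t : ℝ) : ℝ := (t^2 + 8*t + 8) * (t^2 + 2*t + 2)^2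

lemma step_inv_s17 (x y z w : ℝ) (h : SierInv_s17 x y z w) :
    SierInv_s17 (fX x y z w) (fY x y z w) (fZ x y z w) (fW x y z w) ∧
    y / x ≤ fY x y z w / fX x y z w ∧ fZ x y z w / fY x y z w ≤ z / y ∧
    x^3 * fP (y/x) ≤ fX x y z w ∧ fX x y z w ≤ x^3 * fP (z/y) := by
  obtain ⟨hx, hyx, h1, hzy, h3, h13⟩ := h
  have hy : 0 < y := by linarith
  have hz : 0 < z := by
    have : 0 < x*z := lt_of_lt_of_le (by positivity) h1
    exact (pos_iff_pos_of_mul_pos this).1 hx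
  obtain ⟨a, ha⟩ : ∃ a, a = y/x := ⟨_, rfl⟩
  obtain ⟨b, hb⟩ : ∃ b, b = z/y := ⟨_, rfl⟩
  obtain ⟨q, hq⟩ : ∃ q, q = w/z - z/y := ⟨_, rfl⟩
  have ey : y = x*a := by rw [ha]; field_simp
  have ez : z = x*(a*b) := by rw [ha, hb]; field_simp
  have ew : w = x*(a*b*(b+q)) := by rw [ha, hb, hq]; field_simp; ring
  have ha1 : 106/125 ≤ a := by rw [ha, le_div_iff₀ hx]; exact hyx
  have hab : a ≤ b := by rw [ha, hb, div_le_div_iff₀ hx hy]; nlinarith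
  have hb7 : b ≤ 7/8 := by rw [hb, div_le_iff₀ hy]; exact hzy
  have hq0 : 0 ≤ q := by
    rw [hq, sub_nonneg, div_le_div_iff₀ hy hz]; nlinarith
  have hpq : a*b*q ≤ b - a := by
    have e1 : a*b*q = (y*w - z^2)/(x*y) := by rw [ha, hb, hq]; field_simp
    have e2 : b - a = (x*z - y^2)/(x*y) := by rw [ha, hb]; field_simp
    rw [e1, e2]; gcongr
  have eX : fX x y z w = x^3 * fX 1 a (a*b) (a*b*(b+q)) := by
    rw [ey, ez, ew]; unfold fX; ring
  have eY : fY x y z w = x^3 * fY 1 a (a*b) (a*b*(b+q)) := by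
    rw [ey, ez, ew]; unfold fY; ring
  have eZ : fZ x y z w = x^3 * fZ 1 a (a*b) (a*b*(b+q)) := by
    rw [ey, ez, ew]; unfold fZ; ring
  have eW : fW x y z w = x^3 * fW 1 a (a*b) (a*b*(b+q)) := by
    rw [ey, ez, ew]; unfold fW; ring
  have key := norm_step a b q ha1 hab hb7 hq0 hpq _ _ _ _ rfl rfl rfl rfl
  have hPX : fP a ≤ fX 1 a (a*b) (a*b*(b+q)) ∧ fX 1 a (a*b) (a*b*(b+q)) ≤ fP b := by
    have ha0 : 0 ≤ a := by linarith
    have hb0 : 0 ≤ b := by linarith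
    constructor
    · have : fP a = 32+96*a+24*(a*a)+108*a^2+60*a*(a*a)+9*(a*a)^2+44*a^3+39*a^2*(a*a)+12*a*(a*a)^2+(a*a)^3 := by
        unfold fP; ring
      rw [this]; unfold fX
      simp only [one_pow, mul_one]
      gcongr
    · have : fP b = 32+96*b+24*(b*b)+108*b^2+60*b*(b*b)+9*(b*b)^2+44*b^3+39*b^2*(b*b)+12*b*(b*b)^2+(b*b)^3 := by
        unfold fP; ring
      rw [this]; unfold fX
      simp only [one_pow, mul_one]
      gcongr
  rw [eX, eY, eZ, eW, ← ha, ← hb]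
  generalize fX 1 a (a*b) (a*b*(b+q)) = X at *
  generalize fY 1 a (a*b) (a*b*(b+q)) = Y at *
  generalize fZ 1 a (a*b) (a*b*(b+q)) = Z at *
  generalize fW 1 a (a*b) (a*b*(b+q)) = W at *
  obtain ⟨X0, Y0, Z0, k1, k2, k3, k4, k5⟩ := key
  have hc : 0 < x^3 := by positivity
  generalize x^3 = c at *
  have hcc : 0 ≤ c^2 := by positivity
  refine ⟨⟨by positivity, ?_, ?_, ?_, ?_, ?_⟩, ?_, ?_, ?_, ?_⟩
  · have : 106/125 * X ≤ Y := le_trans (by gcongr) k4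
    linear_combination mul_le_mul_of_nonneg_left this hc.le
  · linear_combination mul_nonneg hcc k1
  · have : Z ≤ 7/8 * Y := k5.trans (by gcongr)
    linear_combination mul_le_mul_of_nonneg_left this hc.le
  · linear_combination mul_nonneg hcc k2
  · linear_combination mul_le_mul_of_nonneg_left k3 hcc
  · rw [mul_div_mul_left _ _ hc.ne', le_div_iff₀ X0]; exact k4
  · rw [mul_div_mul_left _ _ hc.ne', div_le_iff₀ Y0]; exact k5
  · exact mul_le_mul_of_nonneg_left hPX.1 hc.le
  · exact mul_le_mul_of_nonneg_left hPX.2 hc.le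

lemma inv_w (x y z w : ℝ) (h : SierInv_s17 x y z w) :
    0 < y ∧ 0 < z ∧ 0 ≤ w ∧ y ≤ x ∧ z ≤ x ∧ w ≤ x := by
  obtain ⟨hx, hyx, h1, hzy, h3, h13⟩ := h
  have hy : 0 < y := by linarith
  have hz : 0 < z := by
    have : 0 < x*z := lt_of_lt_of_le (by positivity) h1
    exact (pos_iff_pos_of_mul_pos this).1 hx
  have hw : 0 ≤ w := by
    have : 0 < y*w := lt_of_lt_of_le (by positivity) h3
    exact ((pos_iff_pos_of_mul_pos this).1 hy).le
  have hyx' : y ≤ x := by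
    by_contra hc
    push Not at hc
    nlinarith
  refine ⟨hy, hz, hw, hyx', by linarith, ?_⟩
  have : y*w ≤ y*x := by nlinarith
  exact le_of_mul_le_mul_left this hy

/-- The analytic part. -/
lemma squeeze_part (L U e : ℕ → ℝ) (C : ℝ)
    (hL : ∀ n, 1 ≤ n → L n ≤ L (n+1)) (hU : ∀ n, 1 ≤ n → U (n+1) ≤ U n)
    (hLU : ∀ n, 1 ≤ n → L n ≤ U n) (he : ∀ n, 1 ≤ n → |e n| ≤ C) :
    ∃ μ : ℝ, Tendsto (fun n => (7 * 3^n * L n + e n) / (7 * 3^n - 1)) atTop (𝓝 μ) ∧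
      ∀ k, 1 ≤ k → L k ≤ μ ∧ μ ≤ U k := by
  have mL : Monotone (fun n => L (n+1)) := monotone_nat_of_le_succ fun n => hL _ (by omega)
  have mU : Antitone (fun n => U (n+1)) := antitone_nat_of_succ_le fun n => hU _ (by omega)
  have hall : ∀ i j, L (i+1) ≤ U (j+1) := fun i j =>
    (mL (le_max_left i j)).trans ((hLU _ (by omega)).trans (mU (le_max_right i j)))
  have hbdd : BddAbove (Set.range fun n => L (n+1)) := ⟨U 1, by rintro _ ⟨n, rfl⟩; exact hall n 0⟩
  have hlim := tendsto_atTop_ciSup mL hbdd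
  refine ⟨⨆ n, L (n+1), ?_, ?_⟩
  · have hlim' : Tendsto L atTop (𝓝 (⨆ n, L (n+1))) := (tendsto_add_atTop_iff_nat 1).1 hlim
    have h3 : Tendsto (fun n : ℕ => (7:ℝ) * 3^n - 1) atTop atTop :=
      tendsto_atTop_add_const_right _ _
        ((tendsto_pow_atTop_atTop_of_one_lt (by norm_num : (1:ℝ) < 3)).const_mul_atTop (by norm_num))
    have hinv := h3.inv_tendsto_atTop
    have hC : Tendsto (fun n : ℕ => C * ((7:ℝ) * 3^n - 1)⁻¹) atTop (𝓝 0) := by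
      simpa using hinv.const_mul C
    have hpos : ∀ n : ℕ, 0 < (7:ℝ) * 3^n - 1 := fun n => by
      have : (1:ℝ) ≤ 3^n := one_le_pow₀ (by norm_num)
      linarith
    have he0 : Tendsto (fun n : ℕ => e n * ((7:ℝ) * 3^n - 1)⁻¹) atTop (𝓝 0) := by
      refine squeeze_zero_norm' ?_ hC
      filter_upwards [eventually_ge_atTop 1] with n hn
      rw [norm_mul, Real.norm_eq_abs, Real.norm_eq_abs, abs_of_pos (inv_pos.2 (hpos n))]
      exact mul_le_mul_of_nonneg_right (he n hn) (inv_pos.2 (hpos n)).le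
    have := (hlim'.add (hlim'.mul hinv)).add he0
    simp only [mul_zero, add_zero] at this
    refine this.congr fun n => ?_
    have := (hpos n).ne'
    simp only [Pi.inv_apply]
    field_simp
    ring
  · intro k hk
    obtain ⟨j, rfl⟩ : ∃ j, k = j+1 := ⟨k-1, by omega⟩
    exact ⟨le_ciSup hbdd j, ciSup_le fun i => hall i j⟩

lemma fP_mono (s t : ℝ) (hs : 0 ≤ s) (hst : s ≤ t) : fP s ≤ fP t := by
  have ht : 0 ≤ t := hs.trans hst
  unfold fP; gcongr

lemma fP_one (s : ℝ) (hs : 0 ≤ s) : 1 ≤ fP s := by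
  have h := fP_mono 0 s le_rfl hs
  have : fP 0 = 32 := by norm_num [fP]
  linarith

lemma log_fP (t : ℝ) (ht : 0 ≤ t) :
    Real.log (fP t) = Real.log (t^2 + 8*t + 8) + 2 * Real.log (t^2 + 2*t + 2) := by
  unfold fP
  rw [Real.log_mul (by positivity) (by positivity), Real.log_pow]; norm_num

theorem sier_entropy_exists_bounds
    (x y z w : ℕ → ℝ)
    (hx0 : x 0 = 1) (hy0 : y 0 = 0) (hz0 : z 0 = 1) (hw0 : w 0 = 0)
    (hx : ∀ n : ℕ, x (n + 1) = 32 * (x n)^3 + 96 * (x n)^2 * y n + 24 * (x n)^2 * z n + 108 * x n * (y n)^2 + 60 * x n * y n * z n + 9 * x n * (z n)^2 + 44 * (y n)^3 + 39 * (y n)^2 * z n + 12 * y n * (z n)^2 + (z n)^3)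
    (hy : ∀ n : ℕ, y (n + 1) = 32 * (x n)^2 * y n + 32 * (x n)^2 * z n + 8 * (x n)^2 * w n + 64 * x n * (y n)^2 + 88 * x n * y n * z n + 20 * x n * y n * w n + 20 * x n * (z n)^2 + 6 * x n * z n * w n + 36 * (y n)^3 + 64 * (y n)^2 * z n + 13 * (y n)^2 * w n + 29 * y n * (z n)^2 + 8 * y n * z n * w n + 4 * (z n)^3 + (z n)^2 * w n)
    (hz : ∀ n : ℕ, z (n + 1) = 32 * x n * (y n)^2 + 64 * x n * y n * z n + 16 * x n * y n * w n + 36 * x n * (z n)^2 + 20 * x n * z n * w n + 3 * x n * (w n)^2 + 32 * (y n)^3 + 80 * (y n)^2 * z n + 20 * (y n)^2 * w n + 64 * y n * (z n)^2 + 32 * y n * z n * w n + 4 * y n * (w n)^2 + 13 * (z n)^3 + 8 * (z n)^2 * w n + z n * (w n)^2)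
    (hw : ∀ n : ℕ, w (n + 1) = 32 * (y n)^3 + 96 * (y n)^2 * z n + 24 * (y n)^2 * w n + 108 * y n * (z n)^2 + 60 * y n * z n * w n + 9 * y n * (w n)^2 + 44 * (z n)^3 + 39 * (z n)^2 * w n + 12 * z n * (w n)^2 + (w n)^3) :
    ∃ μ : ℝ, Tendsto (fun n => Real.log (x n + 3 * y n + 3 * z n + w n) / ((7 * 3 ^ n - 1) / 2)) atTop (𝓝 μ) ∧ ∀ k : ℕ, 1 ≤ k → (2 * Real.log (x k) + Real.log ((y k / x k)^2 + 8 * (y k / x k) + 8) + 2 * Real.log ((y k / x k)^2 + 2 * (y k / x k) + 2)) / (7 * 3 ^ k) ≤ μ ∧ μ ≤ (2 * Real.log (x k) + Real.log ((z k / y k)^2 + 8 * (z k / y k) + 8) + 2 * Real.log ((z k / y k)^2 + 2 * (z k / y k) + 2)) / (7 * 3 ^ k) := by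
  have sX : ∀ n, x (n+1) = fX (x n) (y n) (z n) (w n) := hx
  have sY : ∀ n, y (n+1) = fY (x n) (y n) (z n) (w n) := hy
  have sZ : ∀ n, z (n+1) = fZ (x n) (y n) (z n) (w n) := hz
  have sW : ∀ n, w (n+1) = fW (x n) (y n) (z n) (w n) := hw
  clear hx hy hz hw
  have inv : ∀ n, 1 ≤ n → SierInv_s17 (x n) (y n) (z n) (w n) := by
    intro n hn
    induction n, hn using Nat.le_induction with
    | base =>
      have e1 := sX 0
      have e2 := sY 0
      have e3 := sZ 0
      have e4 := sW 0
      rw [hx0, hy0, hz0, hw0] at e1 e2 e3 e4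
      norm_num [fX, fY, fZ, fW] at e1 e2 e3 e4
      rw [e1, e2, e3, e4]
      norm_num [SierInv_s17]
    | succ n hn ih =>
      rw [sX, sY, sZ, sW]
      exact (step_inv_s17 _ _ _ _ ih).1
  have pos : ∀ n, 1 ≤ n → 0 < x n ∧ 0 ≤ y n / x n ∧ y n / x n ≤ z n / y n ∧ z n / y n ≤ 7/8 := by
    intro n hn
    have h := inv n hn
    obtain ⟨hy, hz, -⟩ := inv_w _ _ _ _ h
    obtain ⟨hx, hyx, h1, hzy, -⟩ := h
    refine ⟨hx, by positivity, ?_, ?_⟩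
    · rw [div_le_div_iff₀ hx hy]; nlinarith
    · rw [div_le_iff₀ hy]; exact hzy
  have step : ∀ n, 1 ≤ n → y n / x n ≤ y (n+1) / x (n+1) ∧ z (n+1) / y (n+1) ≤ z n / y n ∧
      (x n)^3 * fP (y n / x n) ≤ x (n+1) ∧ x (n+1) ≤ (x n)^3 * fP (z n / y n) := by
    intro n hn
    rw [sX, sY, sZ]
    exact (step_inv_s17 _ _ _ _ (inv n hn)).2
  refine Exists.elim (squeeze_part
    (fun n => (2 * Real.log (x n) + Real.log (fP (y n / x n))) / (7 * 3^n))
    (fun n => (2 * Real.log (x n) + Real.log (fP (z n / y n))) / (7 * 3^n))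
    (fun n => 2 * (Real.log (x n + 3 * y n + 3 * z n + w n) - Real.log (x n)) - Real.log (fP (y n / x n)))
    (2 * Real.log 8 + Real.log (fP (7/8))) ?_ ?_ ?_ ?_) ?_
  rotate_left 4
  · rintro μ ⟨h1, h2⟩
    refine ⟨μ, h1.congr fun n => ?_, fun k hk => ?_⟩
    · rw [mul_div_cancel₀ _ (by positivity), div_div_eq_mul_div]
      congr 1
      ring
    · have := h2 k hk
      obtain ⟨p1, p2, p3, p4⟩ := pos k hk
      simp only [log_fP _ p2, log_fP _ (p2.trans p3)] at this
      simpa only [add_assoc] using this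
  · intro n hn
    obtain ⟨p1, p2, p3, p4⟩ := pos n hn
    obtain ⟨s1, s2, s3, s4⟩ := step n hn
    have f1 := fP_one _ p2
    have l1 := Real.log_le_log (by positivity) s3
    rw [Real.log_mul (by positivity) (by positivity), Real.log_pow] at l1
    have l2 := Real.log_le_log (by positivity) (fP_mono _ _ p2 s1)
    push_cast at l1
    rw [div_le_div_iff₀ (by positivity) (by positivity), pow_succ]
    have : (0:ℝ) < 7 * 3^n := by positivity
    nlinarith
  · intro n hn
    obtain ⟨p1, p2, p3, p4⟩ := pos n hn
    obtain ⟨q1, q2, q3, q4⟩ := pos (n+1) (by omega)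
    obtain ⟨s1, s2, s3, s4⟩ := step n hn
    have f1 := fP_one _ (p2.trans p3)
    have f2 := fP_one _ (q2.trans q3)
    have l1 := Real.log_le_log q1 s4
    rw [Real.log_mul (by positivity) (by positivity), Real.log_pow] at l1
    have l2 := Real.log_le_log (by positivity) (fP_mono _ _ (q2.trans q3) s2)
    push_cast at l1
    rw [div_le_div_iff₀ (by positivity) (by positivity), pow_succ]
    have : (0:ℝ) < 7 * 3^n := by positivity
    nlinarith
  · intro n hn
    obtain ⟨p1, p2, p3, p4⟩ := pos n hn
    have f1 := fP_one _ p2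
    have l2 := Real.log_le_log (by positivity) (fP_mono _ _ p2 p3)
    gcongr
  · intro n hn
    obtain ⟨p1, p2, p3, p4⟩ := pos n hn
    obtain ⟨i1, i2, i3, i4, i5, i6⟩ := inv_w _ _ _ _ (inv n hn)
    have f1 := fP_one _ p2
    have l0 := Real.log_nonneg f1
    have l2 := Real.log_le_log (by positivity) (fP_mono _ _ p2 (p3.trans p4))
    have l3 : Real.log (x n) ≤ Real.log (x n + 3 * y n + 3 * z n + w n) :=
      Real.log_le_log p1 (by linarith)
    have l4 : Real.log (x n + 3 * y n + 3 * z n + w n) ≤ Real.log (8 * x n) :=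
      Real.log_le_log (by positivity) (by linarith)
    rw [Real.log_mul (by norm_num) p1.ne'] at l4
    have l5 : 0 ≤ Real.log 8 := Real.log_nonneg (by norm_num)
    rw [abs_le]
    constructor <;> linarith
end
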